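/- There exist constants C, c > 0 depending only on Ω such that for all ε ∈ (0, 1): sup_{θ⋆ ∈ D} P( sup_{λ ∈ [λ_min, λ_max]} | (1/N)‖θ̂_λ‖₀ − s⋆(λ) | ≥ ε ) ≤ (C/ε⁶) N^q e^{−cNε⁶}. -/

import Mathlib

open MeasureTheory ProbabilityTheory
open scoped ENNReal NNReal

noncomputable section

/-- Standard Gaussian density φ. -/
def gphi (x : ℝ) : ℝ := Real.exp (-x ^ 2 / 2) / Real.sqrt (2 * Real.pi)

/-- Standard Gaussian CDF Φ. -/
def gPhi (x : ℝ) : ℝ := ∫ t in Set.Iic x, gphi t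

/-- Soft thresholding η(x; b) = sign(x)(|x| − b)₊. -/
def eta (x b : ℝ) : ℝ := Real.sign x * max (|x| - b) 0

/-- Derivative in x of soft thresholding: η′(x; b) = 1_{|x| > b}. -/
def eta' (x b : ℝ) : ℝ := if b < |x| then 1 else 0

/-- The ℓ_p ball F_p(ξ) = {x : (1/N) ∑ |xᵢ|^p ≤ ξ^p}. -/
def Fball (N : ℕ) (p ξ : ℝ) : Set (Fin N → ℝ) :=
  {x | (1 / (N : ℝ)) * ∑ i, |x i| ^ p ≤ ξ ^ p}

/-- Number of nonzero entries ‖x‖₀. -/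
def l0 {N : ℕ} (x : Fin N → ℝ) : ℕ := (Finset.univ.filter fun i => x i ≠ 0).card

/-- The ℓ₀ ball F_0(s) = {x : ‖x‖₀ ≤ sN}. -/
def F0ball (N : ℕ) (s : ℝ) : Set (Fin N → ℝ) := {x | (l0 x : ℝ) ≤ s * N}

/-- The critical sparsity s_max(δ). -/
def smax (δ : ℝ) : ℝ :=
  δ * sSup ((fun α : ℝ =>
      (1 - (2 / δ) * ((1 + α ^ 2) * gPhi (-α) - α * gphi α)) /
      (1 + α ^ 2 - 2 * ((1 + α ^ 2) * gPhi (-α) - α * gphi α))) '' Set.Ici 0)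

/-- Empirical distribution of the entries of a vector. -/
def empDist {N : ℕ} (θ : Fin N → ℝ) : Measure ℝ :=
  ((N : ℝ≥0∞))⁻¹ • ∑ i : Fin N, Measure.dirac (θ i)

/-- Empirical distribution of pairs of entries of two vectors. -/
def empDist2 {N : ℕ} (u v : Fin N → ℝ) : Measure (ℝ × ℝ) :=
  ((N : ℝ≥0∞))⁻¹ • ∑ i : Fin N, Measure.dirac (u i, v i)

/-- Squared order-2 Wasserstein distance between measures on ℝ². -/
def W2sq (μ ν : Measure (ℝ × ℝ)) : ℝ :=
  sInf {r : ℝ | ∃ γ : Measure ((ℝ × ℝ) × (ℝ × ℝ)),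
    γ.map Prod.fst = μ ∧ γ.map Prod.snd = ν ∧
    r = ∫ q, ((q.1.1 - q.2.1) ^ 2 + (q.1.2 - q.2.2) ^ 2) ∂γ}

/-- Order-2 Wasserstein distance. -/
def W2 (μ ν : Measure (ℝ × ℝ)) : ℝ := Real.sqrt (W2sq μ ν)

/-- Standard Gaussian measure on ℝ. -/
def stdG : Measure ℝ := gaussianReal 0 1

/-- The state-evolution fixed point equations (for (Θ,Z) ∼ μ ⊗ N(0,1)),
together with positivity of (β, τ). -/
def StateEvo (δ σ : ℝ) (μ : Measure ℝ) (lam β τ : ℝ) : Prop :=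
  0 < β ∧ 0 < τ ∧
  τ ^ 2 = σ ^ 2 + (1 / δ) *
    ∫ q : ℝ × ℝ, (eta (q.1 + τ * q.2) (τ * lam / β) - q.1) ^ 2 ∂(μ.prod stdG) ∧
  β = τ * (1 - (1 / δ) *
    ∫ q : ℝ × ℝ, eta' (q.1 + τ * q.2) (τ * lam / β) ∂(μ.prod stdG))

/-- s⋆ = P(|Θ + τZ| ≥ ατ) for (Θ,Z) ∼ μ ⊗ N(0,1). -/
def sStar (μ : Measure ℝ) (τ α : ℝ) : ℝ :=
  ((μ.prod stdG) {q : ℝ × ℝ | α * τ ≤ |q.1 + τ * q.2|}).toReal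

/-- The limit law μ⋆: law of (η(Θ + τZ; ατ), Θ) for (Θ,Z) ∼ μ ⊗ N(0,1). -/
def muStar (μ : Measure ℝ) (τ α : ℝ) : Measure (ℝ × ℝ) :=
  (μ.prod stdG).map (fun q => (eta (q.1 + τ * q.2) (α * τ), q.1))

/-- The limit law for the debiased Lasso: law of (Θ + τZ, Θ). -/
def muStarD (μ : Measure ℝ) (τ : ℝ) : Measure (ℝ × ℝ) :=
  (μ.prod stdG).map (fun q => (q.1 + τ * q.2, q.1))

/-- Law of the design matrix: i.i.d. N(0, 1/n) entries. -/
def PX (n N : ℕ) : Measure (Fin n → Fin N → ℝ) :=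
  Measure.pi fun _ => Measure.pi fun _ => gaussianReal 0 ((n : ℝ≥0))⁻¹

/-- Law of the noise: i.i.d. standard Gaussian entries. -/
def Pz (n : ℕ) : Measure (Fin n → ℝ) :=
  Measure.pi fun _ => gaussianReal 0 1

/-- Joint law of (X, z). -/
def Pmodel (n N : ℕ) : Measure ((Fin n → Fin N → ℝ) × (Fin n → ℝ)) :=
  (PX n N).prod (Pz n)

/-- The response y = Xθ⋆ + σz. -/
def yvec {n N : ℕ} (σ : ℝ) (θstar : Fin N → ℝ) (X : Fin n → Fin N → ℝ)
    (z : Fin n → ℝ) : Fin n → ℝ :=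
  fun i => (∑ j, X i j * θstar j) + σ * z i

/-- The Lasso cost (1/(2n))‖y − Xθ‖² + (λ/n)‖θ‖₁. -/
def lassoCost {n N : ℕ} (X : Fin n → Fin N → ℝ) (y : Fin n → ℝ) (lam : ℝ)
    (θ : Fin N → ℝ) : ℝ :=
  (1 / (2 * (n : ℝ))) * ∑ i, (y i - ∑ j, X i j * θ j) ^ 2
    + (lam / (n : ℝ)) * ∑ j, |θ j|

/-- The uniformity class: D is either an ℓ_p ball F_p(ξ) or an ℓ₀ ball F_0(s) with
s below the critical sparsity, with the corresponding exponent q. -/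
def DFamSpec (δ : ℝ) (Dfam : (M : ℕ) → Set (Fin M → ℝ)) (q : ℝ) : Prop :=
  (∃ p ξ : ℝ, 0 < p ∧ 0 < ξ ∧ (∀ M, Dfam M = Fball M p ξ) ∧ q = max (1 / p - 1) 0) ∨
  (∃ s : ℝ, 0 ≤ s ∧ s < smax δ ∧ (∀ M, Dfam M = F0ball M s) ∧ q = 0)

set_option linter.unusedSectionVars false

instance : IsProbabilityMeasure stdG := by unfold stdG; infer_instance

lemma hasDerivAt_gaussianPDFReal_std (x : ℝ) :
    HasDerivAt (gaussianPDFReal 0 1) (-x * gaussianPDFReal 0 1 x) x := by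
  unfold gaussianPDFReal
  have h : HasDerivAt (fun x : ℝ => -(x - 0) ^ 2 / (2 * ((1 : ℝ≥0) : ℝ))) (-x) x := by
    have := (((hasDerivAt_id x).sub_const 0).pow 2).neg.div_const (2 * ((1 : ℝ≥0) : ℝ))
    convert! this using 1
    simp
    ring
  have := (h.exp).const_mul ((Real.sqrt (2 * Real.pi * ((1 : ℝ≥0) : ℝ)))⁻¹)
  convert! this using 1
  ring

lemma integral_stdG (f : ℝ → ℝ) : ∫ x, f x ∂stdG = ∫ x, gaussianPDFReal 0 1 x * f x := by
  unfold stdG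
  rw [integral_gaussianReal_eq_integral_smul (by norm_num)]
  simp

lemma integrable_stdG_iff {f : ℝ → ℝ} :
    Integrable f stdG ↔ Integrable (fun x => gaussianPDFReal 0 1 x * f x) := by
  unfold stdG
  rw [gaussianReal_of_var_ne_zero _ (by norm_num)]
  rw [integrable_withDensity_iff_integrable_smul₀' (by fun_prop)
    (.of_forall fun x => gaussianPDF_lt_top)]
  simp only [toReal_gaussianPDF, smul_eq_mul]

lemma integrable_pow_stdG (k : ℕ) : Integrable (fun x : ℝ => x ^ k) stdG := by
  have := (memLp_id_gaussianReal (μ := 0) (v := 1) k).integrable_norm_pow'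
  unfold stdG
  refine (integrable_norm_iff (by fun_prop)).1 ?_
  simpa using this

/-- Gaussian integration by parts in one dimension. -/
lemma stein_one {f f' : ℝ → ℝ} {C : ℝ} (hf : ∀ x, HasDerivAt f (f' x) x)
    (hm : Measurable f') (hC : ∀ x, |f x| ≤ C) (hC' : ∀ x, |f' x| ≤ C) :
    ∫ x, x * f x ∂stdG = ∫ x, f' x ∂stdG := by
  have hfm : Measurable f :=
    (continuous_iff_continuousAt.2 fun x => (hf x).continuousAt).measurable
  have i1 : Integrable f' stdG :=
    Integrable.of_bound hm.aestronglyMeasurable C (.of_forall hC')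
  have i2 : Integrable f stdG :=
    Integrable.of_bound hfm.aestronglyMeasurable C (.of_forall hC)
  have i3 : Integrable (fun x => x * f x) stdG := by
    have := (integrable_pow_stdG 1).mul_bdd (g := f) (c := C) hfm.aestronglyMeasurable
      (.of_forall hC)
    simpa using this
  rw [integral_stdG, integral_stdG]
  rw [integrable_stdG_iff] at i1 i2 i3
  have := integral_mul_deriv_eq_deriv_mul_of_integrable (u := gaussianPDFReal 0 1) (v := f)
    (u' := fun x => -x * gaussianPDFReal 0 1 x)
    (fun x _ => hasDerivAt_gaussianPDFReal_std x) (fun x _ => hf x) i1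
    (by refine i3.neg.congr (.of_forall fun x => ?_); simp; ring) i2
  rw [this, ← integral_neg]
  congr 1; ext x; ring

/-- Standard Gaussian measure on `ι → ℝ`. -/
def stdPi (ι : Type*) [Fintype ι] : Measure (ι → ℝ) := Measure.pi fun _ => stdG

instance (ι : Type*) [Fintype ι] : IsProbabilityMeasure (stdPi ι) := by
  unfold stdPi; infer_instance

section Stein

variable {ι : Type*} [Fintype ι] [DecidableEq ι]

lemma measurable_update_pair (i : ι) :
    Measurable (fun p : (ι → ℝ) × ℝ => Function.update p.1 i p.2) := by
  refine measurable_pi_lambda _ fun j => ?_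
  by_cases h : j = i
  · subst h; simpa using measurable_snd
  · simp only [Function.update_of_ne h]; fun_prop

lemma measurePreserving_update (i : ι) :
    MeasurePreserving (fun p : (ι → ℝ) × ℝ => Function.update p.1 i p.2)
      ((stdPi ι).prod stdG) (stdPi ι) := by
  refine ⟨measurable_update_pair i, ?_⟩
  unfold stdPi
  refine (Measure.pi_eq fun s hs => ?_).symm
  rw [Measure.map_apply (measurable_update_pair i) (MeasurableSet.univ_pi hs)]
  have : (fun p : (ι → ℝ) × ℝ => Function.update p.1 i p.2) ⁻¹' (Set.univ.pi s) =
      (Set.univ.pi (Function.update s i Set.univ)) ×ˢ (s i) := by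
    ext p
    simp only [Set.mem_preimage, Set.mem_univ_pi, Set.mem_prod]
    constructor
    · intro h
      refine ⟨fun j => ?_, by simpa using h i⟩
      by_cases hj : j = i
      · subst hj; simp
      · simpa [hj] using h j
    · rintro ⟨h, h'⟩ j
      by_cases hj : j = i
      · subst hj; simpa using h'
      · simpa [hj] using h j
  rw [this, Measure.prod_prod, Measure.pi_pi]
  rw [← Finset.mul_prod_erase _ _ (Finset.mem_univ i),
    ← Finset.mul_prod_erase Finset.univ (fun j => stdG (s j)) (Finset.mem_univ i)]
  simp only [Function.update_self, measure_univ, one_mul]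
  rw [mul_comm]
  congr 1
  refine Finset.prod_congr rfl fun j hj => ?_
  rw [Function.update_of_ne (Finset.ne_of_mem_erase hj)]

lemma integrable_coord (i : ι) : Integrable (fun x : ι → ℝ => x i) (stdPi ι) := by
  have h : MeasurePreserving (Function.eval i) (stdPi ι) stdG := measurePreserving_eval _ i
  have := h.integrable_comp_of_integrable (integrable_pow_stdG 1)
  simpa [Function.comp_def] using this

lemma integrable_coord_mul {F : (ι → ℝ) → ℝ} {C : ℝ} (hm : Measurable F)
    (hC : ∀ x, |F x| ≤ C) (i : ι) : Integrable (fun x : ι → ℝ => x i * F x) (stdPi ι) :=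
  (integrable_coord i).mul_bdd (c := C) hm.aestronglyMeasurable (.of_forall hC)

/-- Gaussian integration by parts. -/
lemma stein_pi {F F' : (ι → ℝ) → ℝ} {C : ℝ} (i : ι)
    (hf : ∀ x s, HasDerivAt (fun t => F (Function.update x i t)) (F' (Function.update x i s)) s)
    (hm : Measurable F) (hm' : Measurable F') (hC : ∀ x, |F x| ≤ C) (hC' : ∀ x, |F' x| ≤ C) :
    ∫ x, x i * F x ∂(stdPi ι) = ∫ x, F' x ∂(stdPi ι) := by
  have mp := measurePreserving_update (ι := ι) i
  have e1 : Integrable (fun x => x i * F x) (stdPi ι) := integrable_coord_mul hm hC i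
  have e2 : Integrable F' (stdPi ι) :=
    Integrable.of_bound hm'.aestronglyMeasurable C (.of_forall hC')
  have key : ∀ G : (ι → ℝ) → ℝ, Integrable G (stdPi ι) →
      ∫ x, G x ∂(stdPi ι) = ∫ x, ∫ s, G (Function.update x i s) ∂stdG ∂(stdPi ι) := by
    intro G hG
    rw [← integral_prod (fun p : (ι → ℝ) × ℝ => G (Function.update p.1 i p.2))
      (mp.integrable_comp_of_integrable hG)]
    conv_lhs => rw [← mp.map_eq]
    rw [integral_map mp.measurable.aemeasurable (by rw [mp.map_eq]; exact hG.1)]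
  rw [key _ e1, key _ e2]
  congr 1; ext x
  have mu : Measurable fun s : ℝ => Function.update x i s := measurable_update x
  simp only [Function.update_self]
  exact stein_one (hf x) (hm'.comp mu) (fun s => hC _) (fun s => hC' _)

end Stein

section Interp

variable {K ι : Type*} [Fintype K] [Fintype ι]

/-- The linear form with coefficients `c`. -/
def linForm (c : K → ℝ) : (K → ℝ) →L[ℝ] ℝ := ∑ k, c k • ContinuousLinearMap.proj k

lemma linForm_apply (c v : K → ℝ) : linForm c v = ∑ k, c k * v k := by
  simp [linForm]

/-- Gaussian interpolation: if the second derivatives of `f` have the sign of the difference of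
the covariances then the expectations are ordered. -/
lemma gaussian_interpolation {f : (K → ℝ) → ℝ} {f1 : K → (K → ℝ) → ℝ}
    {f2 : K → K → (K → ℝ) → ℝ} {C : ℝ}
    (hf : ∀ x, HasFDerivAt f (linForm fun k => f1 k x) x)
    (hf1 : ∀ k x, HasFDerivAt (f1 k) (linForm fun l => f2 k l x) x)
    (hf2 : ∀ k l, Continuous (f2 k l))
    (h0 : ∀ x, |f x| ≤ C) (h1 : ∀ k x, |f1 k x| ≤ C) (h2 : ∀ k l x, |f2 k l x| ≤ C)
    (B D : K → ι → ℝ) (hBD : ∀ k l, ∑ i, B k i * D l i = 0)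
    (hs : ∀ k l x, 0 ≤ (∑ i, D k i * D l i - ∑ i, B k i * B l i) * f2 k l x) :
    ∫ x, f (fun k => ∑ i, B k i * x i) ∂(stdPi ι) ≤
      ∫ x, f (fun k => ∑ i, D k i * x i) ∂(stdPi ι) := by
  classical
  set A : ℝ → K → ι → ℝ := fun t k i => Real.cos t * B k i + Real.sin t * D k i with hA
  set A' : ℝ → K → ι → ℝ := fun t k i => -Real.sin t * B k i + Real.cos t * D k i with hA'
  set Z : ℝ → (ι → ℝ) → K → ℝ := fun t x k => ∑ i, A t k i * x i with hZ
  have cf : Continuous f := continuous_iff_continuousAt.2 fun x => (hf x).continuousAt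
  have cf1 : ∀ k, Continuous (f1 k) := fun k =>
    continuous_iff_continuousAt.2 fun x => (hf1 k x).continuousAt
  have cZ : ∀ t, Continuous (Z t) := fun t => by
    simp only [hZ]; fun_prop
  have dA : ∀ t k i, HasDerivAt (fun t => A t k i) (A' t k i) t := fun t k i =>
    ((Real.hasDerivAt_cos t).mul_const _).add ((Real.hasDerivAt_sin t).mul_const _)
  have dZ : ∀ t x, HasDerivAt (fun t => Z t x) (fun k => ∑ i, A' t k i * x i) t := fun t x =>
    hasDerivAt_pi.2 fun k => HasDerivAt.fun_sum fun i _ => (dA t k i).mul_const _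
  have dfZ : ∀ t x, HasDerivAt (fun t => f (Z t x))
      (∑ k, f1 k (Z t x) * ∑ i, A' t k i * x i) t := fun t x => by
    have := (hf (Z t x)).comp_hasDerivAt t (dZ t x)
    rwa [linForm_apply] at this
  have hC : 0 ≤ C := (abs_nonneg _).trans (h0 0)
  have bA' : ∀ t k i, |A' t k i| ≤ |B k i| + |D k i| := fun t k i => by
    refine (abs_add_le _ _).trans ?_
    rw [abs_mul, abs_mul, abs_neg]
    have := Real.abs_sin_le_one t
    have := Real.abs_cos_le_one t
    gcongr
    · exact mul_le_of_le_one_left (abs_nonneg _) (by assumption)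
    · exact mul_le_of_le_one_left (abs_nonneg _) (by assumption)
  have main : ∀ t, HasDerivAt (fun t => ∫ x, f (Z t x) ∂(stdPi ι))
      (∫ x, ∑ k, f1 k (Z t x) * ∑ i, A' t k i * x i ∂(stdPi ι)) t := by
    intro t
    refine (hasDerivAt_integral_of_dominated_loc_of_deriv_le (s := Set.univ)
      (bound := fun x => ∑ k, C * ∑ i, (|B k i| + |D k i|) * |x i|) Filter.univ_mem
      (.of_forall fun t => (cf.comp (cZ t)).aestronglyMeasurable)
      (Integrable.of_bound (cf.comp (cZ t)).aestronglyMeasurable C (.of_forall fun x => h0 _))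
      ?_ (.of_forall fun x t _ => ?_) ?_ (.of_forall fun x t _ => dfZ t x)).2
    · refine Continuous.aestronglyMeasurable ?_
      refine continuous_finsetSum _ fun k _ => ((cf1 k).comp (cZ t)).mul ?_
      fun_prop
    · rw [Real.norm_eq_abs]
      refine (Finset.abs_sum_le_sum_abs _ _).trans (Finset.sum_le_sum fun k _ => ?_)
      rw [abs_mul]
      refine mul_le_mul (h1 _ _) ?_ (abs_nonneg _) hC
      refine (Finset.abs_sum_le_sum_abs _ _).trans (Finset.sum_le_sum fun i _ => ?_)
      rw [abs_mul]
      exact mul_le_mul_of_nonneg_right (bA' t k i) (abs_nonneg _)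
    · refine integrable_finsetSum _ fun k _ => Integrable.const_mul ?_ _
      exact integrable_finsetSum _ fun i _ => (integrable_coord i).abs.const_mul _
  have deriv_eq : ∀ t, ∫ x, ∑ k, f1 k (Z t x) * ∑ i, A' t k i * x i ∂(stdPi ι) =
      Real.sin t * Real.cos t * ∑ k, ∑ l, ∫ x, (∑ i, D k i * D l i - ∑ i, B k i * B l i) *
        f2 k l (Z t x) ∂(stdPi ι) := by
    intro t
    have i2 : ∀ k l, Integrable (fun x => f2 k l (Z t x)) (stdPi ι) := fun k l =>
      Integrable.of_bound ((hf2 k l).comp (cZ t)).aestronglyMeasurable C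
        (.of_forall fun x => h2 _ _ _)
    have i1 : ∀ k i, Integrable (fun x => x i * f1 k (Z t x)) (stdPi ι) := fun k i =>
      integrable_coord_mul ((cf1 k).comp (cZ t)).measurable (fun x => h1 k _) i
    have st : ∀ k i, ∫ x, x i * f1 k (Z t x) ∂(stdPi ι) =
        ∑ l, A t l i * ∫ x, f2 k l (Z t x) ∂(stdPi ι) := by
      intro k i
      have := stein_pi (F := fun x => f1 k (Z t x))
        (F' := fun x => ∑ l, A t l i * f2 k l (Z t x))
        (C := max C (∑ l, |A t l i| * C)) i ?_ ((cf1 k).comp (cZ t)).measurable ?_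
        (fun x => (h1 k _).trans (le_max_left _ _)) ?_
      · rw [this, integral_finsetSum _ fun l _ => (i2 k l).const_mul _]
        simp_rw [integral_const_mul]
      · intro x s
        have d1 : HasDerivAt (fun r => Z t (Function.update x i r)) (fun l => A t l i) s := by
          refine hasDerivAt_pi.2 fun l => ?_
          have : (fun r => Z t (Function.update x i r) l) = fun r =>
              A t l i * r + ∑ j ∈ Finset.univ.erase i, A t l j * x j := by
            ext r
            simp only [hZ]
            rw [← Finset.add_sum_erase _ _ (Finset.mem_univ i)]
            simp only [Function.update_self]
            congr 1
            refine Finset.sum_congr rfl fun j hj => ?_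
            rw [Function.update_of_ne (Finset.ne_of_mem_erase hj)]
          rw [this]
          simpa using ((hasDerivAt_id s).const_mul (A t l i)).add_const
            (∑ j ∈ Finset.univ.erase i, A t l j * x j)
        have := (hf1 k (Z t (Function.update x i s))).comp_hasDerivAt s d1
        rw [linForm_apply] at this
        convert! this using 1
        exact Finset.sum_congr rfl fun l _ => mul_comm _ _
      · exact (continuous_finsetSum _ fun l _ =>
          continuous_const.mul ((hf2 k l).comp (cZ t))).measurable
      · intro x
        refine (Finset.abs_sum_le_sum_abs _ _).trans (le_trans ?_ (le_max_right _ _))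
        refine Finset.sum_le_sum fun l _ => ?_
        rw [abs_mul]
        exact mul_le_mul_of_nonneg_left (h2 _ _ _) (abs_nonneg _)
    have e1 : ∀ x, ∑ k, f1 k (Z t x) * ∑ i, A' t k i * x i =
        ∑ k, ∑ i, A' t k i * (x i * f1 k (Z t x)) := fun x => by
      refine Finset.sum_congr rfl fun k _ => ?_
      rw [Finset.mul_sum]
      exact Finset.sum_congr rfl fun i _ => by ring
    simp_rw [e1]
    rw [integral_finsetSum _ fun k _ => integrable_finsetSum _ fun i _ => (i1 k i).const_mul _]
    rw [Finset.mul_sum]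
    refine Finset.sum_congr rfl fun k _ => ?_
    rw [integral_finsetSum _ fun i _ => (i1 k i).const_mul _]
    simp_rw [integral_const_mul, st]
    simp_rw [Finset.mul_sum]
    rw [Finset.sum_comm]
    refine Finset.sum_congr rfl fun l _ => ?_
    have : ∑ i, A' t k i * A t l i = Real.sin t * Real.cos t *
        (∑ i, D k i * D l i - ∑ i, B k i * B l i) := by
      have x1 := hBD k l
      have x2 := hBD l k
      have : ∀ i, A' t k i * A t l i = Real.sin t * Real.cos t * (D k i * D l i) -
          Real.sin t * Real.cos t * (B k i * B l i) - (Real.sin t) ^ 2 * (B k i * D l i) +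
          (Real.cos t) ^ 2 * (B l i * D k i) := fun i => by simp only [hA, hA']; ring
      simp_rw [this]
      rw [Finset.sum_add_distrib, Finset.sum_sub_distrib, Finset.sum_sub_distrib]
      simp_rw [← Finset.mul_sum]
      rw [x1, x2]; ring
    rw [← mul_assoc, ← this, Finset.sum_mul]
    exact Finset.sum_congr rfl fun i _ => by ring
  have mono : MonotoneOn (fun t => ∫ x, f (Z t x) ∂(stdPi ι)) (Set.Icc 0 (Real.pi / 2)) := by
    refine monotoneOn_of_deriv_nonneg (convex_Icc _ _)
      (fun t _ => (main t).continuousAt.continuousWithinAt)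
      (fun t _ => (main t).differentiableAt.differentiableWithinAt) fun t ht => ?_
    rw [interior_Icc] at ht
    rw [(main t).deriv, deriv_eq]
    refine mul_nonneg (mul_nonneg ?_ ?_) (Finset.sum_nonneg fun k _ => Finset.sum_nonneg
      fun l _ => integral_nonneg fun x => hs k l _)
    · exact Real.sin_nonneg_of_nonneg_of_le_pi ht.1.le (by linarith [ht.2, Real.pi_pos])
    · exact Real.cos_nonneg_of_neg_pi_div_two_le_of_le (by linarith [ht.1, Real.pi_pos]) ht.2.le
  have hp := Real.pi_pos
  have := mono (Set.left_mem_Icc.2 (by positivity)) (Set.right_mem_Icc.2 (by positivity))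
    (by positivity : (0:ℝ) ≤ Real.pi / 2)
  simpa [hZ, hA] using this

end Interp

section SmoothBounded

variable {K : Type*} [Fintype K] [DecidableEq K]

/-- Bounded `C¹` functions with bounded partial derivatives. -/
def SmoothBdd (h : (K → ℝ) → ℝ) : Prop :=
  ∃ (h' : K → (K → ℝ) → ℝ) (C : ℝ), (∀ x, HasFDerivAt h (linForm fun k => h' k x) x) ∧
    (∀ k, Continuous (h' k)) ∧ (∀ x, |h x| ≤ C) ∧ ∀ k x, |h' k x| ≤ C

lemma HasFDerivAt.partial_linForm {h : (K → ℝ) → ℝ} {c : K → ℝ} {x : K → ℝ}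
    (hh : HasFDerivAt h (linForm c) x) (k : K) :
    HasDerivAt (fun t => h (Function.update x k t)) (c k) (x k) := by
  have hh' : HasFDerivAt h (linForm c) (Function.update x k (x k)) := by simpa using hh
  have := hh'.comp_hasDerivAt (x k) (hasDerivAt_update x k (x k))
  rw [linForm_apply] at this
  convert! this using 1
  simp [Pi.single_apply]

lemma SmoothBdd.const (c : ℝ) : SmoothBdd (fun _ : K → ℝ => c) :=
  ⟨fun _ _ => 0, |c|, fun x => by
    have : linForm (fun _ : K => (0 : ℝ)) = 0 := by ext; simp [linForm]
    rw [this]; exact hasFDerivAt_const c x, fun _ => continuous_const, fun _ => le_rfl,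
    fun _ _ => by simp⟩

lemma SmoothBdd.const_sub {h : (K → ℝ) → ℝ} (hh : SmoothBdd h) (c : ℝ) :
    SmoothBdd (fun x => c - h x) := by
  obtain ⟨h', C, h1, h2, h3, h4⟩ := hh
  refine ⟨fun k x => - h' k x, |c| + C, fun x => ?_, fun k => (h2 k).neg, fun x => ?_,
    fun k x => ?_⟩
  · have : linForm (fun k => - h' k x) = - linForm (fun k => h' k x) := by
      ext; simp [linForm]
    rw [this]; exact (h1 x).const_sub c
  · exact (abs_sub _ _).trans (by linarith [h3 x])
  · rw [abs_neg]; linarith [h4 k x, abs_nonneg c]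

lemma SmoothBdd.mul {g h : (K → ℝ) → ℝ} (hg : SmoothBdd g) (hh : SmoothBdd h) :
    SmoothBdd (fun x => g x * h x) := by
  obtain ⟨g', C, g1, g2, g3, g4⟩ := hg
  obtain ⟨h', D, h1, h2, h3, h4⟩ := hh
  have cg : Continuous g := continuous_iff_continuousAt.2 fun x => (g1 x).continuousAt
  have ch : Continuous h := continuous_iff_continuousAt.2 fun x => (h1 x).continuousAt
  have hC : 0 ≤ C := (abs_nonneg _).trans (g3 0)
  have hD : 0 ≤ D := (abs_nonneg _).trans (h3 0)
  refine ⟨fun k x => g x * h' k x + h x * g' k x, C * D + D * C, fun x => ?_,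
    fun k => (cg.mul (h2 k)).add (ch.mul (g2 k)), fun x => ?_, fun k x => ?_⟩
  · have : linForm (fun k => g x * h' k x + h x * g' k x) =
        g x • linForm (fun k => h' k x) + h x • linForm (fun k => g' k x) := by
      ext v; simp [linForm, Finset.mul_sum, Finset.sum_add_distrib, add_mul, mul_assoc]
    rw [this]; exact (g1 x).mul (h1 x)
  · rw [abs_mul]
    have := mul_le_mul (g3 x) (h3 x) (abs_nonneg _) hC
    nlinarith
  · refine (abs_add_le _ _).trans ?_
    rw [abs_mul, abs_mul]
    exact add_le_add (mul_le_mul (g3 x) (h4 k x) (abs_nonneg _) hC)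
      (mul_le_mul (h3 x) (g4 k x) (abs_nonneg _) hD)

lemma SmoothBdd.prod {α : Type*} (s : Finset α) {h : α → (K → ℝ) → ℝ}
    (hh : ∀ a, SmoothBdd (h a)) : SmoothBdd (fun x => ∏ a ∈ s, h a x) := by
  classical
  induction s using Finset.induction_on with
  | empty => simpa using SmoothBdd.const 1
  | insert a s ha ih => simp_rw [Finset.prod_insert ha]; exact (hh a).mul ih

lemma hasDerivAt_sigmoid_neg_mul (L c t : ℝ) :
    HasDerivAt (fun t => Real.sigmoid (-(L * (t + c))))
      (-(L * (Real.sigmoid (-(L * (t + c))) * (1 - Real.sigmoid (-(L * (t + c))))))) t := by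
  have h1 : HasDerivAt (fun t => -(L * (t + c))) (-L) t := by
    simpa using (((hasDerivAt_id t).add_const c).const_mul L).fun_neg
  have := (Real.hasDerivAt_sigmoid (-(L * (t + c)))).comp t h1
  convert! this using 1
  ring

lemma SmoothBdd.sigmoid_coord (L c : ℝ) (k : K) :
    SmoothBdd (fun x : K → ℝ => Real.sigmoid (-(L * (x k + c)))) := by
  refine ⟨fun l x => if l = k then
    -(L * (Real.sigmoid (-(L * (x k + c))) * (1 - Real.sigmoid (-(L * (x k + c)))))) else 0,
    1 + |L|, fun x => ?_, fun l => ?_, fun x => ?_, fun l x => ?_⟩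
  · have := (hasDerivAt_sigmoid_neg_mul L c (x k)).comp_hasFDerivAt x
      (ContinuousLinearMap.proj (R := ℝ) (φ := fun _ : K => ℝ) k).hasFDerivAt
    convert! this using 1
    ext v
    simp [linForm]
  · by_cases h : l = k
    · simp only [h, if_true]
      have : Continuous fun x : K → ℝ => Real.sigmoid (-(L * (x k + c))) :=
        continuous_sigmoid.comp (by fun_prop)
      fun_prop
    · simp only [h, if_false]; exact continuous_const
  · have := Real.sigmoid_pos (-(L * (x k + c)))
    have := Real.sigmoid_lt_one (-(L * (x k + c)))
    rw [abs_le]; constructor <;> linarith [abs_nonneg L]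
  · have h1 := Real.sigmoid_pos (-(L * (x k + c)))
    have h2 := Real.sigmoid_lt_one (-(L * (x k + c)))
    dsimp only
    split_ifs
    · rw [abs_neg, abs_mul]
      have : |Real.sigmoid (-(L * (x k + c))) * (1 - Real.sigmoid (-(L * (x k + c))))| ≤ 1 := by
        rw [abs_le]; constructor <;> nlinarith
      nlinarith [abs_nonneg L]
    · simp; positivity

end SmoothBounded

section Finite

variable {I J ι : Type*} [Fintype I] [Fintype J] [Fintype ι] [DecidableEq I] [DecidableEq J]

/-- Smooth surrogate of the indicator that each row has a positive entry. -/
def rowSmooth (L : ℝ) (c : I → J → ℝ) (x : I × J → ℝ) : ℝ :=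
  ∏ i, (1 - ∏ j, Real.sigmoid (-(L * (x (i, j) + c i j))))

/-- Partial derivatives of `rowSmooth`. -/
def rowSmoothD (L : ℝ) (c : I → J → ℝ) (k : I × J) (x : I × J → ℝ) : ℝ :=
  (∏ i ∈ Finset.univ.erase k.1, (1 - ∏ j, Real.sigmoid (-(L * (x (i, j) + c i j))))) *
    ((∏ j ∈ Finset.univ.erase k.2, Real.sigmoid (-(L * (x (k.1, j) + c k.1 j)))) *
      (L * (Real.sigmoid (-(L * (x k + c k.1 k.2))) *
        (1 - Real.sigmoid (-(L * (x k + c k.1 k.2)))))))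

lemma smoothBdd_rowSmooth (L : ℝ) (c : I → J → ℝ) : SmoothBdd (rowSmooth L c) :=
  SmoothBdd.prod _ fun i => (SmoothBdd.prod _ fun j =>
    SmoothBdd.sigmoid_coord L (c i j) (i, j)).const_sub 1

lemma smoothBdd_rowSmoothD (L : ℝ) (c : I → J → ℝ) (k : I × J) :
    SmoothBdd (rowSmoothD L c k) :=
  (SmoothBdd.prod _ fun i => (SmoothBdd.prod _ fun j =>
    SmoothBdd.sigmoid_coord L (c i j) (i, j)).const_sub 1).mul
    ((SmoothBdd.prod _ fun j => SmoothBdd.sigmoid_coord L (c k.1 j) (k.1, j)).mul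
      ((SmoothBdd.const L).mul ((SmoothBdd.sigmoid_coord L (c k.1 k.2) k).mul
        ((SmoothBdd.sigmoid_coord L (c k.1 k.2) k).const_sub 1))))

lemma hasDerivAt_rowSmooth (L : ℝ) (c : I → J → ℝ) (k : I × J) (x : I × J → ℝ) :
    HasDerivAt (fun t => rowSmooth L c (Function.update x k t)) (rowSmoothD L c k x) (x k) := by
  obtain ⟨i, j⟩ := k
  have e : (fun t => rowSmooth L c (Function.update x (i, j) t)) = fun t =>
      (∏ i' ∈ Finset.univ.erase i, (1 - ∏ j, Real.sigmoid (-(L * (x (i', j) + c i' j))))) *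
      (1 - (∏ j' ∈ Finset.univ.erase j, Real.sigmoid (-(L * (x (i, j') + c i j')))) *
        Real.sigmoid (-(L * (t + c i j)))) := by
    ext t
    unfold rowSmooth
    rw [← Finset.mul_prod_erase _ _ (Finset.mem_univ i), mul_comm]
    congr 1
    · refine Finset.prod_congr rfl fun i' hi' => ?_
      have : ∀ j', (i', j') ≠ (i, j) := fun j' h => (Finset.ne_of_mem_erase hi') (by simp_all)
      simp [Function.update_of_ne (this _)]
    · rw [← Finset.mul_prod_erase _ _ (Finset.mem_univ j), mul_comm]
      simp only [Function.update_self]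
      congr 2
      refine Finset.prod_congr rfl fun j' hj' => ?_
      have : (i, j') ≠ (i, j) := fun h => (Finset.ne_of_mem_erase hj') (by simp_all)
      rw [Function.update_of_ne this]
  rw [e]
  have := (((hasDerivAt_sigmoid_neg_mul L (c i j) (x (i, j))).const_mul
    (∏ j' ∈ Finset.univ.erase j, Real.sigmoid (-(L * (x (i, j') + c i j'))))).const_sub 1).const_mul
    (∏ i' ∈ Finset.univ.erase i, (1 - ∏ j, Real.sigmoid (-(L * (x (i', j) + c i' j)))))
  convert! this using 1
  unfold rowSmoothD
  ring

lemma rowSmoothD_monotone {L : ℝ} (hL : 0 ≤ L) (c : I → J → ℝ) (k l : I × J) (h : k.1 ≠ l.1)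
    (x : I × J → ℝ) : Monotone fun t => rowSmoothD L c k (Function.update x l t) := by
  intro s t hst
  have p1 : ∀ u : ℝ, 0 ≤ Real.sigmoid u := fun u => (Real.sigmoid_pos u).le
  have p2 : ∀ u : ℝ, 0 ≤ 1 - Real.sigmoid u := fun u => by linarith [Real.sigmoid_lt_one u]
  have e : ∀ j (u : ℝ), Function.update x l u (k.1, j) = x (k.1, j) := fun j u =>
    Function.update_of_ne (fun h' => h (by rw [← h'])) _ _
  simp only [rowSmoothD, e]
  refine mul_le_mul_of_nonneg_right (Finset.prod_le_prod (fun i _ => ?_) fun i _ => ?_) ?_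
  · rw [sub_nonneg]
    exact Finset.prod_le_one (fun j _ => p1 _) fun j _ => (Real.sigmoid_lt_one _).le
  · rw [sub_le_sub_iff_left]
    refine Finset.prod_le_prod (fun j _ => p1 _) fun j _ => Real.sigmoid_monotone ?_
    have : Function.update x l s (i, j) ≤ Function.update x l t (i, j) := by
      by_cases h' : (i, j) = l
      · subst h'; simpa
      · simp [Function.update_of_ne h']
    nlinarith
  · exact mul_nonneg (Finset.prod_nonneg fun j _ => p1 _)
      (mul_nonneg hL (mul_nonneg (p1 _) (p2 _)))

/-- Expectation form of Gordon's inequality for the smooth surrogate. -/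
lemma gordon_smooth {L : ℝ} (hL : 0 ≤ L) (c : I → J → ℝ) (B D : I → J → ι → ℝ)
    (h0 : ∀ i j i' j', ∑ p, B i j p * D i' j' p = 0)
    (hsame : ∀ i j j', ∑ p, D i j p * D i j' p = ∑ p, B i j p * B i j' p)
    (hdiff : ∀ i j i' j', ∑ p, B i j p * B i' j' p ≤ ∑ p, D i j p * D i' j' p) :
    ∫ x, rowSmooth L c (fun k => ∑ p, B k.1 k.2 p * x p) ∂(stdPi ι) ≤
      ∫ x, rowSmooth L c (fun k => ∑ p, D k.1 k.2 p * x p) ∂(stdPi ι) := by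
  obtain ⟨f1, C, a1, a2, a3, a4⟩ := smoothBdd_rowSmooth L c
  choose f2 C2 b1 b2 b3 b4 using smoothBdd_rowSmoothD (I := I) (J := J) L c
  have e1 : f1 = rowSmoothD L c := by
    ext k x
    exact ((a1 x).partial_linForm k).unique (hasDerivAt_rowSmooth L c k x)
  subst e1
  have hC2 : ∀ k, C2 k ≤ C + ∑ k, |C2 k| := fun k => by
    have h1 := Finset.single_le_sum (f := fun k => |C2 k|) (fun k _ => abs_nonneg _)
      (Finset.mem_univ k)
    have h2 := (abs_nonneg _).trans (a3 0)
    have h3 := le_abs_self (C2 k)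
    linarith
  have hC : C ≤ C + ∑ k, |C2 k| := by
    have := Finset.sum_nonneg (s := Finset.univ) (f := fun k => |C2 k|) fun k _ => abs_nonneg _
    linarith
  refine gaussian_interpolation (f1 := rowSmoothD L c) (f2 := f2) (C := C + ∑ k, |C2 k|)
    a1 (fun k x => b1 k x) b2 (fun x => (a3 x).trans hC) (fun k x => (a4 k x).trans hC)
    (fun k l x => (b4 k l x).trans (hC2 k)) (fun k => B k.1 k.2) (fun k => D k.1 k.2)
    (fun k l => h0 _ _ _ _) fun k l x => ?_
  by_cases h : k.1 = l.1
  · have := hsame k.1 k.2 l.2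
    rw [h] at this ⊢
    rw [this]; simp
  · refine mul_nonneg (sub_nonneg.2 (hdiff _ _ _ _)) ?_
    have := (b1 k x).partial_linForm l
    rw [← this.deriv]
    exact (rowSmoothD_monotone hL c k l h x).deriv_nonneg

end Finite

section Gordon

/-- Pointwise limit of steep sigmoids. -/
def stepHalf (t : ℝ) : ℝ := if t < 0 then 1 else if t = 0 then 1 / 2 else 0

lemma tendsto_sigmoid_stepHalf (t : ℝ) :
    Filter.Tendsto (fun L : ℕ => Real.sigmoid (-((L : ℝ) * t))) Filter.atTop
      (nhds (stepHalf t)) := by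
  unfold stepHalf
  rcases lt_trichotomy t 0 with h | h | h
  · simp only [h, if_true]
    refine Real.tendsto_sigmoid_atTop.comp ?_
    have : Filter.Tendsto (fun L : ℕ => (L : ℝ) * (-t)) Filter.atTop Filter.atTop :=
      tendsto_natCast_atTop_atTop.atTop_mul_const (by linarith)
    simpa using this
  · subst h
    simp [Real.sigmoid_zero]
  · simp only [not_lt.2 h.le, h.ne', if_false]
    refine Real.tendsto_sigmoid_atBot.comp ?_
    refine Filter.tendsto_neg_atTop_atBot.comp ?_
    exact tendsto_natCast_atTop_atTop.atTop_mul_const h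

lemma stepHalf_mem (t : ℝ) : 0 ≤ stepHalf t ∧ stepHalf t ≤ 1 := by
  unfold stepHalf; split_ifs <;> norm_num

variable {I J ι : Type*} [Fintype I] [Fintype J] [Fintype ι] [DecidableEq I] [DecidableEq J]

lemma rowSmooth_mem (L : ℝ) (c : I → J → ℝ) (x : I × J → ℝ) :
    0 ≤ rowSmooth L c x ∧ rowSmooth L c x ≤ 1 := by
  have p1 : ∀ u : ℝ, 0 ≤ Real.sigmoid u := fun u => (Real.sigmoid_pos u).le
  have h : ∀ i, ∏ j, Real.sigmoid (-(L * (x (i, j) + c i j))) ≤ 1 := fun i =>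
    Finset.prod_le_one (fun j _ => p1 _) fun j _ => (Real.sigmoid_lt_one _).le
  refine ⟨Finset.prod_nonneg fun i _ => sub_nonneg.2 (h i),
    Finset.prod_le_one (fun i _ => sub_nonneg.2 (h i)) fun i _ => ?_⟩
  linarith [Finset.prod_nonneg (s := Finset.univ)
    (f := fun j => Real.sigmoid (-(L * (x (i, j) + c i j)))) fun j _ => p1 _]

/-- Limit of `rowSmooth` for infinite steepness. -/
def rowStep (c : I → J → ℝ) (y : I × J → ℝ) : ℝ := ∏ i, (1 - ∏ j, stepHalf (y (i, j) + c i j))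

lemma measurable_rowStep (c : I → J → ℝ) : Measurable (rowStep c) := by
  have : Measurable stepHalf := by
    unfold stepHalf
    exact Measurable.ite measurableSet_Iio measurable_const
      (Measurable.ite (measurableSet_singleton 0) measurable_const measurable_const)
  exact Finset.measurable_fun_prod _ fun i _ => measurable_const.sub
    (Finset.measurable_fun_prod _ fun j _ => this.comp (by fun_prop))

lemma rowStep_mem (c : I → J → ℝ) (y : I × J → ℝ) : 0 ≤ rowStep c y ∧ rowStep c y ≤ 1 := by
  have h : ∀ i, ∏ j, stepHalf (y (i, j) + c i j) ≤ 1 := fun i =>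
    Finset.prod_le_one (fun j _ => (stepHalf_mem _).1) fun j _ => (stepHalf_mem _).2
  refine ⟨Finset.prod_nonneg fun i _ => sub_nonneg.2 (h i),
    Finset.prod_le_one (fun i _ => sub_nonneg.2 (h i)) fun i _ => ?_⟩
  linarith [Finset.prod_nonneg (s := Finset.univ)
    (f := fun j => stepHalf (y (i, j) + c i j)) fun j _ => (stepHalf_mem _).1]

lemma rowStep_eq_zero {c : I → J → ℝ} {y : I × J → ℝ} {i : I}
    (hi : ∀ j, y (i, j) + c i j < 0) : rowStep c y = 0 := by
  refine Finset.prod_eq_zero (Finset.mem_univ i) ?_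
  rw [sub_eq_zero, eq_comm]
  exact Finset.prod_eq_one fun j _ => by simp [stepHalf, hi j]

lemma rowStep_eq_one {c : I → J → ℝ} {y : I × J → ℝ}
    (h : ∀ i, ∃ j, 0 < y (i, j) + c i j) : rowStep c y = 1 := by
  refine Finset.prod_eq_one fun i _ => ?_
  obtain ⟨j, hj⟩ := h i
  rw [Finset.prod_eq_zero (Finset.mem_univ j), sub_zero]
  simp [stepHalf, not_lt.2 hj.le, hj.ne']

lemma measurable_pairForm (E : I → J → ι → ℝ) :
    Measurable fun (x : ι → ℝ) (k : I × J) => ∑ p, E k.1 k.2 p * x p :=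
  measurable_pi_lambda _ fun _ => Finset.measurable_fun_sum _ fun p _ =>
    (measurable_pi_apply p).const_mul _

lemma tendsto_rowSmooth (c : I → J → ℝ) (y : I × J → ℝ) :
    Filter.Tendsto (fun L : ℕ => rowSmooth (L : ℝ) c y) Filter.atTop (nhds (rowStep c y)) :=
  tendsto_finsetProd _ fun _ _ => tendsto_const_nhds.sub
    (tendsto_finsetProd _ fun _ _ => tendsto_sigmoid_stepHalf _)

lemma tendsto_integral_rowSmooth (c : I → J → ℝ) (E : I → J → ι → ℝ) :
    Filter.Tendsto
      (fun L : ℕ => ∫ x, rowSmooth L c (fun k => ∑ p, E k.1 k.2 p * x p) ∂(stdPi ι))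
      Filter.atTop (nhds (∫ x, rowStep c (fun k => ∑ p, E k.1 k.2 p * x p) ∂(stdPi ι))) := by
  refine MeasureTheory.tendsto_integral_of_dominated_convergence (fun _ => 1) (fun L => ?_)
    (integrable_const _) (fun L => .of_forall fun x => ?_)
    (.of_forall fun x => tendsto_rowSmooth c _)
  · obtain ⟨_, _, a1, -⟩ := smoothBdd_rowSmooth (L : ℝ) c
    have : Continuous (rowSmooth (L : ℝ) c) :=
      continuous_iff_continuousAt.2 fun x => (a1 x).continuousAt
    exact (this.measurable.comp (measurable_pairForm E)).aestronglyMeasurable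
  · have := rowSmooth_mem (L : ℝ) c (fun k => ∑ p, E k.1 k.2 p * x p)
    rw [Real.norm_eq_abs, abs_of_nonneg this.1]; exact this.2

lemma measure_le_of_integral_le {Ω : Type*} [MeasurableSpace Ω] {μ : Measure Ω}
    [IsProbabilityMeasure μ] {F G : Ω → ℝ} {S T : Set Ω} (mF : Measurable F) (mG : Measurable G)
    (hF : ∀ x, 0 ≤ F x ∧ F x ≤ 1) (hG : ∀ x, 0 ≤ G x ∧ G x ≤ 1)
    (key : ∫ x, F x ∂μ ≤ ∫ x, G x ∂μ) (hS : ∀ x ∈ S, G x = 0) (hT : ∀ x, x ∉ T → F x = 1) :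
    μ S ≤ μ T := by
  have iF : Integrable F μ := Integrable.of_bound mF.aestronglyMeasurable 1
    (.of_forall fun x => by rw [Real.norm_eq_abs, abs_of_nonneg (hF x).1]; exact (hF x).2)
  have iG : Integrable G μ := Integrable.of_bound mG.aestronglyMeasurable 1
    (.of_forall fun x => by rw [Real.norm_eq_abs, abs_of_nonneg (hG x).1]; exact (hG x).2)
  have mS : MeasurableSet {x | G x ≤ 0} := measurableSet_le mG measurable_const
  have mT : MeasurableSet {x | F x < 1} := measurableSet_lt mF measurable_const
  refine (measure_mono (t := {x | G x ≤ 0}) fun x hx => (hS x hx).le).trans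
    (le_trans ?_ (measure_mono (s := {x | F x < 1}) fun x hx => ?_))
  · rw [← ENNReal.toReal_le_toReal (measure_ne_top _ _) (measure_ne_top _ _)]
    have e1 : (μ {x | G x ≤ 0}).toReal = ∫ x, Set.indicator {x | G x ≤ 0} (1 : Ω → ℝ) x ∂μ := by
      rw [integral_indicator_one mS]; rfl
    have e2 : (μ {x | F x < 1}).toReal = ∫ x, Set.indicator {x | F x < 1} (1 : Ω → ℝ) x ∂μ := by
      rw [integral_indicator_one mT]; rfl
    rw [e1, e2]
    have l1 : ∫ x, Set.indicator {x | G x ≤ 0} (1 : Ω → ℝ) x ∂μ ≤ ∫ x, (1 - G x) ∂μ := by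
      refine integral_mono ((integrable_const (1 : ℝ)).indicator mS)
        ((integrable_const 1).sub iG) fun x => ?_
      by_cases hx : x ∈ {x | G x ≤ 0}
      · rw [Set.indicator_of_mem hx]
        have : G x ≤ 0 := hx
        simpa using this
      · rw [Set.indicator_of_notMem hx]
        simpa using (hG x).2
    have l2 : ∫ x, (1 - F x) ∂μ ≤ ∫ x, Set.indicator {x | F x < 1} (1 : Ω → ℝ) x ∂μ := by
      refine integral_mono ((integrable_const 1).sub iF)
        ((integrable_const (1 : ℝ)).indicator mT) fun x => ?_
      by_cases hx : x ∈ {x | F x < 1}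
      · rw [Set.indicator_of_mem hx]
        simpa using (hF x).1
      · rw [Set.indicator_of_notMem hx]
        have : ¬ F x < 1 := hx
        simp only [not_lt] at this
        simpa using this
    refine l1.trans (le_trans ?_ l2)
    rw [integral_sub (integrable_const 1) iF, integral_sub (integrable_const 1) iG]
    linarith
  · by_contra h
    have := hT x h
    have h2 : F x < 1 := hx
    linarith

lemma stdPi_rows_le_of_integral_le {c : I → J → ℝ} {B D : I → J → ι → ℝ}
    (key : ∫ x, rowStep c (fun k => ∑ p, B k.1 k.2 p * x p) ∂(stdPi ι) ≤
      ∫ x, rowStep c (fun k => ∑ p, D k.1 k.2 p * x p) ∂(stdPi ι)) :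
    stdPi ι {x | ∃ i, ∀ j, ∑ p, D i j p * x p + c i j < 0} ≤
      stdPi ι {x | ∃ i, ∀ j, ∑ p, B i j p * x p + c i j ≤ 0} := by
  have hm : ∀ E : I → J → ι → ℝ,
      Measurable fun x : ι → ℝ => rowStep c (fun k => ∑ p, E k.1 k.2 p * x p) := fun E =>
    (measurable_rowStep c).comp (measurable_pairForm E)
  refine measure_le_of_integral_le (hm B) (hm D) (fun _ => rowStep_mem _ _)
    (fun _ => rowStep_mem _ _) key ?_ ?_
  · rintro x ⟨i, hi⟩
    exact rowStep_eq_zero hi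
  · intro x hx
    simp only [Set.mem_ofPred_eq, not_exists, not_forall, not_le] at hx
    exact rowStep_eq_one hx

lemma gordon_finite (c : I → J → ℝ) (B D : I → J → ι → ℝ)
    (h0 : ∀ i j i' j', ∑ p, B i j p * D i' j' p = 0)
    (hsame : ∀ i j j', ∑ p, D i j p * D i j' p = ∑ p, B i j p * B i j' p)
    (hdiff : ∀ i j i' j', ∑ p, B i j p * B i' j' p ≤ ∑ p, D i j p * D i' j' p) :
    stdPi ι {x | ∃ i, ∀ j, ∑ p, D i j p * x p + c i j < 0} ≤
      stdPi ι {x | ∃ i, ∀ j, ∑ p, B i j p * x p + c i j ≤ 0} :=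
  stdPi_rows_le_of_integral_le (le_of_tendsto_of_tendsto' (tendsto_integral_rowSmooth c B)
    (tendsto_integral_rowSmooth c D) fun L =>
      gordon_smooth (Nat.cast_nonneg L) c B D h0 hsame hdiff)

/-- Gordon's comparison inequality for countable families. -/
lemma gordon_seq (c : ℕ → ℕ → ℝ) (B D : ℕ → ℕ → ι → ℝ)
    (h0 : ∀ i j i' j', ∑ p, B i j p * D i' j' p = 0)
    (hsame : ∀ i j j', ∑ p, D i j p * D i j' p = ∑ p, B i j p * B i j' p)
    (hdiff : ∀ i j i' j', ∑ p, B i j p * B i' j' p ≤ ∑ p, D i j p * D i' j' p) :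
    stdPi ι {x | ∃ i, ∀ j, ∑ p, D i j p * x p + c i j < 0} ≤
      stdPi ι {x | ∃ i, ∀ j, ∑ p, B i j p * x p + c i j ≤ 0} := by
  have step : ∀ m k : ℕ, stdPi ι {x | ∃ i < m, ∀ j, ∑ p, D i j p * x p + c i j < 0} ≤
      stdPi ι {x | ∃ i < m, ∀ j < k, ∑ p, B i j p * x p + c i j ≤ 0} := by
    intro m k
    have := gordon_finite (ι := ι) (fun (i : Fin m) (j : Fin k) => c i j)
      (fun i j => B i j) (fun i j => D i j) (fun i j i' j' => h0 _ _ _ _)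
      (fun i j j' => hsame _ _ _) (fun i j i' j' => hdiff _ _ _ _)
    refine le_trans (measure_mono ?_) (this.trans (measure_mono ?_))
    · rintro x ⟨i, hi, h⟩
      exact ⟨⟨i, hi⟩, fun j => h j⟩
    · rintro x ⟨i, h⟩
      exact ⟨i, i.2, fun j hj => h ⟨j, hj⟩⟩
  have mB : ∀ m k : ℕ,
      MeasurableSet {x : ι → ℝ | ∃ i < m, ∀ j < k, ∑ p, B i j p * x p + c i j ≤ 0} := by
    intro m k
    have : {x : ι → ℝ | ∃ i < m, ∀ j < k, ∑ p, B i j p * x p + c i j ≤ 0} =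
        ⋃ i, ⋃ (_ : i < m), ⋂ j, ⋂ (_ : j < k),
          {x : ι → ℝ | ∑ p, B i j p * x p + c i j ≤ 0} := by ext; simp
    rw [this]
    exact MeasurableSet.iUnion fun i => MeasurableSet.iUnion fun _ => MeasurableSet.iInter
      fun j => MeasurableSet.iInter fun _ => measurableSet_le (by fun_prop) (by fun_prop)
  have step2 : ∀ m : ℕ, stdPi ι {x | ∃ i < m, ∀ j, ∑ p, D i j p * x p + c i j < 0} ≤
      stdPi ι {x | ∃ i, ∀ j, ∑ p, B i j p * x p + c i j ≤ 0} := by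
    intro m
    have anti : Antitone fun k : ℕ =>
        {x : ι → ℝ | ∃ i < m, ∀ j < k, ∑ p, B i j p * x p + c i j ≤ 0} := by
      rintro k k' hk x ⟨i, hi, h⟩
      exact ⟨i, hi, fun j hj => h j (hj.trans_le hk)⟩
    have t := tendsto_measure_iInter_atTop (μ := stdPi ι)
      (fun k => (mB m k).nullMeasurableSet) anti ⟨0, measure_ne_top _ _⟩
    refine (ge_of_tendsto' t (step m)).trans (measure_mono ?_)
    intro x hx
    simp only [Set.mem_iInter, Set.mem_ofPred_eq] at hx
    by_contra hcon
    simp only [Set.mem_ofPred_eq, not_exists, not_forall, not_le] at hcon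
    choose w hw using hcon
    obtain ⟨i, hi, h⟩ := hx ((Finset.range m).sup w + 1)
    have := h (w i) (Nat.lt_succ_of_le (Finset.le_sup (f := w) (Finset.mem_range.2 hi)))
    exact absurd this (not_le.2 (hw i))
  have mono : Monotone fun m : ℕ =>
      {x : ι → ℝ | ∃ i < m, ∀ j, ∑ p, D i j p * x p + c i j < 0} := by
    rintro k k' hk x ⟨i, hi, h⟩
    exact ⟨i, hi.trans_le hk, h⟩
  have t := tendsto_measure_iUnion_atTop (μ := stdPi ι) mono
  refine le_trans (measure_mono ?_) (le_of_tendsto' t step2)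
  rintro x ⟨i, h⟩
  exact Set.mem_iUnion.2 ⟨i + 1, i, Nat.lt_succ_self i, h⟩

end Gordon

section Bilinear

/-- Euclidean norm of a coordinate vector. -/
def nrm {ι : Type*} [Fintype ι] (u : ι → ℝ) : ℝ := Real.sqrt (∑ i, u i ^ 2)

lemma nrm_nonneg {ι : Type*} [Fintype ι] (u : ι → ℝ) : 0 ≤ nrm u := Real.sqrt_nonneg _

lemma nrm_sq {ι : Type*} [Fintype ι] (u : ι → ℝ) : nrm u ^ 2 = ∑ i, u i ^ 2 :=
  Real.sq_sqrt (Finset.sum_nonneg fun _ _ => sq_nonneg _)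

lemma dot_le_nrm {ι : Type*} [Fintype ι] (u v : ι → ℝ) : ∑ i, u i * v i ≤ nrm u * nrm v :=
  Real.sum_mul_le_sqrt_mul_sqrt _ _ _

lemma abs_dot_le_nrm {ι : Type*} [Fintype ι] (u v : ι → ℝ) : |∑ i, u i * v i| ≤ nrm u * nrm v := by
  rw [abs_le]
  refine ⟨?_, dot_le_nrm u v⟩
  have := dot_le_nrm (fun i => -u i) v
  have h : nrm (fun i => -u i) = nrm u := by simp [nrm]
  rw [h] at this
  simp only [neg_mul, Finset.sum_neg_distrib] at this
  linarith

/-- The effective noise level `√(‖w‖²/n + σ²)`. -/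
def effT (n : ℕ) {N : ℕ} (σ : ℝ) (w : Fin N → ℝ) : ℝ :=
  Real.sqrt ((∑ q, w q ^ 2) / n + σ ^ 2)

lemma effT_sq (n : ℕ) {N : ℕ} (σ : ℝ) (w : Fin N → ℝ) :
    effT n σ w ^ 2 = (∑ q, w q ^ 2) / n + σ ^ 2 :=
  Real.sq_sqrt (add_nonneg (div_nonneg (Finset.sum_nonneg fun _ _ => sq_nonneg _)
    (Nat.cast_nonneg n)) (sq_nonneg _))

lemma effT_nonneg (n : ℕ) {N : ℕ} (σ : ℝ) (w : Fin N → ℝ) : 0 ≤ effT n σ w := Real.sqrt_nonneg _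

/-- Index of the Gaussian coordinates of the auxiliary problem. -/
abbrev AuxIdx (n N : ℕ) : Type := Fin n ⊕ Fin N ⊕ Unit

/-- Index of the Gaussian coordinates of the bilinear process. -/
abbrev BilIdx (n N : ℕ) : Type := (Fin n × Fin N) ⊕ Fin n ⊕ Unit

variable {n N : ℕ}

/-- Coefficients of the bilinear process. -/
def bilForm (σ : ℝ) (u : Fin n → ℝ) (w : Fin N → ℝ) : BilIdx n N ⊕ AuxIdx n N → ℝ :=
  Sum.elim (Sum.elim (fun r => u r.1 * w r.2 / Real.sqrt n)
    (Sum.elim (fun p => -(σ * u p)) fun _ => nrm u * effT n σ w)) 0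

/-- Coefficients of the decoupled process. -/
def auxForm (σ s : ℝ) (u : Fin n → ℝ) (w : Fin N → ℝ) : BilIdx n N ⊕ AuxIdx n N → ℝ :=
  Sum.elim 0 (Sum.elim (fun p => effT n σ w * u p)
    (Sum.elim (fun q => s * nrm u * (w q / Real.sqrt n)) fun _ => σ * nrm u))

lemma auxForm_dot_bilForm (σ s : ℝ) (u u' : Fin n → ℝ) (w w' : Fin N → ℝ) :
    ∑ p, auxForm σ s u w p * bilForm σ u' w' p = 0 := by
  simp [auxForm, bilForm, Fintype.sum_sum_type]

lemma bilForm_dot (σ : ℝ) (u u' : Fin n → ℝ) (w w' : Fin N → ℝ) :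
    ∑ p, bilForm σ u w p * bilForm σ u' w' p =
      (∑ p, u p * u' p) * ((∑ q, w q * w' q) / n + σ ^ 2) +
        nrm u * nrm u' * (effT n σ w * effT n σ w') := by
  have hs : Real.sqrt n * Real.sqrt n = n := Real.mul_self_sqrt (Nat.cast_nonneg n)
  simp only [bilForm, Fintype.sum_sum_type, Sum.elim_inl, Sum.elim_inr, Fintype.sum_prod_type,
    Pi.zero_apply, mul_zero, Finset.sum_const_zero, add_zero, Finset.univ_unique,
    Finset.sum_singleton]
  have e1 : ∀ p q, u p * w q / Real.sqrt n * (u' p * w' q / Real.sqrt n) =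
      u p * u' p * (w q * w' q / n) := fun p q => by
    rw [div_mul_div_comm, hs]; ring
  simp_rw [e1, ← Finset.mul_sum, ← Finset.sum_mul, ← Finset.sum_div]
  have e2 : ∀ p, -(σ * u p) * -(σ * u' p) = u p * u' p * σ ^ 2 := fun p => by ring
  simp_rw [e2, ← Finset.sum_mul]
  ring

lemma auxForm_dot (σ : ℝ) {s : ℝ} (hs : s ^ 2 = 1) (u u' : Fin n → ℝ) (w w' : Fin N → ℝ) :
    ∑ p, auxForm σ s u w p * auxForm σ s u' w' p =
      effT n σ w * effT n σ w' * (∑ p, u p * u' p) +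
        nrm u * nrm u' * ((∑ q, w q * w' q) / n + σ ^ 2) := by
  have hn : Real.sqrt n * Real.sqrt n = n := Real.mul_self_sqrt (Nat.cast_nonneg n)
  simp only [auxForm, Fintype.sum_sum_type, Sum.elim_inl, Sum.elim_inr,
    Pi.zero_apply, mul_zero, Finset.sum_const_zero, zero_add, Finset.univ_unique,
    Finset.sum_singleton]
  have e1 : ∀ p, effT n σ w * u p * (effT n σ w' * u' p) =
      effT n σ w * effT n σ w' * (u p * u' p) := fun p => by ring
  have e2 : ∀ q, s * nrm u * (w q / Real.sqrt n) * (s * nrm u' * (w' q / Real.sqrt n)) =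
      nrm u * nrm u' * (w q * w' q / n) := fun q => by
    rw [show s * nrm u * (w q / Real.sqrt n) * (s * nrm u' * (w' q / Real.sqrt n)) =
      s ^ 2 * (nrm u * nrm u') * (w q * w' q / (Real.sqrt n * Real.sqrt n)) by
        rw [← div_mul_div_comm]; ring, hn, hs]; ring
  simp_rw [e1, e2, ← Finset.mul_sum, ← Finset.sum_div]
  ring

lemma dot_div_add_le_effT (σ : ℝ) (w w' : Fin N → ℝ) :
    (∑ q, w q * w' q) / n + σ ^ 2 ≤ effT n σ w * effT n σ w' := by
  have h1 := effT_sq n σ w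
  have h2 := effT_sq n σ w'
  have h3 := dot_le_nrm w w'
  have a1 := nrm_sq w
  have a2 := nrm_sq w'
  have hn : (0 : ℝ) ≤ n := Nat.cast_nonneg n
  refine (add_le_add (div_le_div_of_nonneg_right h3 hn) le_rfl).trans ?_
  refine abs_le_of_sq_le_sq' ?_ (mul_nonneg (effT_nonneg _ _ _) (effT_nonneg _ _ _)) |>.2
  rw [mul_pow, h1, h2, ← a1, ← a2]
  have : (nrm w ^ 2 / n + σ ^ 2) * (nrm w' ^ 2 / n + σ ^ 2) - (nrm w * nrm w' / n + σ ^ 2) ^ 2 =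
      σ ^ 2 / n * (nrm w - nrm w') ^ 2 := by ring
  have : 0 ≤ σ ^ 2 / n * (nrm w - nrm w') ^ 2 := by positivity
  linarith

/-- The linear functional of the bilinear process. -/
def bilVal (σ : ℝ) (X : Fin n → Fin N → ℝ) (z : Fin n → ℝ) (u : Fin n → ℝ) (w : Fin N → ℝ) : ℝ :=
  ∑ p, u p * ((∑ q, X p q * w q) - σ * z p)

/-- The linear functional of the decoupled process. -/
def auxVal (σ s : ℝ) (ζ : AuxIdx n N → ℝ) (u : Fin n → ℝ) (w : Fin N → ℝ) : ℝ :=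
  effT n σ w * (∑ p, ζ (Sum.inl p) * u p) +
    nrm u * (s * (∑ q, ζ (Sum.inr (Sum.inl q)) * w q) / Real.sqrt n +
      σ * ζ (Sum.inr (Sum.inr ())))

/-- Assembles the coordinates of the joint Gaussian space from the model. -/
def joinMap (p : (((Fin n → Fin N → ℝ) × (Fin n → ℝ)) × ℝ) × (AuxIdx n N → ℝ)) :
    BilIdx n N ⊕ AuxIdx n N → ℝ :=
  Sum.elim (Sum.elim (fun r => Real.sqrt n * p.1.1.1 r.1 r.2)
    (Sum.elim p.1.1.2 fun _ => p.1.2)) p.2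

lemma bilForm_joinMap (hn : 0 < n) (σ : ℝ) (u : Fin n → ℝ) (w : Fin N → ℝ)
    (p : (((Fin n → Fin N → ℝ) × (Fin n → ℝ)) × ℝ) × (AuxIdx n N → ℝ)) :
    ∑ r, bilForm σ u w r * joinMap p r =
      bilVal σ p.1.1.1 p.1.1.2 u w + nrm u * effT n σ w * p.1.2 := by
  have hs : Real.sqrt n ≠ 0 := (Real.sqrt_pos.2 (by exact_mod_cast hn)).ne'
  simp only [bilForm, joinMap, bilVal, Fintype.sum_sum_type, Sum.elim_inl, Sum.elim_inr,
    Fintype.sum_prod_type, Pi.zero_apply, zero_mul, Finset.sum_const_zero, add_zero,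
    Finset.univ_unique, Finset.sum_singleton]
  rw [← add_assoc, ← Finset.sum_add_distrib]
  congr 1
  refine Finset.sum_congr rfl fun i _ => ?_
  rw [mul_sub, Finset.mul_sum, sub_eq_add_neg]
  congr 1
  · refine Finset.sum_congr rfl fun q _ => ?_
    field_simp
  · ring

lemma auxForm_joinMap (σ s : ℝ) (u : Fin n → ℝ) (w : Fin N → ℝ)
    (p : (((Fin n → Fin N → ℝ) × (Fin n → ℝ)) × ℝ) × (AuxIdx n N → ℝ)) :
    ∑ r, auxForm σ s u w r * joinMap p r = auxVal σ s p.2 u w := by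
  simp only [auxForm, joinMap, auxVal, Fintype.sum_sum_type, Sum.elim_inl, Sum.elim_inr,
    Pi.zero_apply, zero_mul, Finset.sum_const_zero, zero_add, Finset.univ_unique,
    Finset.sum_singleton]
  rw [mul_add, Finset.mul_sum, Finset.mul_sum, Finset.sum_div, Finset.mul_sum]
  congr 1
  · exact Finset.sum_congr rfl fun p _ => by ring
  · congr 1
    · exact Finset.sum_congr rfl fun p _ => by ring
    · simp only [PUnit.default_eq_unit]; ring

lemma gaussianReal_preimage_sqrt_mul (hn : 0 < n) {s : Set ℝ} (hs : MeasurableSet s) :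
    gaussianReal 0 ((n : ℝ≥0))⁻¹ ((fun x => Real.sqrt n * x) ⁻¹' s) = stdG s := by
  rw [← Measure.map_apply (by fun_prop) hs, gaussianReal_map_const_mul]
  unfold stdG
  congr 2
  · simp
  · ext
    have : (n : ℝ) ≠ 0 := by positivity
    simp [Real.sq_sqrt (Nat.cast_nonneg n), this]

instance : IsProbabilityMeasure (PX n N) := by unfold PX; infer_instance
instance : IsProbabilityMeasure (Pz n) := by unfold Pz; infer_instance
instance : IsProbabilityMeasure (Pmodel n N) := by unfold Pmodel; infer_instance

lemma measurable_joinMap : Measurable (joinMap (n := n) (N := N)) := by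
  refine measurable_pi_lambda _ fun r => ?_
  rcases r with ((r | r | r) | r)
  all_goals simp only [joinMap, Sum.elim_inl, Sum.elim_inr]; fun_prop

lemma measurePreserving_joinMap (hn : 0 < n) :
    MeasurePreserving (joinMap (n := n) (N := N))
      (((Pmodel n N).prod stdG).prod (stdPi (AuxIdx n N))) (stdPi (BilIdx n N ⊕ AuxIdx n N)) := by
  refine ⟨measurable_joinMap, ?_⟩
  unfold stdPi
  refine (Measure.pi_eq fun s hs => ?_).symm
  rw [Measure.map_apply measurable_joinMap (MeasurableSet.univ_pi hs)]
  have : joinMap (n := n) (N := N) ⁻¹' (Set.univ.pi s) =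
      (((Set.univ.pi fun p => Set.univ.pi fun q =>
        (fun x => Real.sqrt n * x) ⁻¹' s (Sum.inl (Sum.inl (p, q)))) ×ˢ
        (Set.univ.pi fun p => s (Sum.inl (Sum.inr (Sum.inl p))))) ×ˢ
        s (Sum.inl (Sum.inr (Sum.inr ())))) ×ˢ (Set.univ.pi fun r => s (Sum.inr r)) := by
    ext p
    simp only [Set.mem_preimage, Set.mem_univ_pi, Set.mem_prod, joinMap, Sum.forall,
      Sum.elim_inl, Sum.elim_inr, Prod.forall]
    constructor
    · rintro ⟨⟨h1, h2, h3⟩, h4⟩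
      exact ⟨⟨⟨h1, h2⟩, h3 ()⟩, h4⟩
    · rintro ⟨⟨⟨h1, h2⟩, h3⟩, h4⟩
      exact ⟨⟨h1, h2, fun _ => h3⟩, h4⟩
  rw [this, Measure.prod_prod, Measure.prod_prod]
  unfold Pmodel PX Pz
  rw [Measure.prod_prod, Measure.pi_pi, Measure.pi_pi, Measure.pi_pi]
  simp_rw [Measure.pi_pi, gaussianReal_preimage_sqrt_mul hn (hs _)]
  simp only [Fintype.prod_sum_type, Fintype.prod_prod_type, Finset.univ_unique, Finset.prod_singleton, PUnit.default_eq_unit, stdG, mul_assoc]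

lemma half_le_stdG_Iic : 1 / 2 ≤ stdG (Set.Iic 0) := by
  have h1 : stdG (Set.Iic 0) = stdG (Set.Ici 0) := by
    have : stdG = stdG.map (fun x => -x) := by
      unfold stdG; rw [gaussianReal_map_neg]; simp
    conv_lhs => rw [this]
    rw [Measure.map_apply measurable_neg measurableSet_Iic]
    congr 1; ext x; simp
  have h2 : (1 : ℝ≥0∞) ≤ stdG (Set.Iic 0) + stdG (Set.Ici 0) := by
    rw [← measure_univ (μ := stdG), ← Set.Iic_union_Ici (a := (0:ℝ))]
    exact measure_union_le _ _
  rw [← h1, ← two_mul] at h2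
  rw [ENNReal.div_le_iff (by norm_num) (by norm_num), mul_comm]
  exact h2

/-- Gordon's comparison for the bilinear process over countable families. -/
lemma gordon_bilinear (hn : 0 < n) (σ : ℝ) {s : ℝ} (hs : s ^ 2 = 1) (c : ℕ → ℕ → ℝ)
    (U : ℕ → ℕ → Fin n → ℝ) (W : ℕ → ℕ → Fin N → ℝ)
    (h : ∀ i j j', U i j = U i j' ∨ W i j = W i j') :
    Pmodel n N {ω | ∃ i, ∀ j, bilVal σ ω.1 ω.2 (U i j) (W i j) + c i j < 0} ≤
      2 * stdPi (AuxIdx n N) {ζ | ∃ i, ∀ j, auxVal σ s ζ (U i j) (W i j) + c i j ≤ 0} := by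
  have key := gordon_seq c (fun i j => auxForm σ s (U i j) (W i j))
    (fun i j => bilForm σ (U i j) (W i j)) (fun i j i' j' => auxForm_dot_bilForm _ _ _ _ _ _)
    (fun i j j' => by
      rw [bilForm_dot, auxForm_dot σ hs]
      rcases h i j j' with h | h
      · have h1 : ∑ p, U i j' p * U i j' p = nrm (U i j') * nrm (U i j') := by
          rw [← sq, nrm_sq]; exact Finset.sum_congr rfl fun p _ => by ring
        rw [h, h1]; ring
      · have h1 : (∑ p, W i j' p * W i j' p) / n + σ ^ 2 =
            effT n σ (W i j') * effT n σ (W i j') := by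
          rw [← sq, effT_sq]; simp_rw [sq]
        rw [h, h1]; ring)
    (fun i j i' j' => by
      rw [bilForm_dot, auxForm_dot σ hs]
      have h1 := dot_le_nrm (U i j) (U i' j')
      have h2 := dot_div_add_le_effT (n := n) σ (W i j) (W i' j')
      nlinarith [mul_nonneg (sub_nonneg.2 h1) (sub_nonneg.2 h2)])
  have mp := measurePreserving_joinMap (N := N) hn
  have mB : MeasurableSet {x : BilIdx n N ⊕ AuxIdx n N → ℝ |
      ∃ i, ∀ j, ∑ p, auxForm σ s (U i j) (W i j) p * x p + c i j ≤ 0} := by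
    have : {x : BilIdx n N ⊕ AuxIdx n N → ℝ |
        ∃ i, ∀ j, ∑ p, auxForm σ s (U i j) (W i j) p * x p + c i j ≤ 0} =
        ⋃ i, ⋂ j, {x | ∑ p, auxForm σ s (U i j) (W i j) p * x p + c i j ≤ 0} := by ext; simp
    rw [this]
    exact MeasurableSet.iUnion fun i => MeasurableSet.iInter fun j =>
      measurableSet_le (by fun_prop) (by fun_prop)
  have mD : MeasurableSet {x : BilIdx n N ⊕ AuxIdx n N → ℝ |
      ∃ i, ∀ j, ∑ p, bilForm σ (U i j) (W i j) p * x p + c i j < 0} := by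
    have : {x : BilIdx n N ⊕ AuxIdx n N → ℝ |
        ∃ i, ∀ j, ∑ p, bilForm σ (U i j) (W i j) p * x p + c i j < 0} =
        ⋃ i, ⋂ j, {x | ∑ p, bilForm σ (U i j) (W i j) p * x p + c i j < 0} := by ext; simp
    rw [this]
    exact MeasurableSet.iUnion fun i => MeasurableSet.iInter fun j =>
      measurableSet_lt (by fun_prop) (by fun_prop)
  rw [← mp.measure_preimage mB.nullMeasurableSet,
    ← mp.measure_preimage mD.nullMeasurableSet] at key
  have e1 : joinMap ⁻¹' {x : BilIdx n N ⊕ AuxIdx n N → ℝ |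
      ∃ i, ∀ j, ∑ p, auxForm σ s (U i j) (W i j) p * x p + c i j ≤ 0} = Set.univ ×ˢ
      {ζ | ∃ i, ∀ j, auxVal σ s ζ (U i j) (W i j) + c i j ≤ 0} := by
    ext p
    simp only [Set.mem_preimage, Set.mem_ofPred_eq, auxForm_joinMap, Set.mem_prod, Set.mem_univ,
      true_and]
  rw [e1, Measure.prod_prod, measure_univ, one_mul] at key
  have e2 : ({ω | ∃ i, ∀ j, bilVal σ ω.1 ω.2 (U i j) (W i j) + c i j < 0} ×ˢ Set.Iic 0) ×ˢ
      Set.univ ⊆ joinMap ⁻¹' {x : BilIdx n N ⊕ AuxIdx n N → ℝ |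
      ∃ i, ∀ j, ∑ p, bilForm σ (U i j) (W i j) p * x p + c i j < 0} := by
    rintro p ⟨⟨⟨i, hi⟩, h2⟩, -⟩
    simp only [Set.mem_preimage, Set.mem_ofPred_eq, bilForm_joinMap hn]
    refine ⟨i, fun j => ?_⟩
    have h2' : p.1.2 ≤ 0 := h2
    have := mul_nonpos_of_nonneg_of_nonpos (mul_nonneg (nrm_nonneg (U i j))
      (effT_nonneg n σ (W i j))) h2'
    linarith [hi j]
  have h3 := (measure_mono e2).trans key
  rw [Measure.prod_prod, Measure.prod_prod, measure_univ, mul_one] at h3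
  calc _ = 2 * (Pmodel n N {ω | ∃ i, ∀ j, bilVal σ ω.1 ω.2 (U i j) (W i j) + c i j < 0} *
        (1 / 2)) := by
        rw [mul_comm (Pmodel n N _), ← mul_assoc, ENNReal.mul_div_cancel (by norm_num) (by norm_num),
          one_mul]
    _ ≤ _ := by
        refine mul_le_mul_right ?_ 2
        exact (mul_le_mul_right half_le_stdG_Iic _).trans h3

end Bilinear

section Comparison

variable {n N : ℕ}

lemma continuous_nrm {ι : Type*} [Fintype ι] : Continuous (nrm (ι := ι)) := by
  unfold nrm; fun_prop

lemma continuous_effT (σ : ℝ) : Continuous (effT n σ (N := N)) := by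
  unfold effT; fun_prop

lemma continuous_auxVal_left (σ s : ℝ) (ζ : AuxIdx n N → ℝ) (w : Fin N → ℝ) :
    Continuous fun u => auxVal σ s ζ u w := by
  have := continuous_nrm (ι := Fin n)
  unfold auxVal; fun_prop

lemma continuous_auxVal_right (σ s : ℝ) (ζ : AuxIdx n N → ℝ) (u : Fin n → ℝ) :
    Continuous fun w => auxVal σ s ζ u w := by
  have := continuous_effT (n := n) (N := N) σ
  unfold auxVal; fun_prop

lemma isCompact_nrm_le {ι : Type*} [Fintype ι] (R : ℝ) : IsCompact {w : ι → ℝ | nrm w ≤ R} := by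
  refine Metric.isCompact_of_isClosed_isBounded (isClosed_le continuous_nrm continuous_const) ?_
  refine (Metric.isBounded_closedBall (x := (0 : ι → ℝ)) (r := |R|)).subset fun w hw => ?_
  rw [mem_closedBall_zero_iff, pi_norm_le_iff_of_nonneg (abs_nonneg _)]
  intro i
  have h1 : w i ^ 2 ≤ nrm w ^ 2 := by
    rw [nrm_sq]
    exact Finset.single_le_sum (f := fun i => w i ^ 2) (fun _ _ => sq_nonneg _) (Finset.mem_univ i)
  have h2 : nrm w ≤ |R| := le_trans hw (le_abs_self R)
  exact (abs_le_of_sq_le_sq h1 (nrm_nonneg w)).trans h2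

/-- Gordon bound for the primal problem: low cost on `S` forces low auxiliary cost on `S`. -/
lemma gordon_primal (hn : 0 < n) (σ lam : ℝ) (θ : Fin N → ℝ) (S : Set (Fin N → ℝ)) (a : ℝ) :
    Pmodel n N {ω | ∃ w ∈ S,
        n * lassoCost ω.1 (yvec σ θ ω.1 ω.2) lam (fun q => w q + θ q) < a} ≤
      2 * stdPi (AuxIdx n N) {ζ | ∃ w ∈ S, ∀ u, auxVal σ (-1) ζ u w - nrm u ^ 2 / 2 +
        lam * ∑ q, |w q + θ q| ≤ a} := by
  rcases S.eq_empty_or_nonempty with rfl | hS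
  · simp
  have : Nonempty S := hS.to_subtype
  obtain ⟨W, hW⟩ := TopologicalSpace.exists_dense_seq S
  obtain ⟨U, hU⟩ := TopologicalSpace.exists_dense_seq (Fin n → ℝ)
  have key := gordon_bilinear hn σ (s := -1) (by norm_num)
    (fun i j => -nrm (U j) ^ 2 / 2 + lam * ∑ q, |(W i : Fin N → ℝ) q + θ q| - a)
    (fun _ j => U j) (fun i _ => (W i : Fin N → ℝ)) (fun _ _ _ => Or.inr rfl)
  refine (measure_mono ?_).trans (key.trans (mul_le_mul_right (measure_mono ?_) 2))
  · rintro ω ⟨w, hw, hlt⟩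
    have hc0 : Continuous fun w : Fin N → ℝ =>
        n * lassoCost ω.1 (yvec σ θ ω.1 ω.2) lam (fun q => w q + θ q) := by
      simp only [lassoCost]
      have h1 : ∀ q, Continuous fun w : Fin N → ℝ => |w q + θ q| := fun q =>
        ((continuous_apply q).add continuous_const).abs
      fun_prop
    have hc := hc0.comp (continuous_subtype_val (p := fun w => w ∈ S))
    obtain ⟨i, hi⟩ := hW.exists_mem_open (isOpen_lt hc continuous_const) ⟨⟨w, hw⟩, hlt⟩
    refine ⟨i, fun j => ?_⟩
    have hi' : n * lassoCost ω.1 (yvec σ θ ω.1 ω.2) lam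
      (fun q => (W i : Fin N → ℝ) q + θ q) < a := hi
    refine lt_of_le_of_lt ?_ (sub_neg.2 hi')
    have hn' : (n : ℝ) ≠ 0 := by positivity
    have e : (n : ℝ) * lassoCost ω.1 (yvec σ θ ω.1 ω.2) lam
        (fun q => (W i : Fin N → ℝ) q + θ q) =
        1 / 2 * ∑ p, ((∑ q, ω.1 p q * (W i : Fin N → ℝ) q) - σ * ω.2 p) ^ 2 +
          lam * ∑ q, |(W i : Fin N → ℝ) q + θ q| := by
      unfold lassoCost yvec
      have : ∀ p, (∑ q, ω.1 p q * θ q) + σ * ω.2 p -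
          ∑ q, ω.1 p q * ((W i : Fin N → ℝ) q + θ q) =
          -((∑ q, ω.1 p q * (W i : Fin N → ℝ) q) - σ * ω.2 p) := fun p => by
        simp_rw [mul_add, Finset.sum_add_distrib]; ring
      simp_rw [this, neg_sq]
      field_simp
    rw [e, bilVal, nrm_sq]
    have : ∑ p, U j p * ((∑ q, ω.1 p q * (W i : Fin N → ℝ) q) - σ * ω.2 p) ≤
        (∑ p, U j p ^ 2) / 2 +
          1 / 2 * ∑ p, ((∑ q, ω.1 p q * (W i : Fin N → ℝ) q) - σ * ω.2 p) ^ 2 := by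
      rw [Finset.sum_div, Finset.mul_sum, ← Finset.sum_add_distrib]
      refine Finset.sum_le_sum fun p _ => ?_
      nlinarith [sq_nonneg (U j p - ((∑ q, ω.1 p q * (W i : Fin N → ℝ) q) - σ * ω.2 p))]
    linarith
  · rintro ζ ⟨i, hi⟩
    refine ⟨W i, (W i).2, fun u => ?_⟩
    have hc : Continuous fun u => auxVal σ (-1) ζ u (W i) - nrm u ^ 2 / 2 +
        lam * ∑ q, |(W i : Fin N → ℝ) q + θ q| := by
      have := continuous_auxVal_left σ (-1) ζ (W i : Fin N → ℝ)
      have := continuous_nrm (ι := Fin n)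
      fun_prop
    have hcl : IsClosed {u | auxVal σ (-1) ζ u (W i) - nrm u ^ 2 / 2 +
        lam * ∑ q, |(W i : Fin N → ℝ) q + θ q| ≤ a} := isClosed_le hc continuous_const
    have : Set.range U ⊆ {u | auxVal σ (-1) ζ u (W i) - nrm u ^ 2 / 2 +
        lam * ∑ q, |(W i : Fin N → ℝ) q + θ q| ≤ a} := by
      rintro _ ⟨j, rfl⟩
      have := hi j
      simp only [Set.mem_ofPred_eq]
      linarith
    exact hcl.closure_subset_iff.2 this (hU u)

/-- Gordon bound for the dual problem: low dual objective on `S` forces low auxiliary dual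
objective on `S`. -/
lemma gordon_dual (hn : 0 < n) (σ : ℝ) (θ : Fin N → ℝ) (S : Set ((Fin n → ℝ) × (Fin N → ℝ)))
    {R : ℝ} (hR : 0 ≤ R) (a : ℝ) :
    Pmodel n N {ω | ∃ d ∈ S, (∀ q, ∑ p, ω.1 p q * d.1 p = d.2 q) ∧
        nrm d.1 ^ 2 / 2 - ∑ p, d.1 p * yvec σ θ ω.1 ω.2 p < a} ≤
      2 * stdPi (AuxIdx n N) {ζ | ∃ d ∈ S, ∀ w, nrm w ≤ R → auxVal σ 1 ζ d.1 w +
        nrm d.1 ^ 2 / 2 - ∑ q, (w q + θ q) * d.2 q ≤ a} := by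
  rcases S.eq_empty_or_nonempty with rfl | hS
  · simp
  have : Nonempty S := hS.to_subtype
  obtain ⟨D, hD⟩ := TopologicalSpace.exists_dense_seq S
  have : Nonempty {w : Fin N → ℝ | nrm w ≤ R} := ⟨⟨0, by simpa [nrm] using hR⟩⟩
  obtain ⟨W, hW⟩ := TopologicalSpace.exists_dense_seq {w : Fin N → ℝ | nrm w ≤ R}
  have key := gordon_bilinear (N := N) hn σ (s := 1) (by norm_num)
    (fun i j => nrm (D i : (Fin n → ℝ) × (Fin N → ℝ)).1 ^ 2 / 2 -
      ∑ q, ((W j : Fin N → ℝ) q + θ q) * (D i : (Fin n → ℝ) × (Fin N → ℝ)).2 q - a)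
    (fun i _ => (D i : (Fin n → ℝ) × (Fin N → ℝ)).1) (fun _ j => (W j : Fin N → ℝ))
    (fun _ _ _ => Or.inl rfl)
  refine (measure_mono ?_).trans (key.trans (mul_le_mul_right (measure_mono ?_) 2))
  · rintro ω ⟨d, hd, hv, hlt⟩
    set F : S → (Fin N → ℝ) → ℝ := fun d w => bilVal σ ω.1 ω.2 (d : (Fin n → ℝ) × (Fin N → ℝ)).1 w +
      (nrm (d : (Fin n → ℝ) × (Fin N → ℝ)).1 ^ 2 / 2 -
        ∑ q, (w q + θ q) * (d : (Fin n → ℝ) × (Fin N → ℝ)).2 q - a) with hF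
    have hFc : Continuous fun x : S × (Fin N → ℝ) => F x.1 x.2 := by
      have := continuous_nrm (ι := Fin n)
      simp only [hF]; unfold bilVal; fun_prop
    have h1 : ∀ w ∈ {w : Fin N → ℝ | nrm w ≤ R}, ∀ᶠ x : S × (Fin N → ℝ) in
        nhds (⟨d, hd⟩, w), F x.1 x.2 < 0 := by
      intro w _
      refine hFc.continuousAt.eventually_lt continuousAt_const ?_
      have e1 : ∑ q, (w q + θ q) * d.2 q = (∑ p, d.1 p * ∑ q, ω.1 p q * w q) +
          ∑ p, d.1 p * ∑ q, ω.1 p q * θ q := by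
        rw [← Finset.sum_add_distrib]
        simp_rw [← hv, Finset.mul_sum]
        rw [Finset.sum_comm]
        refine Finset.sum_congr rfl fun p _ => ?_
        rw [← Finset.sum_add_distrib]
        exact Finset.sum_congr rfl fun q _ => by ring
      have e2 : ∑ p, d.1 p * yvec σ θ ω.1 ω.2 p =
          (∑ p, d.1 p * ∑ q, ω.1 p q * θ q) + ∑ p, d.1 p * (σ * ω.2 p) := by
        rw [← Finset.sum_add_distrib]
        exact Finset.sum_congr rfl fun p _ => by unfold yvec; ring
      have e3 : bilVal σ ω.1 ω.2 d.1 w = (∑ p, d.1 p * ∑ q, ω.1 p q * w q) -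
          ∑ p, d.1 p * (σ * ω.2 p) := by
        rw [← Finset.sum_sub_distrib]
        exact Finset.sum_congr rfl fun p _ => by ring
      simp only [hF]
      rw [e1, e3]
      linarith
    have h2 : ∀ᶠ x : S in nhds ⟨d, hd⟩, ∀ w ∈ {w : Fin N → ℝ | nrm w ≤ R}, F x w < 0 :=
      (isCompact_nrm_le R).eventually_forall_of_forall_eventually (P := fun x w => F x w < 0) h1
    obtain ⟨V, hV1, hV2, hV3⟩ := eventually_nhds_iff.1 h2
    obtain ⟨i, hi⟩ := hD.exists_mem_open hV2 ⟨_, hV3⟩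
    exact ⟨i, fun j => hV1 _ hi _ (W j).2⟩
  · rintro ζ ⟨i, hi⟩
    refine ⟨D i, (D i).2, fun w hw => ?_⟩
    set G : (Fin N → ℝ) → ℝ := fun w => auxVal σ 1 ζ (D i : (Fin n → ℝ) × (Fin N → ℝ)).1 w +
        nrm (D i : (Fin n → ℝ) × (Fin N → ℝ)).1 ^ 2 / 2 -
        ∑ q, (w q + θ q) * (D i : (Fin n → ℝ) × (Fin N → ℝ)).2 q with hG
    have hc : Continuous G := by
      have := continuous_auxVal_right σ 1 ζ (D i : (Fin n → ℝ) × (Fin N → ℝ)).1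
      refine (this.add continuous_const).sub ?_
      fun_prop
    have hcl : IsClosed {w : {w : Fin N → ℝ | nrm w ≤ R} | G w ≤ a} :=
      isClosed_le (hc.comp continuous_subtype_val) continuous_const
    have hr : Set.range W ⊆ {w : {w : Fin N → ℝ | nrm w ≤ R} | G w ≤ a} := by
      rintro _ ⟨j, rfl⟩
      have := hi j
      simp only [Set.mem_ofPred_eq, hG]
      linarith
    have hmem : (⟨w, hw⟩ : {w : Fin N → ℝ | nrm w ≤ R}) ∈
        {w : {w : Fin N → ℝ | nrm w ≤ R} | G w ≤ a} :=
      hcl.closure_subset_iff.2 hr (hW ⟨w, hw⟩)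
    exact hmem

end Comparison

section Bernstein

lemma integrable_exp_sq_stdG : Integrable (fun x : ℝ => Real.exp ((3 + x ^ 2) / 4)) stdG := by
  rw [integrable_stdG_iff]
  have := (integrable_exp_neg_mul_sq (b := 1 / 4) (by norm_num)).const_mul
    ((Real.sqrt (2 * Real.pi))⁻¹ * Real.exp (3 / 4))
  refine this.congr (.of_forall fun x => ?_)
  simp only [gaussianPDFReal, NNReal.coe_one, mul_one, sub_zero]
  rw [mul_assoc, mul_assoc, ← Real.exp_add, ← Real.exp_add]
  congr 2
  ring

lemma exp_le_one_add_add_sq_mul_exp (y : ℝ) :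
    Real.exp y ≤ 1 + y + y ^ 2 * Real.exp |y| := by
  have h := Complex.norm_exp_sub_sum_le_norm_mul_exp (y : ℂ) 2
  simp only [Finset.sum_range_succ, Finset.sum_range_zero, pow_zero, pow_one, Nat.factorial_zero,
    Nat.factorial_one, Nat.cast_one, div_one, zero_add] at h
  rw [← Complex.ofReal_exp, ← Complex.ofReal_one, ← Complex.ofReal_add, ← Complex.ofReal_sub,
    Complex.norm_real, Complex.norm_real, Real.norm_eq_abs, Real.norm_eq_abs, sq_abs] at h
  have := le_abs_self (Real.exp y - (1 + y))
  linarith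

lemma integral_one_add_sq_stdG : ∫ x : ℝ, (1 + x ^ 2) ∂stdG = 2 := by
  rw [integral_add (integrable_const _) (integrable_pow_stdG 2)]
  have : ∫ x : ℝ, x ^ 2 ∂stdG = 1 := by
    have h := variance_fun_id_gaussianReal (μ := 0) (v := 1)
    rw [variance_eq_integral (by fun_prop)] at h
    simpa [stdG] using h
  rw [this]; simp; norm_num

lemma integrable_of_le_quadratic {f : ℝ → ℝ} {K : ℝ} (hm : Measurable f)
    (hf : ∀ x, |f x| ≤ K * (1 + x ^ 2)) : Integrable f stdG := by
  refine Integrable.mono' (((integrable_const 1).add (integrable_pow_stdG 2)).const_mul K)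
    hm.aestronglyMeasurable (.of_forall fun x => ?_)
  simpa using hf x

lemma exists_mgf_bound : ∃ B : ℝ, 2 ≤ B ∧ ∀ (f : ℝ → ℝ) (K s : ℝ), Measurable f →
    (∀ x, |f x| ≤ K * (1 + x ^ 2)) → |s| * K ≤ 1 / 8 →
    Integrable (fun x => Real.exp (s * (f x - ∫ y, f y ∂stdG))) stdG ∧
    ∫ x, Real.exp (s * (f x - ∫ y, f y ∂stdG)) ∂stdG ≤ Real.exp (B * K ^ 2 * s ^ 2) := by
  set I := ∫ x : ℝ, Real.exp ((3 + x ^ 2) / 4) ∂stdG with hI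
  have hI0 : 0 ≤ I := integral_nonneg fun x => (Real.exp_pos _).le
  refine ⟨128 * I + 2, by linarith, fun f K s hm hf hs => ?_⟩
  have hfi := integrable_of_le_quadratic hm hf
  set m := ∫ y, f y ∂stdG
  have hmK : |m| ≤ 2 * K := by
    have h1 : |m| ≤ ∫ x : ℝ, K * (1 + x ^ 2) ∂stdG :=
      (abs_integral_le_integral_abs).trans (integral_mono hfi.abs
        (((integrable_const 1).add (integrable_pow_stdG 2)).const_mul K) hf)
    rw [integral_const_mul, integral_one_add_sq_stdG] at h1
    linarith
  have hY : ∀ x, |f x - m| ≤ K * (3 + x ^ 2) := fun x => by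
    have := abs_sub (f x) m
    linarith [hf x]
  have hsY : ∀ x, |s * (f x - m)| ≤ (3 + x ^ 2) / 8 := fun x => by
    rw [abs_mul]
    have := mul_le_mul_of_nonneg_left (hY x) (abs_nonneg s)
    nlinarith [sq_nonneg x]
  have hpt : ∀ x, Real.exp (s * (f x - m)) ≤
      1 + s * (f x - m) + 128 * (K ^ 2 * s ^ 2) * Real.exp ((3 + x ^ 2) / 4) := fun x => by
    refine (exp_le_one_add_add_sq_mul_exp _).trans ?_
    have e1 : (s * (f x - m)) ^ 2 ≤ K ^ 2 * s ^ 2 * (3 + x ^ 2) ^ 2 := by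
      have := sq_le_sq' (a := f x - m) (b := K * (3 + x ^ 2)) (by linarith [abs_le.1 (hY x)])
        (by linarith [abs_le.1 (hY x)])
      have := mul_le_mul_of_nonneg_left this (sq_nonneg s)
      linarith [this]
    have e2 : Real.exp |s * (f x - m)| ≤ Real.exp ((3 + x ^ 2) / 8) := Real.exp_le_exp.2 (hsY x)
    have e3 : (3 + x ^ 2) ^ 2 ≤ 128 * Real.exp ((3 + x ^ 2) / 8) := by
      have := Real.quadratic_le_exp_of_nonneg (x := (3 + x ^ 2) / 8) (by positivity)
      nlinarith [sq_nonneg x]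
    have e4 : Real.exp ((3 + x ^ 2) / 4) =
        Real.exp ((3 + x ^ 2) / 8) * Real.exp ((3 + x ^ 2) / 8) := by
      rw [← Real.exp_add]; ring_nf
    have e5 : (s * (f x - m)) ^ 2 * Real.exp |s * (f x - m)| ≤
        (K ^ 2 * s ^ 2 * (3 + x ^ 2) ^ 2) * Real.exp ((3 + x ^ 2) / 8) :=
      mul_le_mul e1 e2 (Real.exp_pos _).le (by positivity)
    have e6 : (K ^ 2 * s ^ 2 * (3 + x ^ 2) ^ 2) * Real.exp ((3 + x ^ 2) / 8) ≤
        (K ^ 2 * s ^ 2 * (128 * Real.exp ((3 + x ^ 2) / 8))) * Real.exp ((3 + x ^ 2) / 8) := by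
      gcongr
    rw [e4]
    linarith
  have hbi : Integrable (fun x => 1 + s * (f x - m) +
      128 * (K ^ 2 * s ^ 2) * Real.exp ((3 + x ^ 2) / 4)) stdG :=
    ((integrable_const 1).add ((hfi.sub (integrable_const m)).const_mul s)).add
      (integrable_exp_sq_stdG.const_mul _)
  have hei : Integrable (fun x => Real.exp (s * (f x - m))) stdG := by
    refine Integrable.mono' hbi (by fun_prop) (.of_forall fun x => ?_)
    rw [Real.norm_eq_abs, abs_of_pos (Real.exp_pos _)]
    exact hpt x
  refine ⟨hei, (integral_mono hei hbi hpt).trans ?_⟩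
  have i1 : Integrable (fun x => s * (f x - m)) stdG :=
    (hfi.sub (integrable_const m)).const_mul s
  have i2 : Integrable (fun x => 1 + s * (f x - m)) stdG := (integrable_const 1).add i1
  rw [integral_add i2 (integrable_exp_sq_stdG.const_mul _), integral_add (integrable_const 1) i1,
    integral_const_mul, integral_const_mul, integral_sub hfi (integrable_const m)]
  simp only [integral_const, probReal_univ, smul_eq_mul, one_mul]
  have : (128 * I + 2) * K ^ 2 * s ^ 2 + 1 ≤ Real.exp ((128 * I + 2) * K ^ 2 * s ^ 2) :=
    Real.add_one_le_exp _
  have h0 : m - m = 0 := sub_self m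
  nlinarith [mul_nonneg (sq_nonneg K) (sq_nonneg s)]

/-- One-sided Bernstein inequality for functions of Gaussian coordinates of quadratic growth. -/
lemma exists_bernstein_upper : ∃ B : ℝ, 2 ≤ B ∧ ∀ {ι κ : Type} [Fintype ι] [Fintype κ]
    (e : κ → ι), Function.Injective e → ∀ (F : κ → ℝ → ℝ) (K r : ℝ), 1 ≤ K →
    (∀ k, Measurable (F k)) → (∀ k x, |F k x| ≤ K * (1 + x ^ 2)) → 0 ≤ r → r ≤ 1 →
    (stdPi ι).real {ζ | r * Fintype.card κ ≤ ∑ k, (F k (ζ (e k)) - ∫ y, F k y ∂stdG)} ≤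
      Real.exp (-(r ^ 2 * Fintype.card κ / (4 * B * K ^ 2))) := by
  obtain ⟨B, hB2, hB⟩ := exists_mgf_bound
  refine ⟨2 * B, by linarith, fun {ι κ} _ _ e he F K r hK hm hF hr hr1 => ?_⟩
  set s : ℝ := r / (4 * B * K ^ 2) with hs
  have hs0 : 0 ≤ s := by positivity
  have hsK : |s| * K ≤ 1 / 8 := by
    rw [abs_of_nonneg hs0, hs, div_mul_eq_mul_div, div_le_div_iff₀ (by positivity) (by norm_num)]
    nlinarith [mul_le_mul hr1 hK (by norm_num) (by norm_num), mul_le_mul hB2 hK (by norm_num)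
      (by linarith)]
  set Y : κ → (ι → ℝ) → ℝ := fun k ζ => F k (ζ (e k)) - ∫ y, F k y ∂stdG with hY
  have hind0 : iIndepFun (fun (i : ι) (ζ : ι → ℝ) => ζ i) (stdPi ι) :=
    iIndepFun_pi (X := fun _ x => x) fun _ => aemeasurable_id
  have hind : iIndepFun Y (stdPi ι) :=
    (hind0.precomp he).comp (fun k x => F k x - ∫ y, F k y ∂stdG)
      (fun k => (hm k).sub_const _)
  have hYm : ∀ k, Measurable (Y k) := fun k =>
    ((hm k).comp (measurable_pi_apply _)).sub_const _
  have hYi : ∀ k, Integrable (fun ζ => Real.exp (s * Y k ζ)) (stdPi ι) := fun k => by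
    have := (hB (F k) K s (hm k) (hF k) hsK).1
    exact (measurePreserving_eval (fun _ : ι => stdG) (e k)).integrable_comp_of_integrable this
  have hmgf : ∀ k, mgf (Y k) (stdPi ι) s ≤ Real.exp (B * K ^ 2 * s ^ 2) := fun k => by
    have h1 := (hB (F k) K s (hm k) (hF k) hsK)
    have h2 : ∫ ζ : ι → ℝ, Real.exp (s * Y k ζ) ∂stdPi ι =
        ∫ x, Real.exp (s * (F k x - ∫ y, F k y ∂stdG)) ∂stdG := by
      simp only [hY]
      set m := ∫ y, F k y ∂stdG
      have hmp := measurePreserving_eval (fun _ : ι => stdG) (e k)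
      rw [← hmp.map_eq, integral_map hmp.measurable.aemeasurable
        (((hm k).sub_const _).const_mul s).exp.aestronglyMeasurable]
      rfl
    rw [mgf, h2]
    exact h1.2
  have hInt : Integrable (fun ζ => Real.exp (s * (∑ k, Y k) ζ)) (stdPi ι) :=
    hind.integrable_exp_mul_sum hYm fun k _ => hYi k
  have h := measure_ge_le_exp_mul_mgf (μ := stdPi ι) (X := ∑ k, Y k) (r * Fintype.card κ) hs0 hInt
  rw [hind.mgf_sum hYm] at h
  have e1 : {ζ | r * Fintype.card κ ≤ ∑ k, (F k (ζ (e k)) - ∫ y, F k y ∂stdG)} =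
      {ζ | r * Fintype.card κ ≤ (∑ k, Y k) ζ} := by
    ext ζ; simp [hY, Finset.sum_apply]
  rw [e1]
  refine h.trans ?_
  have h3 : ∏ k, mgf (Y k) (stdPi ι) s ≤ Real.exp (B * K ^ 2 * s ^ 2) ^ Fintype.card κ :=
    (Finset.prod_le_prod (fun k _ => mgf_nonneg) fun k _ => hmgf k).trans_eq (by simp)
  refine (mul_le_mul_of_nonneg_left h3 (Real.exp_pos _).le).trans ?_
  rw [← Real.exp_nat_mul, ← Real.exp_add]
  refine Real.exp_le_exp.2 ?_
  have e2 : -s * (r * Fintype.card κ) + Fintype.card κ * (B * K ^ 2 * s ^ 2) =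
      -(3 / 2 * (r ^ 2 * Fintype.card κ / (4 * (2 * B) * K ^ 2))) := by
    rw [hs]
    field_simp
    ring
  rw [e2]
  have : 0 ≤ r ^ 2 * Fintype.card κ / (4 * (2 * B) * K ^ 2) := by positivity
  linarith

/-- Two-sided Bernstein inequality for functions of Gaussian coordinates of quadratic growth. -/
lemma exists_bernstein (K : ℝ) : ∃ c : ℝ, 0 < c ∧ ∀ {ι κ : Type} [Fintype ι] [Fintype κ]
    (e : κ → ι), Function.Injective e → ∀ (F : κ → ℝ → ℝ) (r : ℝ),
    (∀ k, Measurable (F k)) → (∀ k x, |F k x| ≤ K * (1 + x ^ 2)) → 0 ≤ r → r ≤ 1 →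
    stdPi ι {ζ | r * Fintype.card κ ≤ |∑ k, (F k (ζ (e k)) - ∫ y, F k y ∂stdG)|} ≤
      ENNReal.ofReal (2 * Real.exp (-(c * r ^ 2 * Fintype.card κ))) := by
  obtain ⟨B, hB2, hB⟩ := exists_bernstein_upper
  set K' := max K 1
  have hK' : 1 ≤ K' := le_max_right _ _
  refine ⟨1 / (4 * B * K' ^ 2), by positivity, fun {ι κ} _ _ e he F r hm hF hr hr1 => ?_⟩
  have hF' : ∀ k x, |F k x| ≤ K' * (1 + x ^ 2) := fun k x =>
    (hF k x).trans (mul_le_mul_of_nonneg_right (le_max_left _ _) (by positivity))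
  have h1 := hB e he F K' r hK' hm hF' hr hr1
  have h2 := hB e he (fun k x => -F k x) K' r hK' (fun k => (hm k).neg)
    (fun k x => by rw [abs_neg]; exact hF' k x) hr hr1
  rw [← ofReal_measureReal]
  refine ENNReal.ofReal_le_ofReal ?_
  have hsub : {ζ : ι → ℝ | r * Fintype.card κ ≤ |∑ k, (F k (ζ (e k)) - ∫ y, F k y ∂stdG)|} ⊆
      {ζ | r * Fintype.card κ ≤ ∑ k, (F k (ζ (e k)) - ∫ y, F k y ∂stdG)} ∪
      {ζ | r * Fintype.card κ ≤ ∑ k, (-F k (ζ (e k)) - ∫ y, -F k y ∂stdG)} := by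
    intro ζ hζ
    rcases le_abs.1 hζ.out with h | h
    · exact Or.inl h
    · refine Or.inr (h.trans_eq ?_)
      rw [← Finset.sum_neg_distrib]
      refine Finset.sum_congr rfl fun k _ => ?_
      rw [integral_neg]
      ring
  refine (measureReal_mono hsub).trans ((measureReal_union_le _ _).trans ?_)
  have e1 : 1 / (4 * B * K' ^ 2) * r ^ 2 * Fintype.card κ =
      r ^ 2 * Fintype.card κ / (4 * B * K' ^ 2) := by ring
  rw [e1]
  linarith

/-- Gaussian tail bound for a single coordinate. -/
lemma stdPi_abs_coord_ge_le {ι : Type*} [Fintype ι] (i : ι) {t : ℝ} (ht : 0 ≤ t) :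
    stdPi ι {ζ | t ≤ |ζ i|} ≤ ENNReal.ofReal (2 * Real.exp (-(t ^ 2 / 2))) := by
  have hmp := measurePreserving_eval (fun _ : ι => stdG) i
  have e1 : stdPi ι {ζ | t ≤ |ζ i|} = stdG {x | t ≤ |x|} :=
    hmp.measure_preimage (measurableSet_le measurable_const measurable_norm).nullMeasurableSet
  rw [e1, ← ofReal_measureReal]
  refine ENNReal.ofReal_le_ofReal ?_
  have hi : ∀ s : ℝ, Integrable (fun x => Real.exp (s * x)) stdG := fun s =>
    integrable_exp_mul_gaussianReal s
  have hsub : {x : ℝ | t ≤ |x|} ⊆ {x | t ≤ id x} ∪ {x | id x ≤ -t} := by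
    intro x hx
    rcases le_abs.1 hx.out with h | h
    · exact Or.inl h
    · refine Or.inr ?_
      simp only [Set.mem_ofPred_eq, id]
      linarith
  refine (measureReal_mono hsub).trans ((measureReal_union_le _ _).trans ?_)
  have h1 := measure_ge_le_exp_mul_mgf (μ := stdG) (X := id) t ht (hi t)
  have h2 := measure_le_le_exp_mul_mgf (μ := stdG) (X := id) (-t) (neg_nonpos.2 ht) (hi (-t))
  have h3 : ∀ s, mgf id stdG s = Real.exp (s ^ 2 / 2) := fun s => by
    unfold stdG; rw [mgf_id_gaussianReal]; simp
  rw [h3, ← Real.exp_add] at h1 h2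
  have e2 : -t * t + t ^ 2 / 2 = -(t ^ 2 / 2) := by ring
  have e3 : -(-t) * -t + (-t) ^ 2 / 2 = -(t ^ 2 / 2) := by ring
  rw [e2] at h1
  rw [e3] at h2
  linarith

end Bernstein

section Scalar

/-- Truncation of `x` to the interval `[-b, b]`. -/
def clip (b x : ℝ) : ℝ := max (-b) (min x b)

lemma clip_of_le {b x : ℝ} (hb : 0 ≤ b) (h : x ≤ -b) : clip b x = -b := by
  unfold clip
  rw [min_eq_left (by linarith), max_eq_left h]

lemma clip_of_ge {b x : ℝ} (hb : 0 ≤ b) (h : b ≤ x) : clip b x = b := by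
  unfold clip
  rw [min_eq_right h, max_eq_right (by linarith)]

lemma clip_of_abs_le {b x : ℝ} (h : |x| ≤ b) : clip b x = x := by
  have := abs_le.1 h
  unfold clip
  rw [min_eq_left this.2, max_eq_right this.1]

lemma abs_clip_le {b : ℝ} (hb : 0 ≤ b) (x : ℝ) : |clip b x| ≤ b := by
  unfold clip
  rw [abs_le]
  exact ⟨le_max_left _ _, max_le (by linarith) (min_le_right _ _)⟩

lemma abs_clip_eq {b : ℝ} (hb : 0 ≤ b) (x : ℝ) : |clip b x| = min |x| b := by
  rcases le_total |x| b with h | h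
  · rw [clip_of_abs_le h, min_eq_left h]
  · rw [min_eq_right h]
    rcases le_abs.1 h with h | h
    · rw [clip_of_ge hb h, abs_of_nonneg hb]
    · rw [clip_of_le hb (by linarith), abs_neg, abs_of_nonneg hb]

lemma continuous_clip (b : ℝ) : Continuous (clip b) := by unfold clip; fun_prop

lemma eta_eq_sub_clip {b : ℝ} (hb : 0 ≤ b) (x : ℝ) : eta x b = x - clip b x := by
  unfold eta
  rcases le_total |x| b with h | h
  · rw [clip_of_abs_le h, max_eq_right (by linarith)]; simp
  · rw [max_eq_left (by linarith)]
    rcases lt_trichotomy x 0 with h0 | rfl | h0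
    · rw [abs_of_neg h0] at h ⊢
      rw [Real.sign_of_neg h0, clip_of_le hb (by linarith)]; ring
    · have : b = 0 := le_antisymm (by simpa using h) hb
      subst this; simp [clip]
    · rw [abs_of_pos h0] at h ⊢
      rw [Real.sign_of_pos h0, clip_of_ge hb h]; ring

/-- The subgradient identity for soft thresholding. -/
lemma clip_mul_sub_clip {b : ℝ} (hb : 0 ≤ b) (x : ℝ) :
    clip b x * (x - clip b x) = b * |x - clip b x| := by
  rcases le_total |x| b with h | h
  · rw [clip_of_abs_le h]; simp
  · rcases le_abs.1 h with h | h
    · rw [clip_of_ge hb h, abs_of_nonneg (by linarith)]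
    · rw [clip_of_le hb (by linarith), abs_of_nonpos (by linarith)]; ring

lemma abs_sub_clip {b : ℝ} (hb : 0 ≤ b) (x : ℝ) : |x - clip b x| = max (|x| - b) 0 := by
  rcases le_total |x| b with h | h
  · rw [clip_of_abs_le h, max_eq_right (by linarith)]; simp
  · rw [max_eq_left (by linarith)]
    rcases le_abs.1 h with h | h
    · rw [clip_of_ge hb h, abs_of_nonneg (by linarith), abs_of_nonneg (by linarith)]
    · rw [clip_of_le hb (by linarith), abs_of_nonpos (by linarith),
        abs_of_nonpos (by linarith : x ≤ 0)]; ring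

/-- The estimation error of soft thresholding, `η(ϑ + τ z; b) - ϑ`. -/
def resid (ϑ τ b z : ℝ) : ℝ := τ * z - clip b (ϑ + τ * z)

lemma continuous_resid (ϑ τ b : ℝ) : Continuous (resid ϑ τ b) := by
  have := continuous_clip b
  unfold resid; fun_prop

lemma resid_eq {b : ℝ} (hb : 0 ≤ b) (ϑ τ z : ℝ) :
    resid ϑ τ b z = eta (ϑ + τ * z) b - ϑ := by
  rw [eta_eq_sub_clip hb]; unfold resid; ring

lemma add_resid (ϑ τ b z : ℝ) :
    ϑ + resid ϑ τ b z = (ϑ + τ * z) - clip b (ϑ + τ * z) := by unfold resid; ring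

lemma hasDerivWithinAt_clip {b : ℝ} (hb : 0 ≤ b) (x : ℝ) :
    HasDerivWithinAt (clip b) (if -b ≤ x ∧ x < b then 1 else 0) (Set.Ioi x) x := by
  rcases lt_or_ge x (-b) with h | h
  · rw [if_neg (by rintro ⟨h1, _⟩; linarith)]
    have : HasDerivAt (clip b) 0 x := (hasDerivAt_const x (-b)).congr_of_eventuallyEq
      ((eventually_le_nhds h).mono fun y hy => clip_of_le hb hy)
    exact this.hasDerivWithinAt
  rcases lt_or_ge x b with h' | h'
  · rw [if_pos ⟨h, h'⟩]
    refine (hasDerivWithinAt_id x _).congr_of_eventuallyEq ?_ ?_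
    · filter_upwards [self_mem_nhdsWithin, nhdsWithin_le_nhds (eventually_lt_nhds h')] with y h1 h2
      exact clip_of_abs_le (abs_le.2 ⟨h.trans h1.out.le, h2.le⟩)
    · exact clip_of_abs_le (abs_le.2 ⟨h, h'.le⟩)
  · rw [if_neg (by rintro ⟨_, h1⟩; linarith)]
    refine (hasDerivWithinAt_const x _ b).congr_of_eventuallyEq ?_ (clip_of_ge hb h')
    filter_upwards [self_mem_nhdsWithin] with y h1
    exact clip_of_ge hb (h'.trans h1.out.le)

lemma tendsto_gaussianPDFReal_std_atTop :
    Filter.Tendsto (gaussianPDFReal 0 1) Filter.atTop (nhds 0) := by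
  have h1 : Integrable (fun x => -x * gaussianPDFReal 0 1 x) := by
    have := integrable_stdG_iff.1 (integrable_pow_stdG 1)
    refine this.neg.congr (.of_forall fun x => ?_)
    simp; ring
  exact tendsto_zero_of_hasDerivAt_of_integrableOn_Ioi (a := 0)
    (fun x _ => hasDerivAt_gaussianPDFReal_std x) h1.integrableOn
    (integrable_gaussianPDFReal 0 1).integrableOn

lemma stdG_real_eq_integral (s : Set ℝ) (hs : MeasurableSet s) :
    stdG.real s = ∫ z, s.indicator 1 z ∂stdG := (integral_indicator_one hs).symm

/-- Gaussian integration by parts for the truncation. -/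
lemma stein_clip {b τ : ℝ} (hb : 0 ≤ b) (hτ : 0 < τ) (ϑ : ℝ) :
    ∫ z, z * clip b (ϑ + τ * z) ∂stdG =
      ∫ z, τ * (if -b ≤ ϑ + τ * z ∧ ϑ + τ * z < b then 1 else 0) ∂stdG := by
  set p := gaussianPDFReal 0 1 with hp
  set I : ℝ → ℝ := fun z => if -b ≤ ϑ + τ * z ∧ ϑ + τ * z < b then 1 else 0 with hI
  have hc : Continuous fun z => clip b (ϑ + τ * z) := by
    have := continuous_clip b; fun_prop
  have hl : Measurable fun z => ϑ + τ * z := by fun_prop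
  have hs : MeasurableSet {z | -b ≤ ϑ + τ * z ∧ ϑ + τ * z < b} :=
    (measurableSet_le measurable_const hl).inter (measurableSet_lt hl measurable_const)
  have hIm : Measurable I := Measurable.ite hs measurable_const measurable_const
  have hI1 : ∀ z, |I z| ≤ 1 := fun z => by simp only [hI]; split_ifs <;> simp
  have i1 : Integrable (fun z => z * clip b (ϑ + τ * z)) stdG := by
    have := (integrable_pow_stdG 1).mul_bdd (c := b) hc.aestronglyMeasurable
      (.of_forall fun z => abs_clip_le hb (ϑ + τ * z))
    simpa using this
  have i2 : Integrable (fun z => τ * I z) stdG :=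
    (Integrable.of_bound hIm.aestronglyMeasurable 1 (.of_forall hI1)).const_mul τ
  rw [← sub_eq_zero, ← integral_sub i1 i2, integral_stdG]
  set F : ℝ → ℝ := fun z => -(p z * clip b (ϑ + τ * z)) with hF
  have hd : ∀ z, HasDerivWithinAt F (p z * (z * clip b (ϑ + τ * z) - τ * I z)) (Set.Ioi z) z := by
    intro z
    have h1 : HasDerivWithinAt (fun z => ϑ + τ * z) τ (Set.Ioi z) z := by
      simpa using (((hasDerivAt_id z).const_mul τ).const_add ϑ).hasDerivWithinAt
    have h2 := (hasDerivWithinAt_clip hb (ϑ + τ * z)).comp z h1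
      (fun y hy => by
        have := mul_lt_mul_of_pos_left hy.out hτ
        simp only [Set.mem_Ioi]; linarith)
    have h3 := ((hasDerivAt_gaussianPDFReal_std z).hasDerivWithinAt (s := Set.Ioi z)).mul h2
    convert! h3.neg using 1
    simp only [hI, hp]
    simp only [Function.comp]
    ring
  have hFc : Continuous F := by
    have : Continuous p := continuous_iff_continuousAt.2 fun x =>
      (hasDerivAt_gaussianPDFReal_std x).continuousAt
    fun_prop
  have hInt : Integrable (fun z => p z * (z * clip b (ϑ + τ * z) - τ * I z)) :=
    integrable_stdG_iff.1 (i1.sub i2)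
  have ht := intervalIntegral_tendsto_integral hInt
    (Filter.tendsto_neg_atTop_atBot.comp Filter.tendsto_id) (Filter.tendsto_id (x := Filter.atTop))
  have hInt2 : ∀ k : ℝ, 0 ≤ k → ∫ z in (-k)..k, p z * (z * clip b (ϑ + τ * z) - τ * I z) =
      F k - F (-k) := fun k hk =>
    intervalIntegral.integral_eq_sub_of_hasDeriv_right_of_le (by linarith) hFc.continuousOn
      (fun x _ => hd x) hInt.intervalIntegrable
  have hF0 : Filter.Tendsto (fun k => F k - F (-k)) Filter.atTop (nhds 0) := by
    have hb' : ∀ k, ‖F k - F (-k)‖ ≤ 2 * b * p k := fun k => by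
      have e : p (-k) = p k := by simp [hp, gaussianPDFReal]
      have hp0 : 0 ≤ p k := gaussianPDFReal_nonneg _ _ _
      have h1 := abs_clip_le hb (ϑ + τ * k)
      have h2 := abs_clip_le hb (ϑ + τ * -k)
      have : F k - F (-k) = p k * (clip b (ϑ + τ * -k) - clip b (ϑ + τ * k)) := by
        simp only [hF, e]; ring
      rw [this, Real.norm_eq_abs, abs_mul, abs_of_nonneg hp0]
      have := abs_sub (clip b (ϑ + τ * -k)) (clip b (ϑ + τ * k))
      nlinarith
    refine squeeze_zero_norm hb' ?_
    simpa using tendsto_gaussianPDFReal_std_atTop.const_mul (2 * b)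
  refine tendsto_nhds_unique ht (hF0.congr' ?_)
  filter_upwards [Filter.eventually_ge_atTop 0] with k hk
  exact (hInt2 k hk).symm

end Scalar

section Empirical

lemma gaussianPDFReal_std_le_one (x : ℝ) : gaussianPDFReal 0 1 x ≤ 1 := by
  rw [gaussianPDFReal]
  refine mul_le_one₀ (inv_le_one_of_one_le₀ ?_) (Real.exp_pos _).le (Real.exp_le_one_iff.2 ?_)
  · rw [Real.one_le_sqrt]
    have := Real.pi_gt_three
    simp; linarith
  · simp only [sub_zero, NNReal.coe_one, mul_one]
    have := sq_nonneg x
    linarith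

lemma stdG_real_Icc_le {a c : ℝ} (h : a ≤ c) : stdG.real (Set.Icc a c) ≤ c - a := by
  rw [stdG_real_eq_integral _ measurableSet_Icc, integral_stdG]
  have e : ∫ x, gaussianPDFReal 0 1 x * (Set.Icc a c).indicator 1 x =
      ∫ x in Set.Icc a c, gaussianPDFReal 0 1 x := by
    rw [← integral_indicator measurableSet_Icc]
    congr 1; ext x
    by_cases hx : x ∈ Set.Icc a c <;> simp [hx]
  rw [e]
  calc _ ≤ ∫ x in Set.Icc a c, (1 : ℝ) :=
        setIntegral_mono (integrable_gaussianPDFReal 0 1).integrableOn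
          (integrableOn_const (by simp)) gaussianPDFReal_std_le_one
    _ = c - a := by simp [h]

instance : NullSingletonClass stdG := by
  unfold stdG; exact nullSingletonClass_gaussianReal (by norm_num)

/-- The probability that `ϑ + τ z` exceeds `b` in absolute value. -/
def tailProb (ϑ τ b : ℝ) : ℝ := stdG.real {z | b ≤ |ϑ + τ * z|}

lemma measurable_abs_affine (ϑ τ : ℝ) : Measurable fun z : ℝ => |ϑ + τ * z| := by
  have : Continuous fun z : ℝ => |ϑ + τ * z| := (by fun_prop : Continuous fun z => ϑ + τ * z).abs
  exact this.measurable

lemma tailProb_sub_le {τ : ℝ} (hτ : 0 < τ) (ϑ b : ℝ) {k : ℝ} (hk : 0 ≤ k) :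
    tailProb ϑ τ (b - k) ≤ tailProb ϑ τ b + 2 * k / τ := by
  have hsub : {z : ℝ | b - k ≤ |ϑ + τ * z|} ⊆ {z | b ≤ |ϑ + τ * z|} ∪
      (Set.Icc ((b - k - ϑ) / τ) ((b - ϑ) / τ) ∪ Set.Icc ((-b - ϑ) / τ) ((k - b - ϑ) / τ)) := by
    intro z hz
    have hz := hz.out
    rcases le_or_gt b |ϑ + τ * z| with h | h
    · exact Or.inl h
    refine Or.inr ?_
    have h2 := abs_lt.1 h
    rcases le_abs.1 hz with h1 | h1
    · left
      rw [Set.mem_Icc, div_le_iff₀ hτ, le_div_iff₀ hτ]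
      constructor <;> nlinarith
    · right
      rw [Set.mem_Icc, div_le_iff₀ hτ, le_div_iff₀ hτ]
      constructor <;> nlinarith
  have h1 := stdG_real_Icc_le (a := (b - k - ϑ) / τ) (c := (b - ϑ) / τ)
    (div_le_div_of_nonneg_right (by linarith) hτ.le)
  have h2 := stdG_real_Icc_le (a := (-b - ϑ) / τ) (c := (k - b - ϑ) / τ)
    (div_le_div_of_nonneg_right (by linarith) hτ.le)
  have h3 := (measureReal_mono hsub).trans ((measureReal_union_le (μ := stdG) _ _).trans
    (add_le_add_right (measureReal_union_le _ _) _))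
  unfold tailProb
  have e : 2 * k / τ = ((b - ϑ) / τ - (b - k - ϑ) / τ) + ((k - b - ϑ) / τ - (-b - ϑ) / τ) := by
    field_simp; ring
  linarith

lemma stdG_real_lt_eq_tailProb {τ : ℝ} (hτ : 0 < τ) (ϑ b : ℝ) :
    stdG.real {z | b < |ϑ + τ * z|} = tailProb ϑ τ b := by
  refine le_antisymm (measureReal_mono fun z hz => hz.out.le) ?_
  have hsub : {z : ℝ | b ≤ |ϑ + τ * z|} ⊆ {z | b < |ϑ + τ * z|} ∪
      {(b - ϑ) / τ, (-b - ϑ) / τ} := by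
    intro z hz
    rcases hz.out.lt_or_eq with h | h
    · exact Or.inl h
    · right
      rcases abs_choice (ϑ + τ * z) with h' | h' <;> rw [h'] at h
      · left; rw [h]; field_simp; ring
      · right; rw [h]; simp; field_simp
  have h0 : stdG.real {(b - ϑ) / τ, (-b - ϑ) / τ} = 0 := by
    rw [Measure.real, (Set.toFinite _).measure_zero]; rfl
  have := (measureReal_mono hsub).trans (measureReal_union_le (μ := stdG) _ _)
  unfold tailProb; linarith

lemma integral_mul_resid {τ b : ℝ} (hb : 0 ≤ b) (hτ : 0 < τ) (ϑ : ℝ) :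
    ∫ z, z * resid ϑ τ b z ∂stdG = τ * tailProb ϑ τ b := by
  have hc : Continuous fun z => clip b (ϑ + τ * z) := by
    have := continuous_clip b; fun_prop
  have i1 : Integrable (fun z => z * clip b (ϑ + τ * z)) stdG := by
    have := (integrable_pow_stdG 1).mul_bdd (c := b) hc.aestronglyMeasurable
      (.of_forall fun z => abs_clip_le hb (ϑ + τ * z))
    simpa using this
  have e : ∀ z, z * resid ϑ τ b z = τ * ((1 + z ^ 2) - 1) - z * clip b (ϑ + τ * z) := fun z => by
    unfold resid; ring
  have i2 : Integrable (fun z : ℝ => 1 + z ^ 2) stdG :=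
    (integrable_const 1).add (integrable_pow_stdG 2)
  simp_rw [e]
  have i3 : Integrable (fun z : ℝ => 1 + z ^ 2 - 1) stdG := i2.sub (integrable_const 1)
  rw [integral_sub (i3.const_mul τ) i1, integral_const_mul,
    integral_sub i2 (integrable_const 1), integral_one_add_sq_stdG, stein_clip hb hτ,
    integral_const_mul]
  have hs : MeasurableSet {z : ℝ | b ≤ |ϑ + τ * z|} :=
    measurableSet_le measurable_const (measurable_abs_affine ϑ τ)
  have hcompl : ∫ z, (if -b ≤ ϑ + τ * z ∧ ϑ + τ * z < b then (1 : ℝ) else 0) ∂stdG =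
      1 - tailProb ϑ τ b := by
    have h1 : 1 - tailProb ϑ τ b = stdG.real {z : ℝ | b ≤ |ϑ + τ * z|}ᶜ := by
      rw [probReal_compl_eq_one_sub hs]; rfl
    rw [h1, stdG_real_eq_integral _ hs.compl]
    refine integral_congr_ae ?_
    have hae : ∀ᵐ z ∂stdG, z ≠ (-b - ϑ) / τ := by
      rw [ae_iff]; simp
    filter_upwards [hae] with z hz
    have hne : ϑ + τ * z ≠ -b := fun h => hz (by rw [← h]; field_simp; ring)
    by_cases h : -b ≤ ϑ + τ * z ∧ ϑ + τ * z < b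
    · rw [if_pos h, Set.indicator_of_mem]
      · rfl
      · have := abs_lt.2 ⟨lt_of_le_of_ne h.1 (Ne.symm hne), h.2⟩
        simpa using this
    · rw [if_neg h, Set.indicator_of_notMem]
      intro h'
      have : |ϑ + τ * z| < b := by simpa using h'
      exact h ⟨(abs_lt.1 this).1.le, (abs_lt.1 this).2⟩
  rw [hcompl]
  simp only [integral_const, probReal_univ, smul_eq_mul, one_mul]
  ring

variable {N : ℕ}

lemma empDist_prod_stdG (θ : Fin N → ℝ) :
    (empDist θ).prod stdG = ((N : ℝ≥0∞))⁻¹ • ∑ i, stdG.map (Prod.mk (θ i)) := by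
  unfold empDist
  rw [Measure.prod_smul_left]
  congr 1
  have : ∀ s : Finset (Fin N), (∑ i ∈ s, Measure.dirac (θ i)).prod stdG =
      ∑ i ∈ s, stdG.map (Prod.mk (θ i)) := by
    intro s
    induction s using Finset.induction_on with
    | empty => simp
    | insert a s ha ih =>
      rw [Finset.sum_insert ha, Finset.sum_insert ha, Measure.add_prod, ih, Measure.dirac_prod]
  exact this _

lemma integral_empDist_prod (θ : Fin N → ℝ) {f : ℝ × ℝ → ℝ} (hf : Measurable f)
    (hi : ∀ i, Integrable (fun z => f (θ i, z)) stdG) :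
    ∫ q, f q ∂((empDist θ).prod stdG) = (1 / (N : ℝ)) * ∑ i, ∫ z, f (θ i, z) ∂stdG := by
  rw [empDist_prod_stdG, integral_smul_measure, integral_finsetSum_measure]
  · simp only [smul_eq_mul, ENNReal.toReal_inv, ENNReal.toReal_natCast, one_div]
    congr 1
    refine Finset.sum_congr rfl fun i _ => ?_
    rw [integral_map (by fun_prop) hf.aestronglyMeasurable]
  · intro i _
    rw [integrable_map_measure hf.aestronglyMeasurable (by fun_prop)]
    exact hi i

lemma measurable_eta (b : ℝ) : Measurable fun x => eta x b := by
  unfold eta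
  have h1 : Measurable Real.sign := by
    unfold Real.sign
    exact Measurable.ite (measurableSet_lt measurable_id measurable_const) measurable_const
      (Measurable.ite (measurableSet_lt measurable_const measurable_id) measurable_const
        measurable_const)
  have h2 : Measurable fun x : ℝ => max (|x| - b) 0 := by
    have : Continuous fun x : ℝ => max (|x| - b) 0 :=
      (continuous_abs.sub continuous_const).max continuous_const
    exact this.measurable
  exact h1.mul h2

lemma resid_sq_le {τ b : ℝ} (hb : 0 ≤ b) (ϑ z : ℝ) :
    resid ϑ τ b z ^ 2 ≤ 2 * τ ^ 2 * z ^ 2 + 2 * b ^ 2 := by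
  have h1 : clip b (ϑ + τ * z) ^ 2 ≤ b ^ 2 := sq_le_sq.2 (by
    rw [abs_of_nonneg hb]; exact abs_clip_le hb _)
  unfold resid
  nlinarith [sq_nonneg (τ * z + clip b (ϑ + τ * z))]

lemma stateEvo_sums {δ σ lam β τ : ℝ} {n : ℕ} {θ : Fin N → ℝ} (hδ : 0 < δ) (hN : 0 < N)
    (hn : (n : ℝ) = δ * N) (hl : 0 < lam) (h : StateEvo δ σ (empDist θ) lam β τ) :
    (∑ i, ∫ z, resid (θ i) τ (τ * lam / β) z ^ 2 ∂stdG = n * (τ ^ 2 - σ ^ 2)) ∧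
    (∑ i, tailProb (θ i) τ (τ * lam / β)) = n * (1 - β / τ) ∧
    sStar (empDist θ) τ (lam / β) = (1 / (N : ℝ)) * ∑ i, tailProb (θ i) τ (τ * lam / β) := by
  obtain ⟨hβ, hτ, h1, h2⟩ := h
  set b := τ * lam / β with hbdef
  have hb : 0 ≤ b := by positivity
  have hN' : (0 : ℝ) < N := by exact_mod_cast hN
  have hlin : ∀ ϑ : ℝ, Measurable fun z => ϑ + τ * z := fun ϑ => by fun_prop
  refine ⟨?_, ?_, ?_⟩
  · rw [integral_empDist_prod] at h1
    · simp_rw [← resid_eq hb] at h1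
      rw [hn, h1]
      field_simp
      ring
    · have := (measurable_eta b).comp (by fun_prop : Measurable fun q : ℝ × ℝ => q.1 + τ * q.2)
      exact (this.sub measurable_fst).pow_const 2
    · intro i
      simp_rw [← resid_eq hb]
      refine integrable_of_le_quadratic (K := 2 * τ ^ 2 + 2 * b ^ 2)
        ((continuous_resid _ _ _).pow 2).measurable fun x => ?_
      rw [abs_of_nonneg (sq_nonneg _)]
      have := resid_sq_le (τ := τ) hb (θ i) x
      nlinarith [sq_nonneg (τ), sq_nonneg b, mul_nonneg (sq_nonneg b) (sq_nonneg x)]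
  · have hi : ∀ i, ∫ z, eta' (θ i + τ * z) b ∂stdG = tailProb (θ i) τ b := fun i => by
      rw [← stdG_real_lt_eq_tailProb hτ, stdG_real_eq_integral _
        (measurableSet_lt measurable_const (measurable_abs_affine _ _))]
      refine integral_congr_ae (.of_forall fun z => ?_)
      unfold eta'
      by_cases hz : b < |θ i + τ * z| <;> simp [hz]
    have hm : Measurable fun q : ℝ × ℝ => eta' (q.1 + τ * q.2) b := by
      unfold eta'
      have hc : Continuous fun q : ℝ × ℝ => |q.1 + τ * q.2| :=
        (by fun_prop : Continuous fun q : ℝ × ℝ => q.1 + τ * q.2).abs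
      exact Measurable.ite (measurableSet_lt measurable_const hc.measurable) measurable_const
        measurable_const
    rw [integral_empDist_prod _ hm] at h2
    · simp only [hi] at h2
      rw [hn]
      generalize (∑ i, tailProb (θ i) τ b) = S at h2 ⊢
      have : β / τ = 1 - 1 / δ * (1 / N * S) := by rw [div_eq_iff hτ.ne', h2]; ring
      rw [this]
      field_simp
      ring
    · intro i
      refine Integrable.of_bound (C := 1)
        (hm.comp measurable_prodMk_left).aestronglyMeasurable (.of_forall fun z => ?_)
      unfold eta'; split_ifs <;> simp
  · unfold sStar tailProb
    have hc : Continuous fun q : ℝ × ℝ => |q.1 + τ * q.2| :=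
      (by fun_prop : Continuous fun q : ℝ × ℝ => q.1 + τ * q.2).abs
    have hs : MeasurableSet {q : ℝ × ℝ | lam / β * τ ≤ |q.1 + τ * q.2|} :=
      measurableSet_le measurable_const hc.measurable
    rw [empDist_prod_stdG]
    have hb' : lam / β * τ = b := by rw [hbdef]; ring
    simp only [Measure.smul_apply, Measure.finsetSum_apply, smul_eq_mul, ENNReal.toReal_mul,
      ENNReal.toReal_inv, ENNReal.toReal_natCast, one_div]
    rw [ENNReal.toReal_sum]
    · congr 1
      refine Finset.sum_congr rfl fun i _ => ?_
      rw [Measure.map_apply measurable_prodMk_left hs, hb']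
      rfl
    · intro i _
      rw [Measure.map_apply measurable_prodMk_left hs]
      exact measure_ne_top _ _

end Empirical

section GoodEvent

/-- All problem parameters lie in `[1/M, M]` and satisfy the a priori orderings. -/
structure Admissible (M δ σ lam β τ : ℝ) : Prop where
  one_le : 1 ≤ M
  le_sigma : 1 / M ≤ σ
  sigma_le : σ ≤ τ
  tau_le : τ ≤ M
  le_beta : 1 / M ≤ β
  beta_le : β ≤ τ
  le_lam : 1 / M ≤ lam
  lam_le : lam ≤ M
  le_delta : 1 / M ≤ δ
  delta_le : δ ≤ M

namespace Admissible

variable {M δ σ lam β τ : ℝ}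

lemma M_pos (h : Admissible M δ σ lam β τ) : 0 < M := lt_of_lt_of_le one_pos h.one_le
lemma inv_pos (h : Admissible M δ σ lam β τ) : 0 < 1 / M := one_div_pos.2 h.M_pos
lemma sigma_pos (h : Admissible M δ σ lam β τ) : 0 < σ := h.inv_pos.trans_le h.le_sigma
lemma tau_pos (h : Admissible M δ σ lam β τ) : 0 < τ := h.sigma_pos.trans_le h.sigma_le
lemma beta_pos (h : Admissible M δ σ lam β τ) : 0 < β := h.inv_pos.trans_le h.le_beta
lemma lam_pos (h : Admissible M δ σ lam β τ) : 0 < lam := h.inv_pos.trans_le h.le_lam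
lemma delta_pos (h : Admissible M δ σ lam β τ) : 0 < δ := h.inv_pos.trans_le h.le_delta
lemma one_le_mul_beta (h : Admissible M δ σ lam β τ) : 1 ≤ M * β := by
  have := h.le_beta; rwa [div_le_iff₀' h.M_pos] at this
lemma one_le_mul_sigma (h : Admissible M δ σ lam β τ) : 1 ≤ M * σ := by
  have := h.le_sigma; rwa [div_le_iff₀' h.M_pos] at this
lemma one_le_mul_delta (h : Admissible M δ σ lam β τ) : 1 ≤ M * δ := by
  have := h.le_delta; rwa [div_le_iff₀' h.M_pos] at this
lemma one_le_mul_tau (h : Admissible M δ σ lam β τ) : 1 ≤ M * τ :=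
  h.one_le_mul_sigma.trans (mul_le_mul_of_nonneg_left h.sigma_le h.M_pos.le)
lemma threshold_nonneg (h : Admissible M δ σ lam β τ) : 0 ≤ τ * lam / β :=
  div_nonneg (mul_nonneg h.tau_pos.le h.lam_pos.le) h.beta_pos.le
lemma threshold_le (h : Admissible M δ σ lam β τ) : τ * lam / β ≤ M ^ 3 := by
  rw [div_le_iff₀ h.beta_pos]
  have h1 : τ * lam ≤ M * M := mul_le_mul h.tau_le h.lam_le h.lam_pos.le h.M_pos.le
  nlinarith [mul_le_mul_of_nonneg_left h.one_le_mul_beta (sq_nonneg M)]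

end Admissible

variable {n N : ℕ}

/-- The expectation of `λ (‖x₀‖₁ - ‖θ‖₁)` for the soft thresholding output `x₀`. -/
def l1Mean (θ : Fin N → ℝ) (lam τ b : ℝ) : ℝ :=
  ∑ q, ∫ z, lam * (|θ q + resid (θ q) τ b z| - |θ q|) ∂stdG

/-- The event on which all empirical averages are close to their expectations. -/
structure GoodEvent (θ : Fin N → ℝ) (σ lam β τ t k : ℝ) (ζ : AuxIdx n N → ℝ) : Prop where
  row : |∑ p : Fin n, (ζ (.inl p) ^ 2 - 1)| ≤ t * n
  extra : |ζ (.inr (.inr ()))| ≤ t * √n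
  sq : |∑ q, resid (θ q) τ (τ * lam / β) (ζ (.inr (.inl q))) ^ 2 - n * (τ ^ 2 - σ ^ 2)| ≤ t * n
  cross : |∑ q, ζ (.inr (.inl q)) * resid (θ q) τ (τ * lam / β) (ζ (.inr (.inl q))) -
    n * (τ - β)| ≤ t * n
  l1 : |∑ q, lam * (|θ q + resid (θ q) τ (τ * lam / β) (ζ (.inr (.inl q)))| - |θ q|) -
    l1Mean θ lam τ (τ * lam / β)| ≤ t * n
  large : ∑ q, tailProb (θ q) τ (τ * lam / β + k) - k * N ≤
    ((Finset.univ.filter fun q =>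
      τ * lam / β + k ≤ |θ q + τ * ζ (.inr (.inl q))|).card : ℝ)
  saturated : ((Finset.univ.filter fun q =>
      τ * lam / β - k ≤ |θ q + τ * ζ (.inr (.inl q))|).card : ℝ) ≤
    ∑ q, tailProb (θ q) τ (τ * lam / β - k) + k * N

lemma integral_sq_stdG : ∫ x : ℝ, x ^ 2 ∂stdG = 1 := by
  have h := integral_one_add_sq_stdG
  rw [integral_add (integrable_const _) (integrable_pow_stdG 2)] at h
  simp at h; linarith

lemma abs_resid_le {τ b : ℝ} (hτ : 0 ≤ τ) (hb : 0 ≤ b) (ϑ z : ℝ) :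
    |resid ϑ τ b z| ≤ τ * |z| + b := by
  unfold resid
  refine (abs_sub _ _).trans (add_le_add ?_ (abs_clip_le hb _))
  rw [abs_mul, abs_of_nonneg hτ]

lemma card_filter_eq_sum_indicator {b τ : ℝ} (θ : Fin N → ℝ) (g : Fin N → ℝ) :
    ((Finset.univ.filter fun q => b ≤ |θ q + τ * g q|).card : ℝ) =
      ∑ q, {z : ℝ | b ≤ |θ q + τ * z|}.indicator 1 (g q) := by
  rw [Finset.card_filter]
  push_cast
  refine Finset.sum_congr rfl fun q _ => ?_
  by_cases h : b ≤ |θ q + τ * g q| <;> simp [h]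

set_option maxHeartbeats 2000000 in
lemma exists_goodEvent_bound (M : ℝ) : ∃ c : ℝ, 0 < c ∧
    ∀ {n N : ℕ} {θ : Fin N → ℝ} {δ σ lam β τ t k : ℝ}, 0 < N → (n : ℝ) = δ * N →
    Admissible M δ σ lam β τ → StateEvo δ σ (empDist θ) lam β τ → 0 < t → t ≤ k → k ≤ 1 →
    stdPi (AuxIdx n N) {ζ | ¬ GoodEvent θ σ lam β τ t k ζ} ≤
      ENNReal.ofReal (14 * Real.exp (-(c * N * t ^ 2))) := by
  obtain ⟨c, hc, hB⟩ := exists_bernstein (3 * M ^ 7)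
  by_cases hM1 : 1 ≤ M
  swap
  · exact ⟨1, one_pos, fun _ _ hA => absurd hA.one_le hM1⟩
  set c' := min c (1 / 2) / M ^ 2 with hc'
  have hM0 : 0 < M := by linarith
  refine ⟨c', by positivity, fun {n N θ δ σ lam β τ t k} hN hn hA hSE ht htk hk => ?_⟩
  obtain ⟨s1, s2, -⟩ := stateEvo_sums hA.delta_pos hN hn hA.lam_pos hSE
  set b := τ * lam / β with hbd
  have hb : 0 ≤ b := hA.threshold_nonneg
  have hbM : b ≤ M ^ 3 := hA.threshold_le
  have hτ := hA.tau_pos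
  have hN' : (0 : ℝ) < N := by exact_mod_cast hN
  have hnN : (N : ℝ) / M ≤ n := by
    rw [hn, div_le_iff₀ hM0]
    nlinarith [hA.one_le_mul_delta]
  have hn0 : (0 : ℝ) < n := lt_of_lt_of_le (by positivity) hnN
  set E := ENNReal.ofReal (2 * Real.exp (-(c' * N * t ^ 2))) with hE
  have hp1 : ∀ {m m' : ℕ}, m' ≤ m → (1 : ℝ) ≤ M → M ^ m' ≤ M ^ m := fun h h' =>
    pow_le_pow_right₀ h' h
  have k7 : 1 ≤ M ^ 7 := one_le_pow₀ hM1
  have e6 : M ^ 6 ≤ M ^ 7 := hp1 (by norm_num) hM1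
  have e3 : M ^ 3 ≤ M ^ 7 := hp1 (by norm_num) hM1
  have e4 : M ^ 4 ≤ M ^ 7 := hp1 (by norm_num) hM1
  have e2 : M ^ 2 ≤ M ^ 7 := hp1 (by norm_num) hM1
  have e1 : M ≤ M ^ 7 := by simpa using hp1 (m' := 1) (m := 7) (by norm_num) hM1
  have hcc : ∀ x y : ℝ, c' * N * t ^ 2 ≤ x → Real.exp (-x) ≤ Real.exp (-(c' * N * t ^ 2)) :=
    fun x _ h => Real.exp_le_exp.2 (neg_le_neg h)
  have hc1 : c' ≤ c / M ^ 2 := div_le_div_of_nonneg_right (min_le_left _ _) (by positivity)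
  have hc2 : c' ≤ 1 / 2 / M ^ 2 := div_le_div_of_nonneg_right (min_le_right _ _) (by positivity)
  have hMN : (N : ℝ) / M ^ 2 ≤ n := by
    refine le_trans ?_ hnN
    exact div_le_div_of_nonneg_left hN'.le hM0 (by nlinarith)
  have ht1 : t ≤ 1 := htk.trans hk
  have hinj : Function.Injective (fun q : Fin N => (Sum.inr (Sum.inl q) : AuxIdx n N)) :=
    fun a a' h => by simpa using h
  -- sums over the columns with deviation proportional to `n`
  have col : ∀ F : Fin N → ℝ → ℝ, (∀ q, Measurable (F q)) →
      (∀ q x, |F q x| ≤ 3 * M ^ 7 * (1 + x ^ 2)) →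
      stdPi (AuxIdx n N) {ζ | ¬ |∑ q, F q (ζ (.inr (.inl q))) - ∑ q, ∫ y, F q y ∂stdG| ≤ t * n} ≤
        E := by
    intro F hFm hF
    have h1 := hB _ hinj F (t / M) hFm hF (by positivity)
      ((div_le_one hM0).2 (ht1.trans hM1))
    refine (measure_mono fun ζ hζ => ?_).trans (h1.trans (ENNReal.ofReal_le_ofReal ?_))
    · have hζ := (not_le.1 hζ).le
      simp only [Set.mem_ofPred_eq, Fintype.card_fin]
      rw [Finset.sum_sub_distrib]
      refine le_trans ?_ hζ
      rw [div_mul_eq_mul_div, mul_div_assoc]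
      exact mul_le_mul_of_nonneg_left hnN ht.le
    · rw [Fintype.card_fin]
      refine mul_le_mul_of_nonneg_left (hcc _ 0 ?_) (by norm_num)
      calc c' * N * t ^ 2 ≤ c / M ^ 2 * N * t ^ 2 := by gcongr
        _ = c * (t / M) ^ 2 * N := by field_simp
  have ind : ∀ d : ℝ, stdPi (AuxIdx n N) {ζ | ¬ |((Finset.univ.filter fun q =>
      d ≤ |θ q + τ * ζ (.inr (.inl q))|).card : ℝ) - ∑ q, tailProb (θ q) τ d| ≤ k * N} ≤ E := by
    intro d
    have hs : ∀ q, MeasurableSet {z : ℝ | d ≤ |θ q + τ * z|} := fun q =>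
      measurableSet_le measurable_const (measurable_abs_affine _ _)
    have h1 := hB _ hinj (fun q => {z : ℝ | d ≤ |θ q + τ * z|}.indicator 1) k
      (fun q => measurable_one.indicator (hs q)) (fun q x => ?_) (by linarith) hk
    · refine (measure_mono fun ζ hζ => ?_).trans (h1.trans (ENNReal.ofReal_le_ofReal ?_))
      · have hζ := (not_le.1 hζ).le
        simp only [Set.mem_ofPred_eq, Fintype.card_fin]
        rw [Finset.sum_sub_distrib, ← card_filter_eq_sum_indicator]
        simp_rw [← stdG_real_eq_integral _ (hs _)]
        exact hζ
      · rw [Fintype.card_fin]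
        refine mul_le_mul_of_nonneg_left (hcc _ 0 ?_) (by norm_num)
        have : c' ≤ c := hc1.trans (div_le_self hc.le (one_le_pow₀ hM1))
        calc c' * N * t ^ 2 ≤ c * N * k ^ 2 := by gcongr
          _ = c * k ^ 2 * N := by ring
    · have : |{z : ℝ | d ≤ |θ q + τ * z|}.indicator (1 : ℝ → ℝ) x| ≤ 1 := by
        by_cases h : d ≤ |θ q + τ * x| <;> simp [h]
      nlinarith [mul_nonneg (by linarith : (0 : ℝ) ≤ M ^ 7) (sq_nonneg x)]
  have b1 : stdPi (AuxIdx n N) {ζ | ¬ |∑ p : Fin n, (ζ (.inl p) ^ 2 - 1)| ≤ t * n} ≤ E := by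
    have h1 := hB (fun p : Fin n => (Sum.inl p : AuxIdx n N)) Sum.inl_injective
      (fun _ x => x ^ 2) t (fun _ => by fun_prop)
      (fun _ x => by rw [abs_of_nonneg (sq_nonneg x)]; nlinarith [sq_nonneg x]) ht.le ht1
    refine (measure_mono fun ζ hζ => ?_).trans (h1.trans (ENNReal.ofReal_le_ofReal ?_))
    · have hζ := (not_le.1 hζ).le
      simpa only [Set.mem_ofPred_eq, Fintype.card_fin, integral_sq_stdG] using hζ
    · rw [Fintype.card_fin]
      refine mul_le_mul_of_nonneg_left (hcc _ 0 ?_) (by norm_num)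
      calc c' * N * t ^ 2 ≤ c / M ^ 2 * N * t ^ 2 := by gcongr
        _ = c * t ^ 2 * (N / M ^ 2) := by ring
        _ ≤ c * t ^ 2 * n := by gcongr
  have b2 : stdPi (AuxIdx n N) {ζ | ¬ |ζ (.inr (.inr ()))| ≤ t * √n} ≤ E := by
    have h1 := stdPi_abs_coord_ge_le (ι := AuxIdx n N) (.inr (.inr ()))
      (t := t * √n) (by positivity)
    refine (measure_mono fun ζ hζ => (not_le.1 hζ).le).trans
      (h1.trans (ENNReal.ofReal_le_ofReal ?_))
    refine mul_le_mul_of_nonneg_left (hcc _ 0 ?_) (by norm_num)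
    rw [mul_pow, Real.sq_sqrt hn0.le]
    calc c' * N * t ^ 2 ≤ 1 / 2 / M ^ 2 * N * t ^ 2 := by gcongr
      _ = t ^ 2 * (N / M ^ 2) / 2 := by ring
      _ ≤ t ^ 2 * n / 2 := by gcongr
  have b3 := col (fun q z => resid (θ q) τ b z ^ 2)
    (fun q => ((continuous_resid _ _ _).pow 2).measurable) (fun q x => by
      rw [abs_of_nonneg (sq_nonneg _)]
      refine (resid_sq_le hb (θ q) x).trans ?_
      have h1 : τ ^ 2 ≤ M ^ 2 := pow_le_pow_left₀ hτ.le hA.tau_le 2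
      have h2 : b ^ 2 ≤ M ^ 6 := by
        have := pow_le_pow_left₀ hb hbM 2
        rwa [← pow_mul] at this
      nlinarith [sq_nonneg x, mul_nonneg (by linarith : (0 : ℝ) ≤ M ^ 7 - τ ^ 2) (sq_nonneg x)])
  rw [s1] at b3
  have b4 := col (fun q z => z * resid (θ q) τ b z)
    (fun q => (continuous_id.mul (continuous_resid _ _ _)).measurable) (fun q x => by
      rw [abs_mul]
      have h1 := mul_le_mul_of_nonneg_left (abs_resid_le hτ.le hb (θ q) x) (abs_nonneg x)
      have h2 := sq_abs x
      have h3 : |x| ≤ 1 + x ^ 2 := by nlinarith [sq_nonneg (|x| - 1)]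
      have h4 : τ * x ^ 2 ≤ M ^ 7 * x ^ 2 :=
        mul_le_mul_of_nonneg_right (hA.tau_le.trans e1) (sq_nonneg x)
      have h5 : |x| * b ≤ (1 + x ^ 2) * M ^ 7 :=
        mul_le_mul h3 (hbM.trans e3) hb (by positivity)
      nlinarith)
  have s4 : ∑ q, ∫ z, z * resid (θ q) τ b z ∂stdG = n * (τ - β) := by
    simp_rw [integral_mul_resid hb hτ, ← Finset.mul_sum]
    rw [s2]; field_simp
  rw [s4] at b4
  have b5 := col (fun q z => lam * (|θ q + resid (θ q) τ b z| - |θ q|))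
    (fun q => (continuous_const.mul (((continuous_const.add
      (continuous_resid _ _ _)).abs).sub continuous_const)).measurable) (fun q x => by
      rw [abs_mul, abs_of_pos hA.lam_pos]
      have h0 : |(|θ q + resid (θ q) τ b x| - |θ q|)| ≤ |resid (θ q) τ b x| := by
        refine (abs_abs_sub_abs_le _ _).trans_eq ?_
        congr 1; ring
      have h1 := h0.trans (abs_resid_le hτ.le hb (θ q) x)
      have h2 := sq_abs x
      have h3 : |x| ≤ 1 + x ^ 2 := by nlinarith [sq_nonneg (|x| - 1)]
      have h4 : τ * |x| ≤ M * (1 + x ^ 2) := mul_le_mul hA.tau_le h3 (abs_nonneg _) hM0.le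
      have h5 := mul_le_mul hA.lam_le (h1.trans (add_le_add h4 hbM)) (abs_nonneg _) hM0.le
      refine h5.trans ?_
      nlinarith [mul_nonneg (by linarith : (0 : ℝ) ≤ M ^ 7 - M ^ 2) (sq_nonneg x),
        mul_nonneg (by linarith : (0 : ℝ) ≤ M ^ 7) (sq_nonneg x)])
  have b6 := ind (b + k)
  have b7 := ind (b - k)
  have hsub : {ζ : AuxIdx n N → ℝ | ¬ GoodEvent θ σ lam β τ t k ζ} ⊆
      {ζ | ¬ |∑ p : Fin n, (ζ (.inl p) ^ 2 - 1)| ≤ t * n} ∪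
      ({ζ | ¬ |ζ (.inr (.inr ()))| ≤ t * √n} ∪
      ({ζ | ¬ |∑ q, resid (θ q) τ b (ζ (.inr (.inl q))) ^ 2 - n * (τ ^ 2 - σ ^ 2)| ≤ t * n} ∪
      ({ζ | ¬ |∑ q, ζ (.inr (.inl q)) * resid (θ q) τ b (ζ (.inr (.inl q))) -
          n * (τ - β)| ≤ t * n} ∪
      ({ζ | ¬ |∑ q, lam * (|θ q + resid (θ q) τ b (ζ (.inr (.inl q)))| - |θ q|) -
          ∑ q, ∫ z, lam * (|θ q + resid (θ q) τ b z| - |θ q|) ∂stdG| ≤ t * n} ∪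
      ({ζ | ¬ |((Finset.univ.filter fun q =>
        b + k ≤ |θ q + τ * ζ (.inr (.inl q))|).card : ℝ) - ∑ q, tailProb (θ q) τ (b + k)|
          ≤ k * N} ∪
      {ζ | ¬ |((Finset.univ.filter fun q =>
        b - k ≤ |θ q + τ * ζ (.inr (.inl q))|).card : ℝ) - ∑ q, tailProb (θ q) τ (b - k)|
          ≤ k * N}))))) := by
    intro ζ hζ
    by_contra hcon
    simp only [Set.mem_union, Set.mem_ofPred_eq, not_or, not_not] at hcon
    obtain ⟨a1, a2, a3, a4, a5, a6, a7⟩ := hcon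
    refine hζ ⟨a1, a2, a3, a4, a5, ?_, ?_⟩
    · linarith [(abs_le.1 a6).1]
    · linarith [(abs_le.1 a7).2]
  refine (measure_mono hsub).trans ?_
  have e14 : ENNReal.ofReal (14 * Real.exp (-(c' * N * t ^ 2))) =
      E + (E + (E + (E + (E + (E + E))))) := by
    rw [hE, ← ENNReal.ofReal_add (by positivity) (by positivity),
      ← ENNReal.ofReal_add (by positivity) (by positivity),
      ← ENNReal.ofReal_add (by positivity) (by positivity),
      ← ENNReal.ofReal_add (by positivity) (by positivity),
      ← ENNReal.ofReal_add (by positivity) (by positivity),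
      ← ENNReal.ofReal_add (by positivity) (by positivity)]
    congr 1; ring
  rw [e14]
  refine (measure_union_le _ _).trans (add_le_add b1 ?_)
  refine (measure_union_le _ _).trans (add_le_add b2 ?_)
  refine (measure_union_le _ _).trans (add_le_add b3 ?_)
  refine (measure_union_le _ _).trans (add_le_add b4 ?_)
  refine (measure_union_le _ _).trans (add_le_add b5 ?_)
  exact (measure_union_le _ _).trans (add_le_add b6 b7)

end GoodEvent

section PrimalDeterministic

set_option maxHeartbeats 1000000 in
lemma primal_scalar {M δ σ lam β τ t r T q m W : ℝ} (hA : Admissible M δ σ lam β τ)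
    (ht0 : 0 ≤ t) (ht : 100 * M ^ 10 * t ≤ 1) (hr : r ≤ 1) (hσT : σ ≤ T)
    (hT2 : T ^ 2 = q + σ ^ 2) (hW : |W - (τ ^ 2 - σ ^ 2)| ≤ t)
    (hQ : 0 ≤ q - 2 * (T / τ) * m + (T / τ) ^ 2 * W)
    (h : β * T * (1 - t) - β * τ - t * (1 + β + β * σ) - β / τ * m + β / τ * W ≤ r) :
    (T - τ) ^ 2 ≤ 40 * M ^ 10 * (r + 12 * M ^ 4 * t) ∧
      q - 2 * (T / τ) * m + (T / τ) ^ 2 * W ≤ 20 * M ^ 6 * (r + 12 * M ^ 4 * t) := by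
  have hM1 := hA.one_le
  have hM := hA.M_pos
  have hτ := hA.tau_pos
  have hβ := hA.beta_pos
  have hσ := hA.sigma_pos
  have hT : 0 < T := hσ.trans_le hσT
  have hβM : β ≤ M := hA.beta_le.trans hA.tau_le
  have hσM : σ ≤ M := hA.sigma_le.trans hA.tau_le
  have hMτ := hA.one_le_mul_tau
  have hMβ := hA.one_le_mul_beta
  have hMσ := hA.one_le_mul_sigma
  set Q := q - 2 * (T / τ) * m + (T / τ) ^ 2 * W with hQd
  set D := (T - τ) ^ 2 / T with hD
  have hD0 : 0 ≤ D := by positivity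
  have hTD : T ≤ D + 2 * M := by
    have : D = T - 2 * τ + τ ^ 2 / T := by rw [hD]; field_simp; ring
    have h2 : 0 ≤ τ ^ 2 / T := by positivity
    linarith [hA.tau_le]
  have hid : β * T * (1 - t) - β * τ - t * (1 + β + β * σ) - β / τ * m + β / τ * W =
      β * σ ^ 2 / (2 * τ ^ 2) * D + β * Q / (2 * T) +
        (W - (τ ^ 2 - σ ^ 2)) * (β * (1 / τ - T / (2 * τ ^ 2))) -
        t * (1 + β + β * σ + β * T) := by
    have hq : q = T ^ 2 - σ ^ 2 := by linarith
    rw [hQd, hD, hq]; field_simp; ring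
  have ha : 1 / (2 * M ^ 5) ≤ β * σ ^ 2 / (2 * τ ^ 2) := by
    rw [div_le_div_iff₀ (by positivity) (by positivity)]
    have h1 : τ ^ 2 ≤ M ^ 2 := pow_le_pow_left₀ hτ.le hA.tau_le 2
    have h2 : 1 ≤ (M * β) * (M * σ) ^ 2 := one_le_mul_of_one_le_of_one_le hMβ (one_le_pow₀ hMσ)
    nlinarith [mul_le_mul_of_nonneg_left h2 (sq_nonneg M)]
  have herr : -(t * (1 + M ^ 2 * T)) ≤
      (W - (τ ^ 2 - σ ^ 2)) * (β * (1 / τ - T / (2 * τ ^ 2))) := by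
    have h1 : |β * (1 / τ - T / (2 * τ ^ 2))| ≤ 1 + M ^ 2 * T := by
      have e1 : β * (1 / τ - T / (2 * τ ^ 2)) = β / τ - β / τ * (1 / τ) * (T / 2) := by
        field_simp
      have e2 : β / τ ≤ 1 := (div_le_one hτ).2 hA.beta_le
      have e3 : 1 / τ ≤ M := by rw [div_le_iff₀ hτ]; exact hMτ
      have e4 : 0 ≤ β / τ := by positivity
      have e5 : 0 ≤ 1 / τ := by positivity
      have e6 : β / τ * (1 / τ) ≤ 1 * M := mul_le_mul e2 e3 e5 zero_le_one
      have e7 : β / τ * (1 / τ) * (T / 2) ≤ 1 * M * (T / 2) :=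
        mul_le_mul_of_nonneg_right e6 (by positivity)
      have e8 : M * T ≤ M ^ 2 * T := by nlinarith [mul_pos hM hT]
      have e9 : 0 ≤ β / τ * (1 / τ) * (T / 2) := by positivity
      have e10 : 0 < M * T := by positivity
      rw [e1, abs_le]; constructor <;> linarith
    have h2 := mul_le_mul hW h1 (abs_nonneg _) ht0
    rw [← abs_mul] at h2
    linarith [(abs_le.1 h2).1]
  have hp : ∀ i j : ℕ, i ≤ j → M ^ i ≤ M ^ j := fun i j hij => pow_le_pow_right₀ hM1 hij
  have hmain : 1 / (2 * M ^ 5) * D + β * Q / (2 * T) ≤ r + 4 * M ^ 3 * t * (1 + T) := by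
    have h1 := mul_le_mul_of_nonneg_right ha hD0
    have h2 : 1 + β + β * σ + β * T + (1 + M ^ 2 * T) ≤ 4 * M ^ 3 * (1 + T) := by
      have e1 : β * σ ≤ M * M := mul_le_mul hβM hσM hσ.le hM.le
      have e2 : β * T ≤ M * T := mul_le_mul_of_nonneg_right hβM hT.le
      have p1 := hp 1 3 (by norm_num); have p2 := hp 2 3 (by norm_num)
      have p0 := hp 0 3 (by norm_num)
      simp only [pow_one, pow_zero] at p1 p0
      have e3 := mul_le_mul_of_nonneg_right p1 hT.le
      have e4 := mul_le_mul_of_nonneg_right p2 hT.le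
      have e5 : 0 ≤ M ^ 3 * T := by positivity
      linarith [sq M]
    have h3 := mul_le_mul_of_nonneg_left h2 ht0
    linarith
  have hs : 4 * M ^ 3 * t ≤ 1 / (4 * M ^ 5) := by
    rw [le_div_iff₀ (by positivity)]
    have p1 := mul_le_mul_of_nonneg_right (hp 8 10 (by norm_num)) ht0
    have e0 : 0 ≤ M ^ 10 * t := by positivity
    have e1 : 4 * M ^ 3 * t * (4 * M ^ 5) = 16 * (M ^ 8 * t) := by ring
    linarith
  set S := r + 12 * M ^ 4 * t with hS
  have hmain2 : 1 / (4 * M ^ 5) * D + β * Q / (2 * T) ≤ S := by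
    have h1 : 4 * M ^ 3 * t * (1 + T) ≤ 4 * M ^ 3 * t * (1 + 2 * M) + 1 / (4 * M ^ 5) * D := by
      have e1 := mul_le_mul_of_nonneg_right hs hD0
      have e2 := mul_le_mul_of_nonneg_left hTD (by positivity : 0 ≤ 4 * M ^ 3 * t)
      linarith
    have h2 : 4 * M ^ 3 * t * (1 + 2 * M) ≤ 12 * M ^ 4 * t := by
      have e1 := mul_le_mul_of_nonneg_right (hp 3 4 (by norm_num)) ht0
      have e2 : 4 * M ^ 3 * t * (1 + 2 * M) = 4 * (M ^ 3 * t) + 8 * (M ^ 4 * t) := by ring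
      linarith
    have h3 : 1 / (2 * M ^ 5) * D = 1 / (4 * M ^ 5) * D + 1 / (4 * M ^ 5) * D := by
      field_simp; ring
    linarith
  have hQT : 0 ≤ β * Q / (2 * T) := by positivity
  have hDS : D ≤ 4 * M ^ 5 * S := by
    have : 1 / (4 * M ^ 5) * D ≤ S := by linarith
    rwa [one_div, inv_mul_le_iff₀ (by positivity)] at this
  have hS0 : 0 ≤ S := by
    have : 0 ≤ 1 / (4 * M ^ 5) * D := by positivity
    linarith
  have hS2 : S ≤ 2 := by
    have p1 := mul_le_mul_of_nonneg_right (hp 4 10 (by norm_num)) ht0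
    have : 0 ≤ M ^ 10 * t := by positivity
    linarith
  have hTb : T ≤ 10 * M ^ 5 := by
    have p1 := hp 1 5 (by norm_num)
    have : 0 < M ^ 5 := by positivity
    rw [pow_one] at p1
    nlinarith
  constructor
  · have : (T - τ) ^ 2 = D * T := by rw [hD]; field_simp
    rw [this]
    calc D * T ≤ 4 * M ^ 5 * S * (10 * M ^ 5) := mul_le_mul hDS hTb hT.le (by positivity)
      _ = _ := by ring
  · have h1 : β * Q / (2 * T) ≤ S := by
      have : 0 ≤ 1 / (4 * M ^ 5) * D := by positivity
      linarith
    rw [div_le_iff₀ (by positivity)] at h1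
    have h2 : Q ≤ M * (β * Q) := by nlinarith
    calc Q ≤ M * (S * (2 * T)) := h2.trans (mul_le_mul_of_nonneg_left h1 hM.le)
      _ ≤ M * (S * (2 * (10 * M ^ 5))) := by gcongr
      _ = _ := by ring

end PrimalDeterministic

section PrimalDeterministic

/-- The common value (up to sign, and up to the factor `n`) of the auxiliary problems. -/
def optVal (n : ℕ) {N : ℕ} (θ : Fin N → ℝ) (lam β τ : ℝ) : ℝ :=
  n * (β ^ 2 / 2) + l1Mean θ lam τ (τ * lam / β) + lam * ∑ q, |θ q|

variable {n N : ℕ} {θ : Fin N → ℝ} {M δ σ lam β τ t k r : ℝ} {ζ : AuxIdx n N → ℝ}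

lemma nrm_const_mul {ι : Type*} [Fintype ι] {c : ℝ} (hc : 0 ≤ c) (u : ι → ℝ) :
    nrm (fun i => c * u i) = c * nrm u := by
  unfold nrm
  simp_rw [mul_pow, ← Finset.mul_sum]
  rw [Real.sqrt_mul (sq_nonneg c), Real.sqrt_sq hc]

lemma GoodEvent.nrm_row (hG : GoodEvent θ σ lam β τ t k ζ) (ht0 : 0 ≤ t) (ht1 : t ≤ 1) :
    (1 - t) * √n ≤ nrm (fun p : Fin n => ζ (.inl p)) ∧
      nrm (fun p : Fin n => ζ (.inl p)) ≤ (1 + t) * √n := by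
  have h1 := hG.row
  rw [Finset.sum_sub_distrib, ← nrm_sq (fun p : Fin n => ζ (.inl p))] at h1
  simp only [Finset.sum_const, Finset.card_univ, Fintype.card_fin, nsmul_eq_mul, mul_one] at h1
  obtain ⟨ha, hb⟩ := abs_le.1 h1
  have hn := Real.sq_sqrt (Nat.cast_nonneg (α := ℝ) n)
  have hn0 : (0 : ℝ) ≤ n := Nat.cast_nonneg n
  constructor
  · refine abs_le_of_sq_le_sq' ?_ (nrm_nonneg _) |>.2
    rw [mul_pow, hn]
    nlinarith [mul_nonneg (mul_nonneg ht0 (sub_nonneg.2 ht1)) hn0]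
  · refine abs_le_of_sq_le_sq' ?_ (by positivity) |>.2
    rw [mul_pow, hn]
    nlinarith [mul_nonneg ht0 hn0, mul_nonneg (mul_nonneg ht0 ht0) hn0]

lemma GoodEvent.abs_extra (hG : GoodEvent θ σ lam β τ t k ζ) :
    |√n * ζ (.inr (.inr ()))| ≤ t * n := by
  rw [abs_mul, abs_of_nonneg (Real.sqrt_nonneg _)]
  have := mul_le_mul_of_nonneg_left hG.extra (Real.sqrt_nonneg (n : ℝ))
  have hn := Real.mul_self_sqrt (Nat.cast_nonneg (α := ℝ) n)
  calc _ ≤ √n * (t * √n) := this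
    _ = t * (√n * √n) := by ring
    _ = t * n := by rw [hn]

/-- Subgradient inequality at the soft thresholding output. -/
lemma subgradient_soft {β τ lam : ℝ} (hβ : 0 < β) (hτ : 0 < τ) (hl : 0 ≤ lam) (ϑ z w : ℝ) :
    lam * |ϑ + resid ϑ τ (τ * lam / β) z| +
      (β * z - β / τ * resid ϑ τ (τ * lam / β) z) * (w - resid ϑ τ (τ * lam / β) z) ≤
      lam * |w + ϑ| := by
  have hb : 0 ≤ τ * lam / β := by positivity
  set b := τ * lam / β with hbd
  have hv : β * z - β / τ * resid ϑ τ b z = β / τ * clip b (ϑ + τ * z) := by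
    unfold resid; field_simp; ring
  have hlb : lam = β / τ * b := by rw [hbd]; field_simp
  have h1 := clip_mul_sub_clip hb (ϑ + τ * z)
  rw [← add_resid] at h1
  have h2 : clip b (ϑ + τ * z) * (w + ϑ) ≤ b * |w + ϑ| :=
    (le_abs_self _).trans (by
      rw [abs_mul]; exact mul_le_mul_of_nonneg_right (abs_clip_le hb _) (abs_nonneg _))
  have hβτ : 0 ≤ β / τ := by positivity
  rw [hv, hlb]
  have h3 := mul_le_mul_of_nonneg_left h2 hβτ
  have h4 : clip b (ϑ + τ * z) * (ϑ + resid ϑ τ b z) = b * |ϑ + resid ϑ τ b z| := h1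
  linear_combination h3 - β / τ * h4


set_option maxHeartbeats 1000000 in
lemma primal_of_goodEvent (hn0 : 0 < n) (hA : Admissible M δ σ lam β τ)
    (hG : GoodEvent θ σ lam β τ t k ζ) (ht0 : 0 ≤ t) (ht : 100 * M ^ 10 * t ≤ 1) (hr : r ≤ 1)
    {w : Fin N → ℝ} (hw : ∀ u, auxVal σ (-1) ζ u w - nrm u ^ 2 / 2 + lam * ∑ q, |w q + θ q| ≤
      optVal n θ lam β τ + n * r) :
    0 ≤ r + 12 * M ^ 4 * t ∧
      ∑ q, (w q - resid (θ q) τ (τ * lam / β) (ζ (.inr (.inl q)))) ^ 2 ≤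
        n * (200 * M ^ 14 * (r + 12 * M ^ 4 * t)) := by
  have hM1 := hA.one_le
  have hM := hA.M_pos
  have hτ := hA.tau_pos
  have hβ := hA.beta_pos
  have hσ := hA.sigma_pos
  have hl := hA.lam_pos
  have hn : (0 : ℝ) < n := by exact_mod_cast hn0
  have ht1 : 100 * t ≤ 1 := by
    have : (1 : ℝ) ≤ M ^ 10 := one_le_pow₀ hM1
    nlinarith
  set b := τ * lam / β with hbd
  set g : Fin N → ℝ := fun q => ζ (.inr (.inl q)) with hg
  set w₀ : Fin N → ℝ := fun q => resid (θ q) τ b (g q) with hw₀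
  obtain ⟨hlow, -⟩ := hG.nrm_row ht0 (by linarith)
  set h₀ := nrm (fun p : Fin n => ζ (.inl p)) with hh₀
  have hsn : 0 < √(n : ℝ) := Real.sqrt_pos.2 hn
  have hsq : √(n : ℝ) * √n = n := Real.mul_self_sqrt hn.le
  have hh0 : 0 < h₀ := lt_of_lt_of_le (mul_pos (by linarith) hsn) hlow
  set T := effT n σ w with hT
  have hT2 : T ^ 2 = (∑ q, w q ^ 2) / n + σ ^ 2 := effT_sq ..
  have hT0 : 0 ≤ T := effT_nonneg ..
  have hσT : σ ≤ T := by
    refine abs_le_of_sq_le_sq' ?_ hT0 |>.2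
    rw [hT2]
    have : 0 ≤ (∑ q, w q ^ 2) / n := by positivity
    linarith
  have hu := hw (fun p => β * √n / h₀ * ζ (.inl p))
  unfold auxVal at hu
  rw [nrm_const_mul (by positivity), ← hh₀, ← hT] at hu
  have e1 : ∑ p : Fin n, ζ (.inl p) * (β * √n / h₀ * ζ (.inl p)) = β * √n * h₀ := by
    have : ∑ p : Fin n, ζ (.inl p) * (β * √n / h₀ * ζ (.inl p)) = β * √n / h₀ * h₀ ^ 2 := by
      rw [hh₀, nrm_sq, Finset.mul_sum]
      exact Finset.sum_congr rfl fun p _ => by ring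
    rw [this]; field_simp
  have e2 : β * √n / h₀ * h₀ = β * √n := by field_simp
  rw [e1, e2] at hu
  have e3 : β * √n * (-1 * (∑ q, ζ (.inr (.inl q)) * w q) / √n + σ * ζ (.inr (.inr ()))) =
      -(β * ∑ q, g q * w q) + β * σ * (√n * ζ (.inr (.inr ()))) := by
    rw [hg]; field_simp
  have e4 : (β * √n) ^ 2 = β ^ 2 * n := by rw [mul_pow, sq (√(n : ℝ)), hsq]
  rw [e3, e4] at hu
  have e5 : β * T * (n * (1 - t)) ≤ T * (β * √n * h₀) := by
    have : n * (1 - t) ≤ √n * h₀ := by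
      have := mul_le_mul_of_nonneg_left hlow hsn.le
      calc n * (1 - t) = √n * √n * (1 - t) := by rw [hsq]
        _ = √n * ((1 - t) * √n) := by ring
        _ ≤ _ := this
    have := mul_le_mul_of_nonneg_left this (mul_nonneg hβ.le hT0)
    linarith
  have e6 : -(β * σ * (t * n)) ≤ β * σ * (√n * ζ (.inr (.inr ()))) := by
    have := mul_le_mul_of_nonneg_left (abs_le.1 hG.abs_extra).1 (mul_pos hβ hσ).le
    linarith
  have e7 : lam * ∑ q, |θ q + w₀ q| + (β * ∑ q, g q * w q - β * ∑ q, g q * w₀ q -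
      β / τ * ∑ q, w₀ q * w q + β / τ * ∑ q, w₀ q ^ 2) ≤ lam * ∑ q, |w q + θ q| := by
    have := Finset.sum_le_sum fun q (_ : q ∈ Finset.univ) =>
      subgradient_soft hβ hτ hl.le (θ q) (g q) (w q)
    rw [← Finset.mul_sum] at this
    refine le_trans (le_of_eq ?_) this
    simp only [Finset.mul_sum, ← Finset.sum_add_distrib, ← Finset.sum_sub_distrib]
    exact Finset.sum_congr rfl fun q _ => by simp only [hw₀, ← hbd]; ring
  have e8 : l1Mean θ lam τ b + lam * ∑ q, |θ q| - t * n ≤ lam * ∑ q, |θ q + w₀ q| := by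
    have := (abs_le.1 hG.l1).1
    rw [← Finset.mul_sum, Finset.sum_sub_distrib] at this
    simp only [hw₀]
    linarith
  have e9 := (abs_le.1 hG.cross).2
  have e9' := mul_le_mul_of_nonneg_left e9 hβ.le
  have e10 := hG.sq
  set W := (∑ q, w₀ q ^ 2) / n with hW
  set m := (∑ q, w₀ q * w q) / n with hm
  set q := (∑ q, w q ^ 2) / n with hq
  have hWn : ∑ q, w₀ q ^ 2 = n * W := by rw [hW]; field_simp
  have hmn : ∑ q, w₀ q * w q = n * m := by rw [hm]; field_simp
  have hqn : ∑ j, w j ^ 2 = n * q := by rw [hq]; field_simp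
  have hWt : |W - (τ ^ 2 - σ ^ 2)| ≤ t := by
    change |∑ q, w₀ q ^ 2 - _| ≤ _ at e10
    rw [hWn, ← mul_sub, abs_mul, abs_of_pos hn, mul_comm t] at e10
    exact le_of_mul_le_mul_left e10 hn
  have hsumQ : ∀ c : ℝ, ∑ j, (w j - c * w₀ j) ^ 2 = n * (q - 2 * c * m + c ^ 2 * W) := by
    intro c
    rw [show n * (q - 2 * c * m + c ^ 2 * W) = n * q - 2 * c * (n * m) + c ^ 2 * (n * W) by ring,
      ← hWn, ← hmn, ← hqn, Finset.mul_sum, Finset.mul_sum, ← Finset.sum_sub_distrib,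
      ← Finset.sum_add_distrib]
    exact Finset.sum_congr rfl fun j _ => by ring
  have hQ : 0 ≤ q - 2 * (T / τ) * m + (T / τ) ^ 2 * W := by
    have := hsumQ (T / τ)
    have h0 : 0 ≤ ∑ j, (w j - T / τ * w₀ j) ^ 2 := Finset.sum_nonneg fun _ _ => sq_nonneg _
    rw [this] at h0
    exact nonneg_of_mul_nonneg_right h0 hn
  have hkey : β * T * (1 - t) - β * τ - t * (1 + β + β * σ) - β / τ * m + β / τ * W ≤ r := by
    refine le_of_mul_le_mul_left ?_ hn
    rw [hWn, hmn] at e7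
    unfold optVal at hu
    rw [← hbd] at hu
    change β * (∑ q, g q * w₀ q - _) ≤ _ at e9'
    linarith
  obtain ⟨r1, r2⟩ := primal_scalar hA ht0 ht hr hσT hT2 hWt hQ hkey
  set S := r + 12 * M ^ 4 * t with hS
  have hS0 : 0 ≤ S := by
    have : 0 ≤ 40 * M ^ 10 * S := (sq_nonneg _).trans r1
    exact nonneg_of_mul_nonneg_right this (by positivity)
  refine ⟨hS0, ?_⟩
  have hpt : ∑ j, (w j - w₀ j) ^ 2 ≤ 2 * (n * (q - 2 * (T / τ) * m + (T / τ) ^ 2 * W)) +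
      2 * (T / τ - 1) ^ 2 * (n * W) := by
    rw [← hsumQ, ← hWn, Finset.mul_sum, Finset.mul_sum, ← Finset.sum_add_distrib]
    refine Finset.sum_le_sum fun j _ => ?_
    nlinarith [sq_nonneg (w j - T / τ * w₀ j - (T / τ - 1) * w₀ j)]
  refine hpt.trans ?_
  have hWb : W ≤ 2 * M ^ 2 := by
    have h1 := (abs_le.1 hWt).2
    have h2 : τ ^ 2 ≤ M ^ 2 := pow_le_pow_left₀ hτ.le hA.tau_le 2
    nlinarith [sq_nonneg σ]
  have hW0 : 0 ≤ W := by rw [hW]; positivity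
  have hTτ : (T / τ - 1) ^ 2 ≤ M ^ 2 * (40 * M ^ 10 * S) := by
    have h1 : (T / τ - 1) ^ 2 = (1 / τ) ^ 2 * (T - τ) ^ 2 := by field_simp
    have h2 : (1 / τ) ^ 2 ≤ M ^ 2 :=
      pow_le_pow_left₀ (by positivity) (by rw [div_le_iff₀ hτ]; exact hA.one_le_mul_tau) 2
    rw [h1]
    exact mul_le_mul h2 r1 (sq_nonneg _) (by positivity)
  have h3 : (T / τ - 1) ^ 2 * W ≤ M ^ 2 * (40 * M ^ 10 * S) * (2 * M ^ 2) :=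
    mul_le_mul hTτ hWb hW0 (by positivity)
  have h4 : M ^ 6 * S ≤ M ^ 14 * S :=
    mul_le_mul_of_nonneg_right (pow_le_pow_right₀ hM1 (by norm_num)) hS0
  have h5 : 2 * (q - 2 * (T / τ) * m + (T / τ) ^ 2 * W) + 2 * ((T / τ - 1) ^ 2 * W) ≤
      200 * M ^ 14 * S := by
    have h6 : M ^ 2 * (40 * M ^ 10 * S) * (2 * M ^ 2) = 80 * (M ^ 14 * S) := by ring
    linarith
  have h7 := mul_le_mul_of_nonneg_left h5 hn.le
  linarith

end PrimalDeterministic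

section Counting

variable {n N : ℕ} {θ : Fin N → ℝ} {M δ σ lam β τ t k r : ℝ} {ζ : AuxIdx n N → ℝ}

lemma card_filter_mul_sq_le {ι : Type*} [Fintype ι] (p : ι → Prop) [DecidablePred p] {f : ι → ℝ}
    {k V : ℝ} (hk : 0 < k) (hp : ∀ i, p i → k ≤ |f i|) (hV : ∑ i, f i ^ 2 ≤ V) :
    ((Finset.univ.filter p).card : ℝ) ≤ V / k ^ 2 := by
  rw [le_div_iff₀ (by positivity)]
  refine le_trans ?_ hV
  calc ((Finset.univ.filter p).card : ℝ) * k ^ 2 = ∑ _i ∈ Finset.univ.filter p, k ^ 2 := by simp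
    _ ≤ ∑ i ∈ Finset.univ.filter p, f i ^ 2 := Finset.sum_le_sum fun i hi => by
        rw [← sq_abs (f i)]
        exact pow_le_pow_left₀ hk.le (hp i (Finset.mem_filter.1 hi).2) 2
    _ ≤ ∑ i, f i ^ 2 := Finset.sum_le_univ_sum_of_nonneg fun i => sq_nonneg _

lemma sum_tailProb_sub_le (hA : Admissible M δ σ lam β τ) (hk : 0 ≤ k) (b : ℝ) :
    ∑ q, tailProb (θ q) τ (b - k) ≤ ∑ q, tailProb (θ q) τ b + 2 * M * k * N := by
  have h1 : ∀ q, tailProb (θ q) τ (b - k) ≤ tailProb (θ q) τ b + 2 * M * k := fun q => by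
    refine (tailProb_sub_le hA.tau_pos _ _ hk).trans (add_le_add le_rfl ?_)
    rw [div_le_iff₀ hA.tau_pos]
    nlinarith [mul_le_mul_of_nonneg_left hA.one_le_mul_tau hk]
  refine (Finset.sum_le_sum fun q _ => h1 q).trans_eq ?_
  rw [Finset.sum_add_distrib]; simp; ring

lemma GoodEvent.sum_tailProb_le_l0 (hA : Admissible M δ σ lam β τ)
    (hG : GoodEvent θ σ lam β τ t k ζ) (hk : 0 < k) {w : Fin N → ℝ} {V : ℝ}
    (hV : ∑ q, (w q - resid (θ q) τ (τ * lam / β) (ζ (.inr (.inl q)))) ^ 2 ≤ V) :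
    ∑ q, tailProb (θ q) τ (τ * lam / β) ≤
      l0 (fun q => w q + θ q) + (1 + 2 * M) * k * N + V / k ^ 2 := by
  have hb := hA.threshold_nonneg
  set b := τ * lam / β with hbd
  have h1 := hG.large
  rw [← hbd] at h1
  have h2 := sum_tailProb_sub_le (θ := θ) hA hk.le (b + k)
  rw [add_sub_cancel_right] at h2
  set w₀ : Fin N → ℝ := fun q => resid (θ q) τ b (ζ (.inr (.inl q))) with hw₀
  have h3 : ((Finset.univ.filter fun q => b + k ≤ |θ q + τ * ζ (.inr (.inl q))|).card : ℝ) ≤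
      l0 (fun q => w q + θ q) +
        (Finset.univ.filter fun q => k ≤ |w q - w₀ q|).card := by
    unfold l0
    rw [← Nat.cast_add]
    refine Nat.cast_le.2 ((Finset.card_le_card fun q hq => ?_).trans (Finset.card_union_le _ _))
    simp only [Finset.mem_union, Finset.mem_filter, Finset.mem_univ, true_and] at hq ⊢
    by_cases hz : w q + θ q = 0
    · right
      have e1 : w q - w₀ q = -(θ q + w₀ q) := by linear_combination hz
      rw [e1, abs_neg, hw₀]
      simp only
      rw [add_resid, abs_sub_clip hb]
      exact (by linarith : k ≤ _).trans (le_max_left _ _)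
    · exact .inl hz
  have h4 := card_filter_mul_sq_le (fun q => k ≤ |w q - w₀ q|) hk (fun _ h => h) hV
  linarith

lemma GoodEvent.saturated_le (hA : Admissible M δ σ lam β τ)
    (hG : GoodEvent θ σ lam β τ t k ζ) (hk : 0 < k) {v : Fin N → ℝ} {V : ℝ}
    (hV : ∑ q, (β / τ * clip (τ * lam / β) (θ q + τ * ζ (.inr (.inl q))) - v q) ^ 2 ≤ V) :
    ((Finset.univ.filter fun q => lam ≤ |v q|).card : ℝ) ≤
      ∑ q, tailProb (θ q) τ (τ * lam / β) + (1 + 2 * M) * k * N + M ^ 4 * V / k ^ 2 := by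
  have hb := hA.threshold_nonneg
  have hβ := hA.beta_pos
  have hτ := hA.tau_pos
  have hM := hA.M_pos
  set b := τ * lam / β with hbd
  have hlb : lam = β / τ * b := by rw [hbd]; field_simp
  have h1 := hG.saturated
  rw [← hbd] at h1
  have h2 := sum_tailProb_sub_le (θ := θ) hA hk.le b
  have hκ : 0 < β / τ * k := by positivity
  have h3 : ((Finset.univ.filter fun q => lam ≤ |v q|).card : ℝ) ≤
      (Finset.univ.filter fun q => b - k ≤ |θ q + τ * ζ (.inr (.inl q))|).card +
        (Finset.univ.filter fun q => β / τ * k ≤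
          |β / τ * clip b (θ q + τ * ζ (.inr (.inl q))) - v q|).card := by
    rw [← Nat.cast_add]
    refine Nat.cast_le.2 ((Finset.card_le_card fun q hq => ?_).trans (Finset.card_union_le _ _))
    simp only [Finset.mem_union, Finset.mem_filter, Finset.mem_univ, true_and] at hq ⊢
    by_contra! hcon
    obtain ⟨c1, c2⟩ := hcon
    set x := θ q + τ * ζ (.inr (.inl q))
    have c3 : |v q| ≤ |β / τ * clip b x - v q| + |β / τ * clip b x| := by
      rw [← abs_neg (β / τ * clip b x - v q)]
      refine le_trans (le_of_eq ?_) (abs_add_le _ _)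
      congr 1; ring
    have c4 : |β / τ * clip b x| ≤ β / τ * (b - k) := by
      rw [abs_mul, abs_of_pos (by positivity : 0 < β / τ), abs_clip_eq hb]
      exact mul_le_mul_of_nonneg_left ((min_le_left _ _).trans c1.le) (by positivity)
    linarith
  have h4 := card_filter_mul_sq_le (fun q => β / τ * k ≤
    |β / τ * clip b (θ q + τ * ζ (.inr (.inl q))) - v q|) hκ (fun _ h => h) hV
  have hV0 : 0 ≤ V := (Finset.sum_nonneg fun _ _ => sq_nonneg _).trans hV
  have h5 : V / (β / τ * k) ^ 2 ≤ M ^ 4 * V / k ^ 2 := by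
    have e : 1 ≤ M ^ 2 * (β / τ) := by
      have : M ^ 2 * (β / τ) = (M * β) * (M / τ) := by field_simp
      rw [this]
      exact one_le_mul_of_one_le_of_one_le hA.one_le_mul_beta ((one_le_div hτ).2 hA.tau_le)
    rw [div_le_div_iff₀ (by positivity) (by positivity)]
    have e2 : 1 ≤ (M ^ 2 * (β / τ)) ^ 2 := one_le_pow₀ e
    calc V * k ^ 2 = V * k ^ 2 * 1 := by ring
      _ ≤ V * k ^ 2 * (M ^ 2 * (β / τ)) ^ 2 := by gcongr
      _ = _ := by ring
  linarith

end Counting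

section DualDeterministic

lemma effT_scalar_le {M δ σ lam β τ t T X E : ℝ} (hA : Admissible M δ σ lam β τ) (ht0 : 0 ≤ t)
    (hT : T ^ 2 = X + E) (hX : X ≤ τ ^ 2 + t) : T ≤ τ + M * t + E / (2 * τ) := by
  have hτ := hA.tau_pos
  have h1 : T ≤ τ / 2 + T ^ 2 / (2 * τ) := by
    have : τ / 2 + T ^ 2 / (2 * τ) - T = (T - τ) ^ 2 / (2 * τ) := by field_simp; ring
    have h2 : 0 ≤ (T - τ) ^ 2 / (2 * τ) := by positivity
    linarith
  have h2 : T ^ 2 / (2 * τ) ≤ τ / 2 + t * (1 / τ) / 2 + E / (2 * τ) := by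
    have : τ / 2 + t * (1 / τ) / 2 + E / (2 * τ) = (τ ^ 2 + t + E) / (2 * τ) := by
      field_simp
    rw [this]
    exact div_le_div_of_nonneg_right (by linarith) (by positivity)
  have h3 : 1 / τ ≤ M := by rw [div_le_iff₀ hτ]; exact hA.one_le_mul_tau
  have h4 := mul_le_mul_of_nonneg_left h3 ht0
  have h5 : 0 ≤ t * (1 / τ) := by positivity
  linarith

lemma dual_scalar_group {M δ σ lam β τ t B G : ℝ} (hA : Admissible M δ σ lam β τ)
    (ht0 : 0 ≤ t) (ht1 : t ≤ 1) (hB : 0 ≤ B) (hG : τ - β - t ≤ G) :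
    (B - β) ^ 2 / 2 - β ^ 2 / 2 - 5 * M * (B * t) ≤
      -(B * (1 + t) * (τ + M * t)) + B * G - B * σ * t + B ^ 2 / 2 := by
  have hM1 := hA.one_le
  have h1 := mul_le_mul_of_nonneg_left hG hB
  have hBt : 0 ≤ B * t := mul_nonneg hB ht0
  have h2 := mul_le_mul_of_nonneg_left hA.tau_le hBt
  have h3 := mul_le_mul_of_nonneg_left (hA.sigma_le.trans hA.tau_le) hBt
  have h4 := mul_le_mul_of_nonneg_left ht1 (mul_nonneg hBt hA.M_pos.le)
  have h5 := mul_le_mul_of_nonneg_left hM1 hBt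
  nlinarith

lemma dual_scalar_radius {M δ σ lam β τ t r T W B G : ℝ} (hA : Admissible M δ σ lam β τ)
    (ht0 : 0 ≤ t) (ht : 10 * M * t ≤ 1) (hT : T ^ 2 = W + σ ^ 2) (hW : W ≤ τ ^ 2 - σ ^ 2 + t)
    (hB : 0 ≤ B) (hG : τ - β - t ≤ G)
    (h : -(B * (1 + t) * T) + B * G - B * σ * t + B ^ 2 / 2 - t ≤ -(β ^ 2 / 2) + r) :
    (B - β) ^ 2 ≤ 4 * (r + 11 * M ^ 2 * t) := by
  have hM1 := hA.one_le
  have hMt : t ≤ M * t := by nlinarith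
  have ht1 : t ≤ 1 := by nlinarith
  have h1 : T ≤ τ + M * t := by
    have := effT_scalar_le (T := T) (X := W + σ ^ 2) (E := 0) hA ht0 (by rw [hT]; ring) (by linarith)
    simpa using this
  have h2 := dual_scalar_group hA ht0 ht1 hB hG
  have h3 := mul_le_mul_of_nonneg_left h1 (mul_nonneg hB (by linarith : 0 ≤ 1 + t))
  have h4 : B ≤ M + 1 / 2 + (B - β) ^ 2 / 2 := by
    have := hA.beta_le.trans hA.tau_le
    nlinarith [sq_nonneg (B - β - 1)]
  have h5 : 5 * (M * t) * B ≤ 5 * (M * t) * (M + 1 / 2) + (B - β) ^ 2 / 4 := by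
    have e1 := mul_le_mul_of_nonneg_left h4 (by positivity : 0 ≤ 5 * (M * t))
    have e2 := mul_le_mul_of_nonneg_right ht (sq_nonneg (B - β))
    linarith
  have h6 : M * t ≤ M ^ 2 * t := by nlinarith [mul_nonneg hA.M_pos.le ht0]
  linarith

set_option maxHeartbeats 1000000 in
lemma dual_scalar_dist {M δ σ lam β τ t r T W B G Δ md vd gd V : ℝ}
    (hA : Admissible M δ σ lam β τ)
    (ht0 : 0 ≤ t) (ht : 10 * M * t ≤ 1)
    (hT : T ^ 2 = W + md / 2 + Δ / 16 + σ ^ 2) (hW : W ≤ τ ^ 2 - σ ^ 2 + t)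
    (hB : 0 ≤ B) (hG : τ - β - t ≤ G)
    (hB2 : (B - β) ^ 2 ≤ 4 * (r + 11 * M ^ 2 * t)) (hr : 4 * M ^ 2 * (r + 11 * M ^ 2 * t) ≤ 1)
    (hgd : gd = vd / β + md / τ) (hmd : |md| ≤ (W + Δ) / 2) (hΔ0 : 0 ≤ Δ) (hΔ : Δ ≤ 4 * M ^ 3)
    (hvd : ∀ c : ℝ, -(Δ / 4 + c ^ 2 * V) ≤ c * vd) (hV : V ≤ M ^ 3)
    (h : -(B * (1 + t) * T) + B * (G + gd / 4) - B * σ * t + B ^ 2 / 2 - t - vd / 4 + Δ / 4 ≤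
      -(β ^ 2 / 2) + r) :
    Δ ≤ 32 * M ^ 5 * (r + 13 * M ^ 2 * t) := by
  have hM1 := hA.one_le
  have hM := hA.M_pos
  have hτ := hA.tau_pos
  have hβ := hA.beta_pos
  have hMt : t ≤ M * t := by nlinarith
  have ht1 : t ≤ 1 := by nlinarith
  have hc2 : (B / β - 1) ^ 2 ≤ M ^ 2 * (4 * (r + 11 * M ^ 2 * t)) := by
    have e1 : (B / β - 1) ^ 2 = (1 / β) ^ 2 * (B - β) ^ 2 := by field_simp
    have e2 : (1 / β) ^ 2 ≤ M ^ 2 :=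
      pow_le_pow_left₀ (by positivity) (by rw [div_le_iff₀ hβ]; exact hA.one_le_mul_beta) 2
    rw [e1]
    exact mul_le_mul e2 hB2 (sq_nonneg _) (by positivity)
  have hBβ : B ≤ 2 * β := by
    have : B / β - 1 ≤ 1 := abs_le_of_sq_le_sq' (by rw [one_pow]; linarith) zero_le_one |>.2
    have : B / β ≤ 2 := by linarith
    rwa [div_le_iff₀ hβ] at this
  have hBτ : B / τ ≤ 2 := by
    rw [div_le_iff₀ hτ]; linarith [hA.beta_le]
  have h1 := effT_scalar_le (T := T) (X := W + σ ^ 2) (E := md / 2 + Δ / 16) hA ht0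
    (by rw [hT]; ring) (by linarith)
  have h2 := dual_scalar_group hA ht0 ht1 hB hG
  have h3 := mul_le_mul_of_nonneg_left h1 (mul_nonneg hB (by linarith : 0 ≤ 1 + t))
  have h4 : B * (1 + t) * (τ + M * t + (md / 2 + Δ / 16) / (2 * τ)) =
      B * (1 + t) * (τ + M * t) + B / τ * md / 4 + B / τ * t * md / 4 +
        B / τ * (1 + t) * (Δ / 32) := by
    field_simp; ring
  have h5 : B / τ * (1 + t) * (Δ / 32) ≤ 2 * 2 * (Δ / 32) := by
    gcongr; linarith
  have h6 : B * (G + gd / 4) = B * G + B / β * vd / 4 + B / τ * md / 4 := by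
    rw [hgd]; field_simp; ring
  have h7 := hvd (B / β - 1)
  have hW2 : W ≤ 2 * M ^ 2 := by
    have : τ ^ 2 ≤ M ^ 2 := pow_le_pow_left₀ hτ.le hA.tau_le 2
    nlinarith [sq_nonneg σ]
  have h8 : B / τ * t * md ≤ 2 * t * (3 * M ^ 3) := by
    have e1 : md ≤ 3 * M ^ 3 := by
      have : M ^ 2 ≤ M ^ 3 := pow_le_pow_right₀ hM1 (by norm_num)
      linarith [le_abs_self md]
    have e2 : 0 ≤ B / τ * t := by positivity
    calc B / τ * t * md ≤ B / τ * t * (3 * M ^ 3) := mul_le_mul_of_nonneg_left e1 e2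
      _ ≤ _ := by gcongr
  have h9 : (B / β - 1) ^ 2 * V ≤ M ^ 2 * (4 * (r + 11 * M ^ 2 * t)) * M ^ 3 := by
    calc (B / β - 1) ^ 2 * V ≤ (B / β - 1) ^ 2 * M ^ 3 :=
          mul_le_mul_of_nonneg_left hV (sq_nonneg _)
      _ ≤ _ := mul_le_mul_of_nonneg_right hc2 (by positivity)
  have hS0 : 0 ≤ r + 11 * M ^ 2 * t := by linarith [(sq_nonneg (B - β)).trans hB2]
  have h10 : 5 * M * (B * t) ≤ 10 * M ^ 2 * t := by
    have : B ≤ 2 * M := hBβ.trans (by linarith [hA.beta_le.trans hA.tau_le])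
    have := mul_le_mul_of_nonneg_left this (by positivity : 0 ≤ 5 * M * t)
    linarith [sq M]
  have h11 : t ≤ M ^ 2 * t := le_mul_of_one_le_left ht0 (one_le_pow₀ hM1)
  have h12 : r + 11 * M ^ 2 * t ≤ M ^ 5 * (r + 11 * M ^ 2 * t) :=
    le_mul_of_one_le_left hS0 (one_le_pow₀ hM1)
  have h13 : M ^ 3 * t ≤ M ^ 7 * t :=
    mul_le_mul_of_nonneg_right (pow_le_pow_right₀ hM1 (by norm_num)) ht0
  have h14 : M ^ 7 * t = M ^ 5 * (M ^ 2 * t) := by ring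
  have h15 : M ^ 2 * (4 * (r + 11 * M ^ 2 * t)) * M ^ 3 = 4 * (M ^ 5 * (r + 11 * M ^ 2 * t)) := by
    ring
  have h16 : 0 ≤ M ^ 7 * t := by positivity
  have h17 : Δ / 16 ≤ 2 * (M ^ 5 * (r + 11 * M ^ 2 * t)) + 3 * (M ^ 3 * t) / 2 := by
    linarith [sq_nonneg (B - β)]
  have h18 : M ^ 5 * (r + 13 * M ^ 2 * t) = M ^ 5 * (r + 11 * M ^ 2 * t) + 2 * (M ^ 7 * t) := by
    ring
  linarith

end DualDeterministic

section DualDeterministic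

variable {n N : ℕ} {θ : Fin N → ℝ} {M δ σ lam β τ t k r : ℝ} {ζ : AuxIdx n N → ℝ}

lemma GoodEvent.auxVal_ge (hn : 0 < n) (hσ : 0 ≤ σ) (hG : GoodEvent θ σ lam β τ t k ζ)
    (ht0 : 0 ≤ t) (ht1 : t ≤ 1) (u : Fin n → ℝ) (w : Fin N → ℝ) :
    -(n * (nrm u / √n * (1 + t) * effT n σ w)) +
      nrm u / √n * ∑ q, ζ (.inr (.inl q)) * w q - n * (nrm u / √n * σ * t) ≤
      auxVal σ 1 ζ u w := by
  have hn' : (0 : ℝ) < n := by exact_mod_cast hn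
  have hsn : 0 < √(n : ℝ) := Real.sqrt_pos.2 hn'
  have hsq : √(n : ℝ) * √n = n := Real.mul_self_sqrt hn'.le
  set B := nrm u / √n with hB
  have hu : nrm u = B * √n := by rw [hB]; field_simp
  have hB0 : 0 ≤ B := div_nonneg (nrm_nonneg _) hsn.le
  have hT0 : 0 ≤ effT n σ w := effT_nonneg ..
  unfold auxVal
  have h1 : -(n * (B * (1 + t))) ≤ ∑ p, ζ (.inl p) * u p := by
    have e1 := (abs_le.1 (abs_dot_le_nrm (fun p : Fin n => ζ (.inl p)) u)).1
    have e2 := mul_le_mul_of_nonneg_right (hG.nrm_row ht0 ht1).2 (nrm_nonneg u)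
    have e3 : (1 + t) * √n * nrm u = n * (B * (1 + t)) := by
      rw [hu]
      calc (1 + t) * √n * (B * √n) = √n * √n * (B * (1 + t)) := by ring
        _ = _ := by rw [hsq]
    linarith
  have h2 := mul_le_mul_of_nonneg_left h1 hT0
  have h3 : -(n * (B * σ * t)) ≤ B * σ * (√n * ζ (.inr (.inr ()))) := by
    have := mul_le_mul_of_nonneg_left (abs_le.1 hG.abs_extra).1 (mul_nonneg hB0 hσ)
    linarith
  have h4 : nrm u * (1 * (∑ q, ζ (.inr (.inl q)) * w q) / √n + σ * ζ (.inr (.inr ()))) =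
      B * ∑ q, ζ (.inr (.inl q)) * w q + B * σ * (√n * ζ (.inr (.inr ()))) := by
    rw [hu]; field_simp
  rw [h4]
  linarith

lemma soft_dual_le {β τ lam : ℝ} (hβ : 0 < β) (hτ : 0 < τ) (hl : 0 ≤ lam) {ϑ z v : ℝ}
    (hv : |v| ≤ lam) :
    let w₀ := resid ϑ τ (τ * lam / β) z
    let d := β * z - β / τ * w₀ - v
    |d| ≤ 2 * lam ∧ |β * z - β / τ * w₀| ≤ lam ∧
      (w₀ + ϑ) * v ≤ lam * |ϑ + w₀| ∧
      (w₀ + d / 4 + ϑ) * v ≤ lam * |ϑ + w₀| + (β * z - β / τ * w₀) * d / 4 - d ^ 2 / 4 := by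
  intro w₀ d
  have hb : 0 ≤ τ * lam / β := by positivity
  set b := τ * lam / β with hbd
  have hv0 : β * z - β / τ * w₀ = β / τ * clip b (ϑ + τ * z) := by
    simp only [w₀]
    unfold resid; field_simp; ring
  have hlb : lam = β / τ * b := by rw [hbd]; field_simp
  have h2 : |β * z - β / τ * w₀| ≤ lam := by
    rw [hv0, abs_mul, abs_of_pos (by positivity : 0 < β / τ), hlb]
    exact mul_le_mul_of_nonneg_left (abs_clip_le hb _) (by positivity)
  have h3 : (w₀ + ϑ) * v ≤ lam * |ϑ + w₀| := by
    refine (le_abs_self _).trans ?_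
    rw [abs_mul, mul_comm, add_comm]
    exact mul_le_mul_of_nonneg_right hv (abs_nonneg _)
  refine ⟨?_, h2, h3, ?_⟩
  · refine (abs_sub _ _).trans ?_
    linarith
  · have : v = β * z - β / τ * w₀ - d := by simp only [d]; ring
    have e : (w₀ + d / 4 + ϑ) * v = (w₀ + ϑ) * v + (β * z - β / τ * w₀) * d / 4 - d ^ 2 / 4 := by
      rw [this]; ring
    linarith

set_option maxHeartbeats 1000000 in
lemma dual_of_goodEvent (hN : 0 < N) (hn : (n : ℝ) = δ * N) (hA : Admissible M δ σ lam β τ)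
    (hG : GoodEvent θ σ lam β τ t k ζ) (ht0 : 0 ≤ t) (ht : 10 * M * t ≤ 1) {R : ℝ} (hR : 0 ≤ R)
    (hR2 : n * (2 * τ ^ 2 + 2) + lam ^ 2 * N / 2 ≤ R ^ 2)
    {u : Fin n → ℝ} {v : Fin N → ℝ} (hv : ∀ q, |v q| ≤ lam)
    (h : ∀ w, nrm w ≤ R → auxVal σ 1 ζ u w + nrm u ^ 2 / 2 - ∑ q, (w q + θ q) * v q ≤
      -optVal n θ lam β τ + n * r) :
    (nrm u / √n - β) ^ 2 ≤ 4 * (r + 11 * M ^ 2 * t) ∧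
      (4 * M ^ 2 * (r + 11 * M ^ 2 * t) ≤ 1 →
        ∑ q, (β / τ * clip (τ * lam / β) (θ q + τ * ζ (.inr (.inl q))) - v q) ^ 2 ≤
          n * (32 * M ^ 5 * (r + 13 * M ^ 2 * t))) := by
  have hM1 := hA.one_le
  have hM := hA.M_pos
  have hτ := hA.tau_pos
  have hβ := hA.beta_pos
  have hσ := hA.sigma_pos
  have hl := hA.lam_pos
  have hδ := hA.delta_pos
  have hN' : (0 : ℝ) < N := by exact_mod_cast hN
  have hn' : (0 : ℝ) < n := by rw [hn]; positivity
  have hn0 : 0 < n := by exact_mod_cast hn'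
  have ht1 : t ≤ 1 := by nlinarith
  have hNn : (N : ℝ) ≤ n * M := by
    rw [hn]; nlinarith [hA.one_le_mul_delta]
  have hlN : lam ^ 2 * N ≤ n * M ^ 3 := by
    have h1 : lam ^ 2 ≤ M ^ 2 := pow_le_pow_left₀ hl.le hA.lam_le 2
    calc lam ^ 2 * N ≤ M ^ 2 * (n * M) := mul_le_mul h1 hNn hN'.le (by positivity)
      _ = _ := by ring
  set b := τ * lam / β with hbd
  set g : Fin N → ℝ := fun q => ζ (.inr (.inl q)) with hg
  set w₀ : Fin N → ℝ := fun q => resid (θ q) τ b (g q) with hw₀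
  set v₀ : Fin N → ℝ := fun q => β * g q - β / τ * w₀ q with hv₀
  set d : Fin N → ℝ := fun q => v₀ q - v q with hd
  have hloc := fun q => soft_dual_le hβ hτ hl.le (ϑ := θ q) (z := g q) (hv q)
  simp only [← hbd] at hloc
  have hclip : ∀ q, β / τ * clip b (θ q + τ * g q) = v₀ q := fun q => by
    simp only [hv₀, hw₀]; unfold resid; field_simp; ring
  simp_rw [show ∀ q, β / τ * clip b (θ q + τ * ζ (.inr (.inl q))) - v q = d q from
    fun q => by simp only [hd, ← hclip, hg]]
  set B := nrm u / √n with hB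
  have hB0 : 0 ≤ B := div_nonneg (nrm_nonneg _) (Real.sqrt_nonneg _)
  have hu2 : nrm u ^ 2 = n * B ^ 2 := by
    rw [hB, div_pow, Real.sq_sqrt hn'.le]; field_simp
  have htest : ∀ w, nrm w ≤ R → -(n * (B * (1 + t) * effT n σ w)) + B * ∑ q, g q * w q -
      n * (B * σ * t) + n * B ^ 2 / 2 - ∑ q, (w q + θ q) * v q ≤
      -optVal n θ lam β τ + n * r := fun w hw => by
    have h1 := h w hw
    have h2 := hG.auxVal_ge hn0 hσ.le ht0 ht1 u w
    rw [hu2] at h1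
    linarith
  have e8 : lam * ∑ q, |θ q + w₀ q| ≤ l1Mean θ lam τ b + lam * ∑ q, |θ q| + t * n := by
    have := (abs_le.1 hG.l1).2
    rw [← Finset.mul_sum, Finset.sum_sub_distrib] at this
    simp only [hw₀]
    linarith
  set W := (∑ q, w₀ q ^ 2) / n with hW
  set md := (∑ q, w₀ q * d q) / n with hmd
  set vd := (∑ q, v₀ q * d q) / n with hvd
  set V := (∑ q, v₀ q ^ 2) / n with hV
  set Δ := (∑ q, d q ^ 2) / n with hΔ
  set G := (∑ q, g q * w₀ q) / n with hGd
  have hWn : ∑ q, w₀ q ^ 2 = n * W := by rw [hW]; field_simp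
  have hmn : ∑ q, w₀ q * d q = n * md := by rw [hmd]; field_simp
  have hvn : ∑ q, v₀ q * d q = n * vd := by rw [hvd]; field_simp
  have hVn : ∑ q, v₀ q ^ 2 = n * V := by rw [hV]; field_simp
  have hΔn : ∑ q, d q ^ 2 = n * Δ := by rw [hΔ]; field_simp
  have hGn : ∑ q, g q * w₀ q = n * G := by rw [hGd]; field_simp
  have hW0 : 0 ≤ W := by rw [hW]; positivity
  have hΔ0 : 0 ≤ Δ := by rw [hΔ]; positivity
  have hWt : W ≤ τ ^ 2 - σ ^ 2 + t := by
    have := (abs_le.1 hG.sq).2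
    change ∑ q, w₀ q ^ 2 - _ ≤ _ at this
    rw [hWn] at this
    refine le_of_mul_le_mul_left ?_ hn'
    linarith
  have hGt : τ - β - t ≤ G := by
    have := (abs_le.1 hG.cross).1
    change _ ≤ ∑ q, g q * w₀ q - _ at this
    rw [hGn] at this
    refine le_of_mul_le_mul_left ?_ hn'
    linarith
  have hd2 : ∑ q, d q ^ 2 ≤ 4 * (lam ^ 2 * N) := by
    calc ∑ q, d q ^ 2 ≤ ∑ _q : Fin N, (2 * lam) ^ 2 := Finset.sum_le_sum fun q _ => by
          rw [← sq_abs]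
          exact pow_le_pow_left₀ (abs_nonneg _) (hloc q).1 2
      _ = _ := by simp; ring
  have hw₀R : nrm w₀ ≤ R := by
    refine abs_le_of_sq_le_sq' ?_ hR |>.2
    rw [nrm_sq, hWn]
    have : n * W ≤ n * (2 * τ ^ 2 + 2) :=
      mul_le_mul_of_nonneg_left (by nlinarith [sq_nonneg σ, sq_nonneg τ]) hn'.le
    have : 0 ≤ lam ^ 2 * N / 2 := by positivity
    linarith
  have hw₁R : nrm (fun q => w₀ q + d q / 4) ≤ R := by
    refine abs_le_of_sq_le_sq' ?_ hR |>.2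
    rw [nrm_sq]
    have e1 : ∑ q, (w₀ q + d q / 4) ^ 2 ≤ 2 * ∑ q, w₀ q ^ 2 + (∑ q, d q ^ 2) / 8 := by
      rw [Finset.mul_sum, Finset.sum_div, ← Finset.sum_add_distrib]
      exact Finset.sum_le_sum fun q _ => by nlinarith [sq_nonneg (w₀ q - d q / 4)]
    rw [hWn] at e1
    have : n * W ≤ n * (τ ^ 2 + 1) :=
      mul_le_mul_of_nonneg_left (by nlinarith [sq_nonneg σ]) hn'.le
    linarith
  have hT0 : effT n σ w₀ ^ 2 = W + σ ^ 2 := effT_sq ..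
  have hT1 : effT n σ (fun q => w₀ q + d q / 4) ^ 2 = W + md / 2 + Δ / 16 + σ ^ 2 := by
    rw [effT_sq, hW, hmd, hΔ]
    have : ∑ q, (w₀ q + d q / 4) ^ 2 = ∑ q, w₀ q ^ 2 + (∑ q, w₀ q * d q) / 2 +
        (∑ q, d q ^ 2) / 16 := by
      rw [Finset.sum_div, Finset.sum_div, ← Finset.sum_add_distrib, ← Finset.sum_add_distrib]
      exact Finset.sum_congr rfl fun q _ => by ring
    rw [this]; field_simp
  have k0 : -(B * (1 + t) * effT n σ w₀) + B * G - B * σ * t + B ^ 2 / 2 - t ≤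
      -(β ^ 2 / 2) + r := by
    have h1 := htest w₀ hw₀R
    have h2 := Finset.sum_le_sum fun q (_ : q ∈ Finset.univ) => (hloc q).2.2.1
    rw [← Finset.mul_sum] at h2
    change ∑ q, (w₀ q + θ q) * v q ≤ lam * ∑ q, |θ q + w₀ q| at h2
    unfold optVal at h1
    rw [← hbd, hGn] at h1
    refine le_of_mul_le_mul_left ?_ hn'
    linarith
  have k1 := dual_scalar_radius hA ht0 ht hT0 hWt hB0 hGt k0
  refine ⟨k1, fun hr => ?_⟩
  set gd := (∑ q, g q * d q) / n with hgd
  have hgn : ∑ q, g q * d q = n * gd := by rw [hgd]; field_simp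
  have hgd' : gd = vd / β + md / τ := by
    have : ∑ q, v₀ q * d q = β * ∑ q, g q * d q - β / τ * ∑ q, w₀ q * d q := by
      rw [Finset.mul_sum, Finset.mul_sum, ← Finset.sum_sub_distrib]
      exact Finset.sum_congr rfl fun q _ => by simp only [hv₀]; ring
    rw [hvd, this, hmd, hgd]; field_simp; ring
  have k2 : -(B * (1 + t) * effT n σ (fun q => w₀ q + d q / 4)) + B * (G + gd / 4) - B * σ * t +
      B ^ 2 / 2 - t - vd / 4 + Δ / 4 ≤ -(β ^ 2 / 2) + r := by
    have h1 := htest _ hw₁R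
    have h2 := Finset.sum_le_sum fun q (_ : q ∈ Finset.univ) => (hloc q).2.2.2
    change ∑ q, (w₀ q + d q / 4 + θ q) * v q ≤
      ∑ q, (lam * |θ q + w₀ q| + v₀ q * d q / 4 - d q ^ 2 / 4) at h2
    rw [Finset.sum_sub_distrib, Finset.sum_add_distrib, ← Finset.mul_sum, ← Finset.sum_div,
      ← Finset.sum_div, hvn, hΔn] at h2
    have h3 : ∑ q, g q * (w₀ q + d q / 4) = n * (G + gd / 4) := by
      rw [mul_add, ← hGn, mul_div_assoc', ← hgn, Finset.sum_div, ← Finset.sum_add_distrib]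
      exact Finset.sum_congr rfl fun q _ => by ring
    unfold optVal at h1
    rw [← hbd, h3] at h1
    refine le_of_mul_le_mul_left ?_ hn'
    linarith
  have hmd' : |md| ≤ (W + Δ) / 2 := by
    have e : ∀ s : ℝ, s ^ 2 = 1 → s * md ≤ (W + Δ) / 2 := fun s hs => by
      have : 0 ≤ ∑ q, (w₀ q - s * d q) ^ 2 := Finset.sum_nonneg fun _ _ => sq_nonneg _
      have e2 : ∑ q, (w₀ q - s * d q) ^ 2 = n * (W - 2 * s * md + Δ) := by
        rw [mul_add, mul_sub, ← hWn, show n * (2 * s * md) = 2 * s * (n * md) by ring, ← hmn,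
          ← hΔn, Finset.mul_sum, ← Finset.sum_sub_distrib, ← Finset.sum_add_distrib]
        exact Finset.sum_congr rfl fun q _ => by linear_combination d q ^ 2 * hs
      rw [e2] at this
      have := nonneg_of_mul_nonneg_right this hn'
      linarith
    exact abs_le.2 ⟨by linarith [e (-1) (by norm_num)], by linarith [e 1 (by norm_num)]⟩
  have hvd' : ∀ c : ℝ, -(Δ / 4 + c ^ 2 * V) ≤ c * vd := fun c => by
    have : 0 ≤ ∑ q, (d q / 2 + c * v₀ q) ^ 2 := Finset.sum_nonneg fun _ _ => sq_nonneg _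
    have e2 : ∑ q, (d q / 2 + c * v₀ q) ^ 2 = n * (Δ / 4 + c * vd + c ^ 2 * V) := by
      rw [show n * (Δ / 4 + c * vd + c ^ 2 * V) = n * Δ / 4 + c * (n * vd) + c ^ 2 * (n * V) by
        ring, ← hΔn, ← hvn, ← hVn, Finset.mul_sum, Finset.mul_sum, Finset.sum_div,
        ← Finset.sum_add_distrib, ← Finset.sum_add_distrib]
      exact Finset.sum_congr rfl fun q _ => by ring
    rw [e2] at this
    have := nonneg_of_mul_nonneg_right this hn'
    linarith
  have hVM : V ≤ M ^ 3 := by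
    refine le_of_mul_le_mul_left ?_ hn'
    rw [← hVn]
    refine le_trans ?_ hlN
    calc ∑ q, v₀ q ^ 2 ≤ ∑ _q : Fin N, lam ^ 2 := Finset.sum_le_sum fun q _ => by
          rw [← sq_abs]
          exact pow_le_pow_left₀ (abs_nonneg _) (hloc q).2.1 2
      _ = _ := by simp; ring
  have hΔM : Δ ≤ 4 * M ^ 3 := by
    refine le_of_mul_le_mul_left ?_ hn'
    rw [← hΔn]; linarith
  have k3 := dual_scalar_dist hA ht0 ht hT1 hWt hB0 hGt k1 hr hgd' hmd' hΔ0 hΔM hvd' hVM k2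
  rw [hΔn]
  exact mul_le_mul_of_nonneg_left k3 hn'.le

end DualDeterministic

section CellEvent

variable {n N : ℕ}

/-- The event on which near-optimal primal and dual points at penalty `lam` are controlled. -/
structure CellGood (θ : Fin N → ℝ) (σ lam β τ κ ε : ℝ)
    (ω : (Fin n → Fin N → ℝ) × (Fin n → ℝ)) : Prop where
  primal_ge : ∀ x : Fin N → ℝ,
    optVal n θ lam β τ - n * κ ≤ n * lassoCost ω.1 (yvec σ θ ω.1 ω.2) lam x
  le_l0 : ∀ x : Fin N → ℝ,
    n * lassoCost ω.1 (yvec σ θ ω.1 ω.2) lam x < optVal n θ lam β τ + n * (3 * κ) →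
    ∑ q, tailProb (θ q) τ (τ * lam / β) - ε * N ≤ l0 x
  dual_ge : ∀ u : Fin n → ℝ, (∀ q, |∑ p, ω.1 p q * u p| ≤ lam) →
    -optVal n θ lam β τ - n * κ ≤ nrm u ^ 2 / 2 - ∑ p, u p * yvec σ θ ω.1 ω.2 p
  dual_near : ∀ u : Fin n → ℝ, (∀ q, |∑ p, ω.1 p q * u p| ≤ lam) →
    nrm u ^ 2 / 2 - ∑ p, u p * yvec σ θ ω.1 ω.2 p < -optVal n θ lam β τ + n * (3 * κ) →
    ((Finset.univ.filter fun q => lam ≤ |∑ p, ω.1 p q * u p|).card : ℝ) ≤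
      ∑ q, tailProb (θ q) τ (τ * lam / β) + ε * N ∧ nrm u ≤ 2 * β * √n

/-- The accuracy `t` at which the auxiliary averages are controlled. -/
def tolT (M ε : ℝ) : ℝ := ε ^ 3 / (10 ^ 7 * M ^ 30)

lemma exists_cellGood_bound (M : ℝ) : ∃ c : ℝ, 0 < c ∧
    ∀ {n N : ℕ} {θ : Fin N → ℝ} {δ σ lam β τ ε : ℝ}, 0 < N → (n : ℝ) = δ * N →
    Admissible M δ σ lam β τ → StateEvo δ σ (empDist θ) lam β τ → 0 < ε → ε ≤ 1 →
    Pmodel n N {ω | ¬ CellGood θ σ lam β τ (13 * M ^ 4 * tolT M ε) ε ω} ≤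
      ENNReal.ofReal (112 * Real.exp (-(c * N * ε ^ 6))) := by
  obtain ⟨c, hc, hB⟩ := exists_goodEvent_bound M
  by_cases hM1 : 1 ≤ M
  swap
  · exact ⟨1, one_pos, fun _ _ hA => absurd hA.one_le hM1⟩
  have hM : 0 < M := by linarith
  refine ⟨c / (10 ^ 7 * M ^ 30) ^ 2, by positivity,
    fun {n N θ δ σ lam β τ ε} hN hn hA hSE hε0 hε1 => ?_⟩
  have hτ := hA.tau_pos
  have hβ := hA.beta_pos
  have hδ := hA.delta_pos
  have hN' : (0 : ℝ) < N := by exact_mod_cast hN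
  have hn' : (0 : ℝ) < n := by rw [hn]; positivity
  have hn0 : 0 < n := by exact_mod_cast hn'
  set t := tolT M ε with ht
  have ht0 : 0 < t := by rw [ht, tolT]; positivity
  set κ := 13 * M ^ 4 * t with hκ
  set k := ε / (6 * M) with hk
  have hk0 : 0 < k := by positivity
  have htε : 10 ^ 7 * (M ^ 30 * t) = ε ^ 3 := by rw [ht, tolT]; field_simp
  have hpt : ∀ i : ℕ, i ≤ 30 → M ^ i * t ≤ M ^ 30 * t := fun i hi =>
    mul_le_mul_of_nonneg_right (pow_le_pow_right₀ hM1 hi) ht0.le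
  have hε3 : ε ^ 3 ≤ ε := by
    calc ε ^ 3 = ε * ε ^ 2 := by ring
      _ ≤ ε * 1 := mul_le_mul_of_nonneg_left (pow_le_one₀ hε0.le hε1) hε0.le
      _ = ε := mul_one _
  have hk1 : k ≤ 1 := by rw [hk, div_le_one (by positivity)]; linarith
  have htk : t ≤ k := by
    rw [hk, le_div_iff₀ (by positivity)]
    have := hpt 1 (by norm_num)
    rw [pow_one] at this
    linarith
  have ht10 : 100 * M ^ 10 * t ≤ 1 := by
    have := hpt 10 (by norm_num)
    linarith
  have ht10' : 10 * M * t ≤ 1 := by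
    have := hpt 1 (by norm_num)
    rw [pow_one] at this
    linarith
  have h4t : 0 < M ^ 4 * t := by positivity
  have h24 : M ^ 2 * t ≤ M ^ 4 * t :=
    mul_le_mul_of_nonneg_right (pow_le_pow_right₀ hM1 (by norm_num)) ht0.le
  have hnN : (n : ℝ) ≤ M * N := by
    rw [hn]; exact mul_le_mul_of_nonneg_right hA.delta_le hN'.le
  have hkε : (1 + 2 * M) * k * N ≤ ε / 2 * N := by
    refine mul_le_mul_of_nonneg_right ?_ hN'.le
    rw [hk, mul_div_assoc', div_le_div_iff₀ (by positivity) (by norm_num)]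
    nlinarith
  have hVk : ∀ {V : ℝ}, V ≤ N * (10 ^ 5 * (M ^ 28 * t)) → V / k ^ 2 ≤ ε / 2 * N := by
    intro V hV
    rw [div_le_iff₀ (by positivity)]
    refine hV.trans ?_
    have e1 : ε / 2 * N * k ^ 2 = N * (ε ^ 3 / (72 * M ^ 2)) := by rw [hk]; field_simp; norm_num
    rw [e1, ← htε]
    refine mul_le_mul_of_nonneg_left ?_ hN'.le
    rw [le_div_iff₀ (by positivity)]
    have e2 : 10 ^ 5 * (M ^ 28 * t) * (72 * M ^ 2) = 72 * 10 ^ 5 * (M ^ 30 * t) := by ring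
    rw [e2]
    have := hpt 0 (by norm_num)
    have : 0 < M ^ 30 * t := by positivity
    linarith
  have hgood := hB (t := t) (k := k) hN hn hA hSE ht0 htk hk1
  set E := ENNReal.ofReal (14 * Real.exp (-(c * N * t ^ 2))) with hE
  -- the four failure events
  have f1 : Pmodel n N {ω | ∃ w ∈ (Set.univ : Set (Fin N → ℝ)), n * lassoCost ω.1 (yvec σ θ ω.1 ω.2) lam
      (fun q => w q + θ q) < optVal n θ lam β τ + n * (-κ)} ≤ 2 * E := by
    refine (gordon_primal hn0 σ lam θ _ _).trans ?_
    gcongr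
    refine (measure_mono fun ζ hζ => ?_).trans hgood
    rintro hG
    obtain ⟨w, -, hw⟩ := hζ
    have h1 := (primal_of_goodEvent hn0 hA hG ht0.le ht10 (by linarith) hw).1
    linarith
  have f2 : Pmodel n N {ω | ∃ w ∈ {w : Fin N → ℝ | (l0 (fun q => w q + θ q) : ℝ) <
      ∑ q, tailProb (θ q) τ (τ * lam / β) - ε * N}, n * lassoCost ω.1 (yvec σ θ ω.1 ω.2) lam
      (fun q => w q + θ q) < optVal n θ lam β τ + n * (3 * κ)} ≤ 2 * E := by
    refine (gordon_primal hn0 σ lam θ _ _).trans ?_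
    gcongr
    refine (measure_mono fun ζ hζ => ?_).trans hgood
    rintro hG
    obtain ⟨w, hwl, hw⟩ := hζ
    have hr1 : 3 * κ ≤ 1 := by
      have := hpt 4 (by norm_num)
      linarith
    have h1 := (primal_of_goodEvent hn0 hA hG ht0.le ht10 hr1 hw).2
    have h2 := hG.sum_tailProb_le_l0 hA hk0 h1
    have h3 : n * (200 * M ^ 14 * (3 * κ + 12 * M ^ 4 * t)) ≤ N * (10 ^ 5 * (M ^ 28 * t)) := by
      calc n * (200 * M ^ 14 * (3 * κ + 12 * M ^ 4 * t)) ≤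
          M * N * (200 * M ^ 14 * (3 * κ + 12 * M ^ 4 * t)) := by gcongr
        _ = N * (10200 * (M ^ 19 * t)) := by rw [hκ]; ring
        _ ≤ _ := by
          have : M ^ 19 * t ≤ M ^ 28 * t :=
            mul_le_mul_of_nonneg_right (pow_le_pow_right₀ hM1 (by norm_num)) ht0.le
          have h0 : 0 < M ^ 19 * t := by positivity
          refine mul_le_mul_of_nonneg_left ?_ hN'.le
          linarith
    have h4 := hVk h3
    have h5 := hwl.out
    linarith
  have f3 : Pmodel n N {ω | ∃ d ∈ {d : (Fin n → ℝ) × (Fin N → ℝ) | ∀ q, |d.2 q| ≤ lam},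
      (∀ q, ∑ p, ω.1 p q * d.1 p = d.2 q) ∧
      nrm d.1 ^ 2 / 2 - ∑ p, d.1 p * yvec σ θ ω.1 ω.2 p < -optVal n θ lam β τ + n * (-κ)} ≤
      2 * E := by
    refine (gordon_dual hn0 σ θ _ (Real.sqrt_nonneg (n * (2 * τ ^ 2 + 2) + lam ^ 2 * N / 2)) _).trans
      ?_
    gcongr
    refine (measure_mono fun ζ hζ => ?_).trans hgood
    rintro hG
    obtain ⟨d, hd, hw⟩ := hζ
    have h1 := (dual_of_goodEvent hN hn hA hG ht0.le ht10' (Real.sqrt_nonneg _)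
      (Real.sq_sqrt (by positivity)).ge hd hw).1
    have h2 := (sq_nonneg _).trans h1
    linarith
  have f4 : Pmodel n N {ω | ∃ d ∈ {d : (Fin n → ℝ) × (Fin N → ℝ) | (∀ q, |d.2 q| ≤ lam) ∧
      ¬ (((Finset.univ.filter fun q => lam ≤ |d.2 q|).card : ℝ) ≤
      ∑ q, tailProb (θ q) τ (τ * lam / β) + ε * N ∧ nrm d.1 ≤ 2 * β * √n)},
      (∀ q, ∑ p, ω.1 p q * d.1 p = d.2 q) ∧
      nrm d.1 ^ 2 / 2 - ∑ p, d.1 p * yvec σ θ ω.1 ω.2 p < -optVal n θ lam β τ + n * (3 * κ)} ≤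
      2 * E := by
    refine (gordon_dual hn0 σ θ _ (Real.sqrt_nonneg (n * (2 * τ ^ 2 + 2) + lam ^ 2 * N / 2)) _).trans
      ?_
    gcongr
    refine (measure_mono fun ζ hζ => ?_).trans hgood
    rintro hG
    obtain ⟨d, ⟨hd, hbad⟩, hw⟩ := hζ
    obtain ⟨h1, h2⟩ := dual_of_goodEvent hN hn hA hG ht0.le ht10' (Real.sqrt_nonneg _)
      (Real.sq_sqrt (by positivity)).ge hd hw
    have hsmall : 200 * (M ^ 6 * t) < 1 := by
      have := hpt 6 (by norm_num)
      have : 0 < M ^ 30 * t := by positivity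
      have : ε ^ 3 ≤ 1 := hε3.trans hε1
      linarith
    have hr : 3 * κ + 11 * M ^ 2 * t ≤ 50 * (M ^ 4 * t) := by linarith
    have hr2 : 4 * M ^ 2 * (3 * κ + 11 * M ^ 2 * t) ≤ 200 * (M ^ 6 * t) := by
      calc 4 * M ^ 2 * (3 * κ + 11 * M ^ 2 * t) ≤ 4 * M ^ 2 * (50 * (M ^ 4 * t)) := by gcongr
        _ = _ := by ring
    apply hbad
    constructor
    · have h3 := hG.saturated_le hA hk0 (h2 (hr2.trans hsmall.le))
      have h4 : M ^ 4 * (n * (32 * M ^ 5 * (3 * κ + 13 * M ^ 2 * t))) ≤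
          N * (10 ^ 5 * (M ^ 28 * t)) := by
        calc M ^ 4 * (n * (32 * M ^ 5 * (3 * κ + 13 * M ^ 2 * t))) ≤
            M ^ 4 * (M * N * (32 * M ^ 5 * (52 * (M ^ 4 * t)))) := by
              gcongr; linarith
          _ = N * (1664 * (M ^ 14 * t)) := by ring
          _ ≤ _ := by
            have : M ^ 14 * t ≤ M ^ 28 * t :=
              mul_le_mul_of_nonneg_right (pow_le_pow_right₀ hM1 (by norm_num)) ht0.le
            have h0 : 0 < M ^ 14 * t := by positivity
            refine mul_le_mul_of_nonneg_left ?_ hN'.le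
            linarith
      have h5 := hVk h4
      linarith
    · have hsn : 0 < √(n : ℝ) := Real.sqrt_pos.2 hn'
      rw [← div_le_iff₀ hsn]
      have e1 : (nrm d.1 / √n - β) ^ 2 ≤ β ^ 2 := by
        refine h1.trans ?_
        have e2 : 1 ≤ (M * β) ^ 2 := one_le_pow₀ hA.one_le_mul_beta
        have e3 : M ^ 2 * (4 * (3 * κ + 11 * M ^ 2 * t)) ≤ M ^ 2 * β ^ 2 := by
          rw [mul_pow] at e2; linarith
        exact le_of_mul_le_mul_left e3 (by positivity)
      have := abs_le_of_sq_le_sq' e1 hβ.le |>.2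
      linarith
  have hE2 : 2 * E + (2 * E + (2 * E + 2 * E)) =
      ENNReal.ofReal (112 * Real.exp (-(c / (10 ^ 7 * M ^ 30) ^ 2 * N * ε ^ 6))) := by
    have e1 : c / (10 ^ 7 * M ^ 30) ^ 2 * N * ε ^ 6 = c * N * t ^ 2 := by
      rw [ht, tolT]; field_simp
    have e2 : 112 * Real.exp (-(c * N * t ^ 2)) = 8 * (14 * Real.exp (-(c * N * t ^ 2))) := by
      ring
    rw [e1, e2, ENNReal.ofReal_mul (by norm_num), ← hE]
    norm_num
    ring
  rw [← hE2]
  refine le_trans ?_ (((measure_union_le _ _).trans (add_le_add f1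
    ((measure_union_le _ _).trans (add_le_add f2
      ((measure_union_le _ _).trans (add_le_add f3 f4)))))))
  refine measure_mono fun ω hω => ?_
  by_contra hcon
  rw [Set.mem_union, Set.mem_union, Set.mem_union, not_or, not_or, not_or] at hcon
  obtain ⟨a1, a2, a3, a4⟩ := hcon
  refine hω ⟨fun x => ?_, fun x hx => ?_, fun u hu => ?_, fun u hu hv => ?_⟩
  · by_contra hlt
    refine a1 ⟨fun q => x q - θ q, trivial, ?_⟩
    simp only [sub_add_cancel]
    linarith [not_le.1 hlt]
  · by_contra hlt
    refine a2 ⟨fun q => x q - θ q, ?_, ?_⟩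
    · simp only [Set.mem_ofPred_eq, sub_add_cancel]
      exact not_le.1 hlt
    · simp only [sub_add_cancel]
      exact hx
  · by_contra hlt
    refine a3 ⟨(u, fun q => ∑ p, ω.1 p q * u p), hu, fun _ => rfl, ?_⟩
    linarith [not_le.1 hlt]
  · by_contra hbad
    exact a4 ⟨(u, fun q => ∑ p, ω.1 p q * u p), ⟨hu, hbad⟩, fun _ => rfl, hv⟩

end CellEvent

section LassoAlgebra

variable {n N : ℕ} {X : Fin n → Fin N → ℝ} {y : Fin n → ℝ} {lam lam₀ : ℝ} {x x₀ : Fin N → ℝ}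

/-- The residual `y - X x`. -/
def lassoRes (X : Fin n → Fin N → ℝ) (y : Fin n → ℝ) (x : Fin N → ℝ) (p : Fin n) : ℝ :=
  y p - ∑ j, X p j * x j

lemma mul_lassoCost (hn : 0 < n) (X : Fin n → Fin N → ℝ) (y : Fin n → ℝ) (lam : ℝ)
    (x : Fin N → ℝ) :
    n * lassoCost X y lam x = nrm (lassoRes X y x) ^ 2 / 2 + lam * ∑ j, |x j| := by
  have : (0 : ℝ) < n := by exact_mod_cast hn
  rw [nrm_sq]; unfold lassoCost lassoRes
  field_simp

lemma le_of_forall_le_add_mul {a b c : ℝ} (h : ∀ s : ℝ, 0 < s → s ≤ 1 → a ≤ b + s * c) :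
    a ≤ b := by
  refine le_of_forall_pos_le_add fun e he => ?_
  have hs : 0 < min 1 (e / (|c| + 1)) := by positivity
  have h1 := h _ hs (min_le_left _ _)
  have h2 : min 1 (e / (|c| + 1)) * c ≤ e := by
    calc min 1 (e / (|c| + 1)) * c ≤ min 1 (e / (|c| + 1)) * (|c| + 1) :=
          mul_le_mul_of_nonneg_left (by linarith [le_abs_self c]) hs.le
      _ ≤ e / (|c| + 1) * (|c| + 1) :=
          mul_le_mul_of_nonneg_right (min_le_right _ _) (by positivity)
      _ = e := by field_simp
  linarith

lemma lasso_variational (hn : 0 < n) (hl : 0 ≤ lam) (hx : IsMinOn (lassoCost X y lam) Set.univ x)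
    (d : Fin N → ℝ) :
    ∑ p, lassoRes X y x p * ∑ j, X p j * d j ≤ lam * (∑ j, |x j + d j| - ∑ j, |x j|) := by
  have hn' : (0 : ℝ) < n := by exact_mod_cast hn
  refine le_of_forall_le_add_mul (c := (∑ p, (∑ j, X p j * d j) ^ 2) / 2) fun s hs hs1 => ?_
  have h1 := mul_le_mul_of_nonneg_left
    (isMinOn_iff.1 hx (fun j => x j + s * d j) trivial) hn'.le
  rw [mul_lassoCost hn, mul_lassoCost hn, nrm_sq, nrm_sq] at h1
  have h2 : ∀ p, lassoRes X y (fun j => x j + s * d j) p =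
      lassoRes X y x p - s * ∑ j, X p j * d j := fun p => by
    unfold lassoRes
    rw [sub_sub, Finset.mul_sum, ← Finset.sum_add_distrib]
    congr 1
    exact Finset.sum_congr rfl fun j _ => by ring
  simp_rw [h2] at h1
  have h3 : ∑ p, (lassoRes X y x p - s * ∑ j, X p j * d j) ^ 2 =
      ∑ p, lassoRes X y x p ^ 2 - 2 * s * ∑ p, lassoRes X y x p * ∑ j, X p j * d j +
        s ^ 2 * ∑ p, (∑ j, X p j * d j) ^ 2 := by
    rw [Finset.mul_sum, Finset.mul_sum, ← Finset.sum_sub_distrib, ← Finset.sum_add_distrib]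
    exact Finset.sum_congr rfl fun p _ => by ring
  have h4 : ∑ j, |x j + s * d j| ≤ (1 - s) * ∑ j, |x j| + s * ∑ j, |x j + d j| := by
    rw [Finset.mul_sum, Finset.mul_sum, ← Finset.sum_add_distrib]
    refine Finset.sum_le_sum fun j _ => ?_
    calc |x j + s * d j| = |(1 - s) * x j + s * (x j + d j)| := by congr 1; ring
      _ ≤ _ := by
        refine (abs_add_le _ _).trans_eq ?_
        rw [abs_mul, abs_mul, abs_of_pos hs, abs_of_nonneg (by linarith : 0 ≤ 1 - s)]
  rw [h3] at h1
  have h5 := mul_le_mul_of_nonneg_left h4 hl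
  refine le_of_mul_le_mul_left ?_ hs
  linarith

lemma lasso_kkt (hn : 0 < n) (hl : 0 ≤ lam) (hx : IsMinOn (lassoCost X y lam) Set.univ x)
    (j : Fin N) :
    |∑ p, X p j * lassoRes X y x p| ≤ lam ∧
      (∑ p, X p j * lassoRes X y x p) * x j = lam * |x j| := by
  have h : ∀ a : ℝ, (∑ p, X p j * lassoRes X y x p) * a ≤ lam * (|x j + a| - |x j|) := by
    intro a
    have h1 := lasso_variational hn hl hx (Pi.single j a)
    have h2 : ∀ p, ∑ i, X p i * (Pi.single j a : Fin N → ℝ) i = X p j * a := fun p => by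
      simp [Pi.single_apply]
    have h3 : ∑ i, |x i + (Pi.single j a : Fin N → ℝ) i| - ∑ i, |x i| = |x j + a| - |x j| := by
      rw [← Finset.sum_sub_distrib, Finset.sum_eq_single j]
      · simp
      · intro i _ hi; simp [hi]
      · simp
    simp_rw [h2] at h1
    rw [h3] at h1
    refine le_trans (le_of_eq ?_) h1
    rw [Finset.sum_mul]
    exact Finset.sum_congr rfl fun p _ => by ring
  set c := ∑ p, X p j * lassoRes X y x p
  have hb : |c| ≤ lam := by
    have e : ∀ a : ℝ, |a| = 1 → c * a ≤ lam := fun a ha => by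
      have h1 := h a
      have h2 : |x j + a| - |x j| ≤ 1 := by linarith [abs_add_le (x j) a]
      nlinarith [mul_le_mul_of_nonneg_left h2 hl]
    have e1 := e 1 (by norm_num)
    have e2 := e (-1) (by norm_num)
    exact abs_le.2 ⟨by linarith, by linarith⟩
  refine ⟨hb, le_antisymm ?_ ?_⟩
  · refine (le_abs_self _).trans ?_
    rw [abs_mul]
    exact mul_le_mul_of_nonneg_right hb (abs_nonneg _)
  · have := h (-x j)
    simp only [add_neg_cancel, abs_zero, zero_sub] at this
    linarith

lemma lasso_dot_y (hn : 0 < n) (hl : 0 ≤ lam) (hx : IsMinOn (lassoCost X y lam) Set.univ x) :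
    ∑ p, lassoRes X y x p * y p = nrm (lassoRes X y x) ^ 2 + lam * ∑ j, |x j| := by
  have h1 : ∑ j, (∑ p, X p j * lassoRes X y x p) * x j =
      ∑ p, lassoRes X y x p * ∑ j, X p j * x j := by
    simp_rw [Finset.sum_mul, Finset.mul_sum]
    rw [Finset.sum_comm]
    exact Finset.sum_congr rfl fun p _ => Finset.sum_congr rfl fun j _ => by ring
  simp_rw [(lasso_kkt hn hl hx _).2] at h1
  rw [Finset.mul_sum, h1, nrm_sq, ← Finset.sum_add_distrib]
  refine Finset.sum_congr rfl fun p _ => ?_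
  have : y p = lassoRes X y x p + ∑ j, X p j * x j := by unfold lassoRes; ring
  rw [this]
  have : lassoRes X y x p + ∑ j, X p j * x j = y p := this.symm
  ring

lemma nrm_lassoRes_mono (hn : 0 < n) (hl : 0 ≤ lam) (hlt : lam < lam₀)
    (hx : IsMinOn (lassoCost X y lam) Set.univ x)
    (hx₀ : IsMinOn (lassoCost X y lam₀) Set.univ x₀) :
    nrm (lassoRes X y x) ^ 2 ≤ nrm (lassoRes X y x₀) ^ 2 := by
  have hn' : (0 : ℝ) ≤ n := Nat.cast_nonneg n
  have h1 := mul_le_mul_of_nonneg_left (isMinOn_iff.1 hx x₀ trivial) hn'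
  have h2 := mul_le_mul_of_nonneg_left (isMinOn_iff.1 hx₀ x trivial) hn'
  rw [mul_lassoCost hn, mul_lassoCost hn] at h1 h2
  have h3 : 0 ≤ ∑ j, |x j| - ∑ j, |x₀ j| :=
    nonneg_of_mul_nonneg_right (a := lam₀ - lam) (by linarith) (by linarith)
  linarith [mul_nonneg hl h3]

end LassoAlgebra

section Cell

variable {n N : ℕ} {θ : Fin N → ℝ} {σ lam lam₀ β τ κ ε : ℝ}
  {ω : (Fin n → Fin N → ℝ) × (Fin n → ℝ)} {x x₀ : Fin N → ℝ}

/-- The dual objective at a rescaled residual, in terms of the primal cost. -/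
lemma dual_value_scaled (hn : 0 < n) {X : Fin n → Fin N → ℝ} {y : Fin n → ℝ} (hl : 0 < lam)
    (hx : IsMinOn (lassoCost X y lam) Set.univ x) (lam₀ : ℝ) :
    nrm (fun p => lam₀ / lam * lassoRes X y x p) ^ 2 / 2 -
        ∑ p, lam₀ / lam * lassoRes X y x p * y p + n * lassoCost X y lam₀ x =
      ((lam₀ - lam) / lam) ^ 2 * nrm (lassoRes X y x) ^ 2 / 2 := by
  rw [mul_lassoCost hn]
  have h1 : nrm (fun p => lam₀ / lam * lassoRes X y x p) ^ 2 =
      (lam₀ / lam) ^ 2 * nrm (lassoRes X y x) ^ 2 := by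
    rw [nrm_sq, nrm_sq, Finset.mul_sum]
    exact Finset.sum_congr rfl fun p _ => by ring
  simp_rw [mul_assoc]
  rw [h1, ← Finset.mul_sum, lasso_dot_y hn hl.le hx]
  field_simp
  ring

lemma abs_dot_scaled {X : Fin n → Fin N → ℝ} {r : Fin n → ℝ} (h₀ : 0 < lam₀) (hl : 0 < lam)
    (q : Fin N) :
    |∑ p, X p q * (lam₀ / lam * r p)| = lam₀ / lam * |∑ p, X p q * r p| := by
  rw [← abs_of_pos (div_pos h₀ hl), ← abs_mul, Finset.mul_sum, abs_of_pos (div_pos h₀ hl)]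
  congr 1
  exact Finset.sum_congr rfl fun p _ => by ring

lemma CellGood.abs_l0_sub_le (h : CellGood θ σ lam₀ β τ κ ε ω) (hn : 0 < n) (hκ : 0 < κ)
    (hl : 0 < lam) (hll : lam ≤ lam₀)
    (hcell : ((lam₀ - lam) / lam) ^ 2 * (2 * β ^ 2) ≤ κ)
    (hx : IsMinOn (lassoCost ω.1 (yvec σ θ ω.1 ω.2) lam) Set.univ x)
    (hx₀ : IsMinOn (lassoCost ω.1 (yvec σ θ ω.1 ω.2) lam₀) Set.univ x₀)
    (hmono : nrm (lassoRes ω.1 (yvec σ θ ω.1 ω.2) x) ^ 2 ≤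
      nrm (lassoRes ω.1 (yvec σ θ ω.1 ω.2) x₀) ^ 2) :
    |(l0 x : ℝ) - ∑ q, tailProb (θ q) τ (τ * lam₀ / β)| ≤ ε * N := by
  have hn' : (0 : ℝ) < n := by exact_mod_cast hn
  have h₀ : 0 < lam₀ := hl.trans_le hll
  have hnκ : 0 < n * κ := mul_pos hn' hκ
  obtain ⟨hp, hl0, hd, hdn⟩ := h
  set y := yvec σ θ ω.1 ω.2
  have hnear₀ : nrm (lassoRes ω.1 y x₀) ≤ 2 * β * √n := by
    refine (hdn _ (fun q => (lasso_kkt hn h₀.le hx₀ q).1) ?_).2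
    have h1 := dual_value_scaled hn h₀ hx₀ lam₀
    simp only [div_self h₀.ne', one_mul, sub_self, zero_div] at h1
    have h2 := hp x₀
    linarith
  have hsq : nrm (lassoRes ω.1 y x) ^ 2 ≤ 4 * β ^ 2 * n := by
    refine hmono.trans ((pow_le_pow_left₀ (nrm_nonneg _) hnear₀ 2).trans_eq ?_)
    rw [mul_pow, mul_pow, Real.sq_sqrt hn'.le]; norm_num
  have hgap := dual_value_scaled hn hl hx lam₀
  have hgap' : ((lam₀ - lam) / lam) ^ 2 * nrm (lassoRes ω.1 y x) ^ 2 / 2 ≤ n * κ := by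
    have h1 := mul_le_mul_of_nonneg_left hsq (sq_nonneg ((lam₀ - lam) / lam))
    have h2 := mul_le_mul_of_nonneg_left hcell hn'.le
    linarith
  have hfeas : ∀ q, |∑ p, ω.1 p q * (lam₀ / lam * lassoRes ω.1 y x p)| ≤ lam₀ := fun q => by
    rw [abs_dot_scaled h₀ hl, div_mul_eq_mul_div, div_le_iff₀ hl]
    exact mul_le_mul_of_nonneg_left (lasso_kkt hn hl.le hx q).1 h₀.le
  have hpx := hp x
  have hdx := hd _ hfeas
  have hA := hl0 x (by linarith)
  have hB := (hdn _ hfeas (by linarith)).1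
  have hC : (l0 x : ℝ) ≤ (Finset.univ.filter fun q =>
      lam₀ ≤ |∑ p, ω.1 p q * (lam₀ / lam * lassoRes ω.1 y x p)|).card := by
    unfold l0
    refine Nat.cast_le.2 (Finset.card_le_card fun q hq => ?_)
    have hq : x q ≠ 0 := (Finset.mem_filter.1 hq).2
    refine Finset.mem_filter.2 ⟨Finset.mem_univ _, ?_⟩
    rw [abs_dot_scaled h₀ hl, div_mul_eq_mul_div, le_div_iff₀ hl]
    refine mul_le_mul_of_nonneg_left ?_ h₀.le
    refine le_of_mul_le_mul_right ?_ (abs_pos.2 hq)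
    rw [← (lasso_kkt hn hl.le hx q).2, ← abs_mul]
    exact le_abs_self _
  rw [abs_le]
  constructor <;> linarith

end Cell

section Assembly

/-- Width of a cell of regularization parameters sharing a single good event. -/
def cellWidth (M e : ℝ) : ℝ := e ^ 2 / (10 ^ 4 * M ^ 15)

lemma cellWidth_pos {M e : ℝ} (hM : 1 ≤ M) (he : 0 < e) : 0 < cellWidth M e := by
  have : 0 < M := by linarith
  unfold cellWidth; positivity

lemma tolT_pos {M e : ℝ} (hM : 1 ≤ M) (he : 0 < e) : 0 < tolT M e := by
  have : 0 < M := by linarith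
  unfold tolT; positivity

variable {n N : ℕ} {θ : Fin N → ℝ} {δ σ lam lam₀ β β' τ τ' M e : ℝ}
  {ω : (Fin n → Fin N → ℝ) × (Fin n → ℝ)} {x x₀ : Fin N → ℝ}

lemma cell_gap_le (hA : Admissible M δ σ lam₀ β τ) (he : 0 < e) (he1 : e ≤ 1)
    (hlam : 1 / M ≤ lam) (hll : lam ≤ lam₀) (hΔ : lam₀ - lam ≤ cellWidth M e) :
    ((lam₀ - lam) / lam) ^ 2 * (2 * β ^ 2) ≤ 13 * M ^ 4 * tolT M e := by
  have hM := hA.M_pos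
  have hl : 0 < lam := hA.inv_pos.trans_le hlam
  have h1 : (lam₀ - lam) / lam ≤ M * cellWidth M e := by
    rw [div_le_iff₀ hl]
    have : 1 ≤ M * lam := by rwa [div_le_iff₀' hM] at hlam
    nlinarith [mul_le_mul_of_nonneg_left this (cellWidth_pos hA.one_le he).le]
  have h2 : ((lam₀ - lam) / lam) ^ 2 ≤ (M * cellWidth M e) ^ 2 :=
    pow_le_pow_left₀ (div_nonneg (by linarith) hl.le) h1 2
  have h3 : β ^ 2 ≤ M ^ 2 := pow_le_pow_left₀ hA.beta_pos.le (hA.beta_le.trans hA.tau_le) 2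
  calc ((lam₀ - lam) / lam) ^ 2 * (2 * β ^ 2)
      ≤ (M * cellWidth M e) ^ 2 * (2 * M ^ 2) :=
        mul_le_mul h2 (by linarith) (by positivity) (by positivity)
    _ = 2 * M ^ 4 * (e ^ 3 / (10 ^ 8 * M ^ 30)) * e := by
        unfold cellWidth; field_simp
    _ ≤ 2 * M ^ 4 * (e ^ 3 / (10 ^ 8 * M ^ 30)) * 1 :=
        mul_le_mul_of_nonneg_left he1 (by positivity)
    _ ≤ 13 * M ^ 4 * tolT M e := by
        have h4 : tolT M e = 10 * (e ^ 3 / (10 ^ 8 * M ^ 30)) := by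
          unfold tolT; ring
        have h5 : 0 ≤ M ^ 4 * (e ^ 3 / (10 ^ 8 * M ^ 30)) := by positivity
        rw [h4]; linarith

lemma CellGood.abs_sub_sStar_le (hA : Admissible M δ σ lam₀ β τ) (he : 0 < e) (he1 : e ≤ 1)
    (hN : 0 < N) (hn : 0 < n)
    (h : CellGood θ σ lam₀ β τ (13 * M ^ 4 * tolT M e) e ω)
    (hs : sStar (empDist θ) τ (lam₀ / β) = (1 / N) * ∑ q, tailProb (θ q) τ (τ * lam₀ / β))
    (hlam : 1 / M ≤ lam) (hll : lam ≤ lam₀) (hΔ : lam₀ - lam ≤ cellWidth M e)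
    (hx : IsMinOn (lassoCost ω.1 (yvec σ θ ω.1 ω.2) lam) Set.univ x)
    (hx₀ : IsMinOn (lassoCost ω.1 (yvec σ θ ω.1 ω.2) lam₀) Set.univ x₀)
    (hmono : nrm (lassoRes ω.1 (yvec σ θ ω.1 ω.2) x) ^ 2 ≤
      nrm (lassoRes ω.1 (yvec σ θ ω.1 ω.2) x₀) ^ 2) :
    |(1 / (N : ℝ)) * (l0 x : ℝ) - sStar (empDist θ) τ (lam₀ / β)| ≤ e := by
  have hN' : (0 : ℝ) < N := by exact_mod_cast hN
  have h1 := h.abs_l0_sub_le hn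
    (mul_pos (mul_pos (by norm_num) (pow_pos hA.M_pos 4)) (tolT_pos hA.one_le he))
    (hA.inv_pos.trans_le hlam) hll (cell_gap_le hA he he1 hlam hll hΔ) hx hx₀ hmono
  rw [hs, ← mul_sub, abs_mul, abs_of_pos (by positivity)]
  rwa [one_div, inv_mul_le_iff₀ hN', mul_comm (N : ℝ)]

lemma exists_grid {lmin lmax Δ : ℝ} (hll : lmin ≤ lmax) (hΔ : 0 < Δ) :
    ∃ g : ℕ → ℝ, (∀ k, g k ∈ Set.Icc lmin lmax) ∧
      ∀ lam ∈ Set.Icc lmin lmax, ∃ k ∈ Finset.range (⌊(lmax - lmin) / Δ⌋₊ + 1),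
        lam ≤ g k ∧ g k - lam ≤ Δ := by
  refine ⟨fun k => min (lmin + (k + 1) * Δ) lmax, fun k => ⟨le_min ?_ hll, min_le_right _ _⟩,
    fun lam hlam => ⟨⌊(lam - lmin) / Δ⌋₊, ?_, le_min ?_ hlam.2, ?_⟩⟩
  · have : 0 ≤ ((k : ℝ) + 1) * Δ := by positivity
    linarith
  · refine Finset.mem_range.2 (Nat.lt_succ_of_le (Nat.floor_le_floor ?_))
    exact div_le_div_of_nonneg_right (by linarith [hlam.2]) hΔ.le
  · have := (Nat.lt_floor_add_one ((lam - lmin) / Δ)).le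
    rw [div_le_iff₀ hΔ] at this
    linarith
  · have := Nat.floor_le (div_nonneg (sub_nonneg.2 hlam.1) hΔ.le)
    rw [le_div_iff₀ hΔ] at this
    linarith [min_le_left (lmin + ((⌊(lam - lmin) / Δ⌋₊ : ℝ) + 1) * Δ) lmax]

end Assembly

section Assembly

lemma exists_notMem_of_measure_le {Ω : Type*} [MeasurableSpace Ω] (μ : Measure Ω)
    [IsProbabilityMeasure μ] {s t : Set Ω} {a : ℝ} (hs : μ s ≤ ENNReal.ofReal a)
    (ht : μ t ≤ ENNReal.ofReal a) (ha0 : 0 ≤ a) (ha : 2 * a < 1) : ∃ ω, ω ∉ s ∧ ω ∉ t := by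
  by_contra! h
  have h1 : (Set.univ : Set Ω) ⊆ s ∪ t := fun ω _ => by
    by_cases hω : ω ∈ s
    · exact .inl hω
    · exact .inr (h ω hω)
  have h2 := (measure_mono h1).trans ((measure_union_le (μ := μ) s t).trans (add_le_add hs ht))
  rw [measure_univ, ← ENNReal.ofReal_add ha0 ha0] at h2
  have h3 := ENNReal.one_le_ofReal.1 h2
  linarith

lemma card_grid_le {M a e : ℝ} (hM : 1 ≤ M) (haM : a ≤ M) (ha : 0 ≤ a) (he : 0 < e)
    (he1 : e ≤ 1) :
    ((⌊a / cellWidth M e⌋₊ + 1 : ℕ) : ℝ) ≤ 20000 * M ^ 16 / e ^ 6 := by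
  have hM0 : 0 < M := by linarith
  have h1 := Nat.floor_le (div_nonneg ha (cellWidth_pos hM he).le)
  have h2 : a / cellWidth M e ≤ M / cellWidth M e :=
    div_le_div_of_nonneg_right haM (cellWidth_pos hM he).le
  have h3 : M / cellWidth M e = 10 ^ 4 * M ^ 16 / e ^ 2 := by
    unfold cellWidth; field_simp
  have h4 : 10 ^ 4 * M ^ 16 / e ^ 2 ≤ 10 ^ 4 * M ^ 16 / e ^ 6 :=
    div_le_div_of_nonneg_left (by positivity) (by positivity)
      (pow_le_pow_of_le_one he.le he1 (by norm_num))
  have h5 : 1 ≤ 10 ^ 4 * M ^ 16 / e ^ 6 := by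
    rw [le_div_iff₀ (by positivity)]
    have := one_le_pow₀ (n := 16) hM
    have := pow_le_one₀ (n := 6) he.le he1
    linarith
  push_cast
  have h6 : 20000 * M ^ 16 / e ^ 6 = 10 ^ 4 * M ^ 16 / e ^ 6 + 10 ^ 4 * M ^ 16 / e ^ 6 := by ring
  linarith

/-- Uniform control of the sparsity of the Lasso when all parameters are admissible. -/
lemma sparsity_bound_of_admissible {M : ℝ} (hM : 1 ≤ M) {δ σ lmin lmax q : ℝ} (hδ : 0 < δ)
    (hl : 0 < lmin) (hll : lmin ≤ lmax) (hq : 0 ≤ q) :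
    ∃ C c : ℝ, 0 < C ∧ 0 < c ∧ ∀ (N n : ℕ), 0 < N → (n : ℝ) = δ * N →
      ∀ (θ : Fin N → ℝ) (βs τs : ℝ → ℝ),
      (∀ lam ∈ Set.Icc lmin lmax, StateEvo δ σ (empDist θ) lam (βs lam) (τs lam)) →
      (∀ lam ∈ Set.Icc lmin lmax, Admissible M δ σ lam (βs lam) (τs lam)) →
      ∀ θhat : ℝ → (Fin n → Fin N → ℝ) → (Fin n → ℝ) → (Fin N → ℝ),
      (∀ lam ∈ Set.Icc lmin lmax, ∀ (X : Fin n → Fin N → ℝ) (z : Fin n → ℝ),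
        IsMinOn (lassoCost X (yvec σ θ X z) lam) Set.univ (θhat lam X z)) →
      ∀ ε : ℝ, ε ∈ Set.Ioo (0 : ℝ) 1 →
      Pmodel n N
        {ω | ∃ lam ∈ Set.Icc lmin lmax,
          ε ≤ |(1 / (N : ℝ)) * (l0 (θhat lam ω.1 ω.2) : ℝ)
              - sStar (empDist θ) (τs lam) (lam / βs lam)|}
      ≤ ENNReal.ofReal (C / ε ^ 6 * (N : ℝ) ^ q * Real.exp (-c * N * ε ^ 6)) := by
  obtain ⟨c, hc, hB⟩ := exists_cellGood_bound M
  have hM0 : 0 < M := by linarith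
  refine ⟨4 ^ 6 * (20000 * M ^ 16 * 112), c / 4 ^ 6, by positivity, by positivity, ?_⟩
  intro N n hN hn θ βs τs hSE hA θhat hmin ε hε
  have hN' : (0 : ℝ) < N := by exact_mod_cast hN
  have hn0 : 0 < n := by
    have : (0 : ℝ) < n := hn ▸ mul_pos hδ hN'
    exact_mod_cast this
  obtain ⟨hε0, hε1⟩ := hε
  set e := ε / 4 with he
  have he0 : 0 < e := by positivity
  have he1 : e ≤ 1 := by linarith
  have hs : ∀ lam ∈ Set.Icc lmin lmax, sStar (empDist θ) (τs lam) (lam / βs lam) =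
      (1 / (N : ℝ)) * ∑ i, tailProb (θ i) (τs lam) (τs lam * lam / βs lam) := fun lam h =>
    (stateEvo_sums hδ hN hn (hl.trans_le h.1) (hSE lam h)).2.2
  set bad : ℝ → Set ((Fin n → Fin N → ℝ) × (Fin n → ℝ)) := fun lam =>
    {ω | ¬ CellGood θ σ lam (βs lam) (τs lam) (13 * M ^ 4 * tolT M e) e ω}
  set B := 112 * Real.exp (-(c * N * e ^ 6)) with hBdef
  have hB0 : 0 ≤ B := by positivity
  have hbad : ∀ lam ∈ Set.Icc lmin lmax, Pmodel n N (bad lam) ≤ ENNReal.ofReal B :=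
    fun lam h => hB hN hn (hA lam h) (hSE lam h) he0 he1
  have hcell : ∀ lam ∈ Set.Icc lmin lmax, ∀ lam₀ ∈ Set.Icc lmin lmax, lam ≤ lam₀ →
      lam₀ - lam ≤ cellWidth M e → ∀ ω, ω ∉ bad lam₀ →
      |(1 / (N : ℝ)) * (l0 (θhat lam ω.1 ω.2) : ℝ)
        - sStar (empDist θ) (τs lam₀) (lam₀ / βs lam₀)| ≤ e := by
    intro lam h lam₀ h₀ hle hΔ ω hω
    refine (not_not.1 hω).abs_sub_sStar_le (hA lam₀ h₀) he0 he1 hN hn0 (hs lam₀ h₀)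
      (hA lam h).le_lam hle hΔ (hmin lam h _ _) (hmin lam₀ h₀ _ _) ?_
    rcases hle.lt_or_eq with hlt | rfl
    · exact nrm_lassoRes_mono hn0 (hl.trans_le h.1).le hlt (hmin lam h _ _) (hmin lam₀ h₀ _ _)
    · exact le_rfl
  have hfin : 20000 * M ^ 16 / e ^ 6 * B ≤
      4 ^ 6 * (20000 * M ^ 16 * 112) / ε ^ 6 * (N : ℝ) ^ q *
        Real.exp (-(c / 4 ^ 6) * N * ε ^ 6) := by
    have h1 : (1 : ℝ) ≤ (N : ℝ) ^ q := Real.one_le_rpow (by exact_mod_cast hN) hq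
    have h2 : 20000 * M ^ 16 / e ^ 6 * B = 4 ^ 6 * (20000 * M ^ 16 * 112) / ε ^ 6 * 1 *
        Real.exp (-(c / 4 ^ 6) * N * ε ^ 6) := by
      rw [hBdef, he, show -(c / 4 ^ 6) * N * ε ^ 6 = -(c * N * (ε / 4) ^ 6) by ring]
      field_simp
    rw [h2]
    gcongr
  have hC1 : 2 ≤ 20000 * M ^ 16 / e ^ 6 := by
    rw [le_div_iff₀ (by positivity)]
    have := one_le_pow₀ (n := 16) hM
    have := pow_le_one₀ (n := 6) he0.le he1
    linarith
  by_cases h2B : 2 * B < 1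
  swap
  · refine prob_le_one.trans (ENNReal.one_le_ofReal.2 (le_trans ?_ hfin))
    exact (not_lt.1 h2B).trans (mul_le_mul_of_nonneg_right hC1 hB0)
  have hsdiff : ∀ lam ∈ Set.Icc lmin lmax, ∀ lam₀ ∈ Set.Icc lmin lmax, lam ≤ lam₀ →
      lam₀ - lam ≤ cellWidth M e →
      |sStar (empDist θ) (τs lam) (lam / βs lam)
        - sStar (empDist θ) (τs lam₀) (lam₀ / βs lam₀)| ≤ 2 * e := by
    intro lam h lam₀ h₀ hle hΔ
    obtain ⟨ω, h1, h2⟩ :=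
      exists_notMem_of_measure_le (Pmodel n N) (hbad lam h) (hbad lam₀ h₀) hB0 h2B
    have h3 := abs_le.1 (hcell lam h lam h le_rfl
      (by rw [sub_self]; exact (cellWidth_pos hM he0).le) ω h1)
    have h4 := abs_le.1 (hcell lam h lam₀ h₀ hle hΔ ω h2)
    exact abs_le.2 ⟨by linarith [h3.1, h3.2, h4.1, h4.2], by linarith [h3.1, h3.2, h4.1, h4.2]⟩
  obtain ⟨g, hg, hgrid⟩ := exists_grid hll (cellWidth_pos hM he0)
  set K := ⌊(lmax - lmin) / cellWidth M e⌋₊ + 1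
  have hsub : {ω : (Fin n → Fin N → ℝ) × (Fin n → ℝ) | ∃ lam ∈ Set.Icc lmin lmax,
      ε ≤ |(1 / (N : ℝ)) * (l0 (θhat lam ω.1 ω.2) : ℝ)
        - sStar (empDist θ) (τs lam) (lam / βs lam)|} ⊆ ⋃ k ∈ Finset.range K, bad (g k) := by
    rintro ω ⟨lam, h, hlam⟩
    obtain ⟨k, hk, h1, h2⟩ := hgrid lam h
    refine Set.mem_iUnion₂.2 ⟨k, hk, ?_⟩
    by_contra hω
    have h3 := abs_le.1 (hcell lam h _ (hg k) h1 h2 ω hω)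
    have h4 := abs_le.1 (hsdiff lam h _ (hg k) h1 h2)
    have h5 : |(1 / (N : ℝ)) * (l0 (θhat lam ω.1 ω.2) : ℝ)
        - sStar (empDist θ) (τs lam) (lam / βs lam)| ≤ 3 * e :=
      abs_le.2 ⟨by linarith [h3.1, h3.2, h4.1, h4.2], by linarith [h3.1, h3.2, h4.1, h4.2]⟩
    linarith
  have hlM : lmax - lmin ≤ M := by
    have := (hA lmax ⟨hll, le_rfl⟩).lam_le
    linarith
  calc _ ≤ Pmodel n N (⋃ k ∈ Finset.range K, bad (g k)) := measure_mono hsub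
    _ ≤ ∑ k ∈ Finset.range K, Pmodel n N (bad (g k)) := measure_biUnion_finset_le _ _
    _ ≤ ∑ k ∈ Finset.range K, ENNReal.ofReal B :=
        Finset.sum_le_sum fun k _ => hbad _ (hg k)
    _ = ENNReal.ofReal (K * B) := by
        rw [Finset.sum_const, Finset.card_range, nsmul_eq_mul,
          ENNReal.ofReal_mul (Nat.cast_nonneg _), ENNReal.ofReal_natCast]
    _ ≤ _ := ENNReal.ofReal_le_ofReal (le_trans (mul_le_mul_of_nonneg_right
        (card_grid_le hM hlM (by linarith) he0 he1) hB0) hfin)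

end Assembly

section ScalarBounds

lemma resid_optimality {b : ℝ} (hb : 0 ≤ b) (ϑ τ z : ℝ) :
    resid ϑ τ b z ^ 2 - τ * (z * resid ϑ τ b z) + b * (|ϑ + resid ϑ τ b z| - |ϑ|) ≤ 0 := by
  have h1 := clip_mul_sub_clip hb (ϑ + τ * z)
  rw [add_resid]
  have h2 : ϑ * clip b (ϑ + τ * z) ≤ b * |ϑ| := by
    refine (le_abs_self _).trans ?_
    rw [abs_mul, mul_comm]
    exact mul_le_mul_of_nonneg_right (abs_clip_le hb _) (abs_nonneg _)
  unfold resid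
  set c := clip b (ϑ + τ * z)
  have e : (τ * z - c) ^ 2 - τ * (z * (τ * z - c)) = -(c * (ϑ + τ * z - c)) + ϑ * c := by ring
  linarith

/-- Second moment of the soft thresholded standard Gaussian. -/
def softMoment (a : ℝ) : ℝ := ∫ z, (max (|z| - a) 0) ^ 2 ∂stdG

lemma continuous_softSq (a : ℝ) : Continuous fun z : ℝ => (max (|z| - a) 0) ^ 2 :=
  ((continuous_abs.sub continuous_const).max continuous_const).pow 2

lemma softSq_le_sq {a : ℝ} (ha : 0 ≤ a) (z : ℝ) : (max (|z| - a) 0) ^ 2 ≤ z ^ 2 := by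
  rw [← sq_abs z]
  refine pow_le_pow_left₀ (le_max_right _ _) (max_le (by linarith) (abs_nonneg _)) 2

lemma integrable_softSq {a : ℝ} (ha : 0 ≤ a) :
    Integrable (fun z : ℝ => (max (|z| - a) 0) ^ 2) stdG :=
  (integrable_pow_stdG 2).mono' (continuous_softSq a).aestronglyMeasurable
    (.of_forall fun z => by
      rw [Real.norm_of_nonneg (sq_nonneg _)]; exact softSq_le_sq ha z)

lemma softMoment_nonneg (a : ℝ) : 0 ≤ softMoment a := integral_nonneg fun _ => sq_nonneg _

lemma softMoment_le_one {a : ℝ} (ha : 0 ≤ a) : softMoment a ≤ 1 := by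
  rw [← integral_sq_stdG]
  exact integral_mono (integrable_softSq ha) (integrable_pow_stdG 2) fun z => softSq_le_sq ha z

lemma softMoment_le {a : ℝ} (ha : 0 < a) : softMoment a ≤ (∫ z, z ^ 4 ∂stdG) / a ^ 2 := by
  rw [← integral_div]
  refine integral_mono (integrable_softSq ha.le) ((integrable_pow_stdG 4).div_const _) fun z => ?_
  simp only
  rw [le_div_iff₀ (by positivity)]
  rcases le_or_gt |z| a with h | h
  · rw [max_eq_right (by linarith), zero_pow two_ne_zero, zero_mul]; positivity
  · have h1 := softSq_le_sq ha.le z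
    have h2 : a ^ 2 ≤ z ^ 2 := by
      rw [← sq_abs z]; exact pow_le_pow_left₀ ha.le h.le 2
    calc _ ≤ z ^ 2 * z ^ 2 := mul_le_mul h1 h2 (by positivity) (by positivity)
      _ = z ^ 4 := by ring

/-- Completing the square in the direction of the sign of `ϑ`. -/
lemma quad_le_shifted_sq {a τ ϑ : ℝ} (ha : 0 ≤ a) (hτ : 0 ≤ τ) :
    ∃ s : ℝ, s ^ 2 = 1 ∧ ∀ w z : ℝ,
      2 * τ * (z * w) - w ^ 2 - 2 * a * τ * (|ϑ + w| - |ϑ|) ≤ τ ^ 2 * (z - a * s) ^ 2 := by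
  have key : ∀ s w z d : ℝ, s * w ≤ d →
      2 * τ * (z * w) - w ^ 2 - 2 * a * τ * d ≤ τ ^ 2 * (z - a * s) ^ 2 := by
    intro s w z d h
    have h1 := mul_le_mul_of_nonneg_left h (mul_nonneg ha hτ)
    have h2 := sq_nonneg (τ * (z - a * s) - w)
    linarith
  rcases le_or_gt 0 ϑ with h | h
  · refine ⟨1, by norm_num, fun w z => key _ _ _ _ ?_⟩
    rw [abs_of_nonneg h]; linarith [le_abs_self (ϑ + w)]
  · refine ⟨-1, by norm_num, fun w z => key _ _ _ _ ?_⟩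
    rw [abs_of_neg h]; linarith [neg_le_abs (ϑ + w)]

lemma quad_le_softSq {a τ : ℝ} (ha : 0 ≤ a) (hτ : 0 ≤ τ) (ϑ w z : ℝ) :
    2 * τ * (z * w) - w ^ 2 - 2 * a * τ * (|ϑ + w| - |ϑ|) ≤
      τ ^ 2 * (max (|z| - a) 0) ^ 2 + 4 * a * τ * |ϑ| := by
  have h1 : |w| - 2 * |ϑ| ≤ |ϑ + w| - |ϑ| := by
    have := abs_sub (ϑ + w) ϑ
    rw [add_sub_cancel_left] at this
    linarith
  have h2 := mul_le_mul_of_nonneg_left h1 (mul_nonneg ha hτ)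
  have h3 : z * w ≤ |z| * |w| := (le_abs_self _).trans_eq (abs_mul _ _)
  have h4 := mul_le_mul_of_nonneg_left h3 hτ
  have h5 : (|z| - a) * |w| ≤ max (|z| - a) 0 * |w| :=
    mul_le_mul_of_nonneg_right (le_max_left _ _) (abs_nonneg _)
  have h6 := mul_le_mul_of_nonneg_left h5 hτ
  have h7 := sq_nonneg (τ * max (|z| - a) 0 - |w|)
  have h8 := sq_abs w
  linarith

end ScalarBounds

section ParameterBounds

lemma integral_shifted_sq {a s : ℝ} (hs : s ^ 2 = 1) :
    Integrable (fun z : ℝ => (z - a * s) ^ 2) stdG ∧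
      ∫ z, (z - a * s) ^ 2 ∂stdG = 1 + a ^ 2 := by
  have i1 : Integrable (fun z : ℝ => z) stdG := by simpa using integrable_pow_stdG 1
  have i2 : Integrable (fun z : ℝ => z ^ 2 - 2 * a * s * z) stdG :=
    (integrable_pow_stdG 2).sub (i1.const_mul (2 * a * s))
  have e : (fun z : ℝ => (z - a * s) ^ 2) = fun z => z ^ 2 - 2 * a * s * z + a ^ 2 := by
    funext z
    have : a ^ 2 = a ^ 2 * s ^ 2 := by rw [hs, mul_one]
    rw [this]; ring
  have hz : ∫ z : ℝ, z ∂stdG = 0 := by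
    unfold stdG; exact integral_id_gaussianReal
  have : IsProbabilityMeasure stdG := by unfold stdG; infer_instance
  rw [e]
  refine ⟨i2.add (integrable_const _), ?_⟩
  rw [integral_add i2 (integrable_const _), integral_sub (integrable_pow_stdG 2)
    (i1.const_mul _), integral_const_mul, hz, integral_sq_stdG]
  simp

variable {N n : ℕ} {θ : Fin N → ℝ} {δ σ lam β τ a κ m s : ℝ}

/-- The number of coordinates exceeding the level `t`. -/
def largeCount (θ : Fin N → ℝ) (t : ℝ) : ℝ := ((Finset.univ.filter fun i => t < |θ i|).card : ℝ)

lemma sum_ite_largeCount (θ : Fin N → ℝ) (t u v : ℝ) :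
    ∑ i, (if t < |θ i| then u else v) = largeCount θ t * u + (N - largeCount θ t) * v := by
  rw [Finset.sum_ite, Finset.sum_const, Finset.sum_const, nsmul_eq_mul, nsmul_eq_mul]
  have h := Finset.card_filter_add_card_filter_not (s := (Finset.univ : Finset (Fin N)))
    (fun i => t < |θ i|)
  rw [Finset.card_univ, Fintype.card_fin] at h
  have h' : ((Finset.univ.filter fun i => ¬ t < |θ i|).card : ℝ) = N - largeCount θ t := by
    unfold largeCount
    have : ((Finset.univ.filter fun i => t < |θ i|).card : ℝ) +
      (Finset.univ.filter fun i => ¬ t < |θ i|).card = N := by exact_mod_cast h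
    linarith
  rw [h']; rfl

lemma largeCount_le (θ : Fin N → ℝ) (t : ℝ) : largeCount θ t ≤ N := by
  unfold largeCount
  have := Finset.card_le_univ (Finset.univ.filter fun i => t < |θ i|)
  rw [Fintype.card_fin] at this
  exact_mod_cast this

lemma largeCount_nonneg (θ : Fin N → ℝ) (t : ℝ) : 0 ≤ largeCount θ t := Nat.cast_nonneg _

/-- The expected increase of the `ℓ¹` norm at a soft thresholding estimate. -/
def l1Gain (τ b ϑ : ℝ) : ℝ := ∫ z, (|ϑ + resid ϑ τ b z| - |ϑ|) ∂stdG

lemma integrable_l1Gain {b : ℝ} (hb : 0 ≤ b) (hτ : 0 ≤ τ) (ϑ : ℝ) :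
    Integrable (fun z => |ϑ + resid ϑ τ b z| - |ϑ|) stdG := by
  have hc : Continuous fun z => |ϑ + resid ϑ τ b z| - |ϑ| := by
    have := continuous_resid ϑ τ b
    exact (continuous_const.add this).abs.sub continuous_const
  refine integrable_of_le_quadratic (K := τ + b) hc.measurable fun z => ?_
  have h1 : |(|ϑ + resid ϑ τ b z| - |ϑ|)| ≤ |resid ϑ τ b z| := by
    have := abs_abs_sub_abs_le (ϑ + resid ϑ τ b z) ϑ
    rwa [add_sub_cancel_left] at this
  refine h1.trans ((abs_resid_le hτ hb ϑ z).trans ?_)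
  have h2 : |z| ≤ 1 + z ^ 2 := by
    rw [← sq_abs]; nlinarith [sq_nonneg (|z| - 1)]
  nlinarith [mul_le_mul_of_nonneg_left h2 hτ, mul_nonneg hb (sq_nonneg z)]

lemma integrable_resid_sq {b : ℝ} (hb : 0 ≤ b) (ϑ : ℝ) :
    Integrable (fun z => resid ϑ τ b z ^ 2) stdG := by
  have hc : Continuous fun z => resid ϑ τ b z ^ 2 := (continuous_resid ϑ τ b).pow 2
  refine integrable_of_le_quadratic (K := 2 * τ ^ 2 + 2 * b ^ 2) hc.measurable fun z => ?_
  rw [abs_of_nonneg (sq_nonneg _)]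
  refine (resid_sq_le hb ϑ z).trans ?_
  nlinarith [mul_nonneg (sq_nonneg b) (sq_nonneg z), sq_nonneg τ]

lemma integrable_mul_resid {b : ℝ} (hb : 0 ≤ b) (hτ : 0 ≤ τ) (ϑ : ℝ) :
    Integrable (fun z => z * resid ϑ τ b z) stdG := by
  have hc : Continuous fun z => z * resid ϑ τ b z := by
    have := continuous_resid ϑ τ b
    fun_prop
  refine integrable_of_le_quadratic (K := τ + b) hc.measurable fun z => ?_
  rw [abs_mul]
  have h1 := mul_le_mul_of_nonneg_left (abs_resid_le hτ hb ϑ z) (abs_nonneg z)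
  refine h1.trans ?_
  have h2 : |z| ≤ 1 + z ^ 2 := by
    rw [← sq_abs]; nlinarith [sq_nonneg (|z| - 1)]
  have h3 : |z| * (τ * |z| + b) = τ * z ^ 2 + b * |z| := by rw [← sq_abs z]; ring
  rw [h3]
  nlinarith [mul_le_mul_of_nonneg_left h2 hb]

lemma mul_l1Gain_le {b : ℝ} (hb : 0 ≤ b) (hτ : 0 < τ) (ϑ : ℝ) :
    ∫ z, resid ϑ τ b z ^ 2 ∂stdG - τ * (τ * tailProb ϑ τ b) + b * l1Gain τ b ϑ ≤ 0 := by
  have i1 := integrable_resid_sq (τ := τ) hb ϑ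
  have i2 := (integrable_mul_resid hb hτ.le ϑ).const_mul τ
  have i3 := (integrable_l1Gain hb hτ.le ϑ).const_mul b
  have i12 : Integrable (fun z => resid ϑ τ b z ^ 2 - τ * (z * resid ϑ τ b z)) stdG := i1.sub i2
  rw [← integral_mul_resid hb hτ, l1Gain, ← integral_const_mul, ← integral_const_mul,
    ← integral_sub i1 i2, ← integral_add i12 i3]
  exact integral_nonpos fun z => resid_optimality hb ϑ τ z

lemma quad_integral_le {b : ℝ} (hb : 0 ≤ b) (hτ : 0 < τ) (ha : 0 ≤ a) (κ ϑ : ℝ) :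
    2 * τ * (τ * tailProb ϑ τ b) - ∫ z, resid ϑ τ b z ^ 2 ∂stdG - 2 * a * τ * l1Gain τ b ϑ ≤
      τ ^ 2 * if κ * τ < |ϑ| then 1 + a ^ 2 else softMoment a + 4 * a * κ := by
  have : IsProbabilityMeasure stdG := by unfold stdG; infer_instance
  have i1 := integrable_resid_sq (τ := τ) hb ϑ
  have i2 := (integrable_mul_resid hb hτ.le ϑ).const_mul (2 * τ)
  have i3 := (integrable_l1Gain hb hτ.le ϑ).const_mul (2 * a * τ)
  have i12 : Integrable (fun z => 2 * τ * (z * resid ϑ τ b z) - resid ϑ τ b z ^ 2) stdG :=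
    i2.sub i1
  have i123 : Integrable (fun z => 2 * τ * (z * resid ϑ τ b z) - resid ϑ τ b z ^ 2 -
    2 * a * τ * (|ϑ + resid ϑ τ b z| - |ϑ|)) stdG := i12.sub i3
  rw [← integral_mul_resid hb hτ, l1Gain, ← integral_const_mul, ← integral_const_mul,
    ← integral_sub i2 i1, ← integral_sub i12 i3]
  split_ifs with h
  · obtain ⟨s, hs, hq⟩ := quad_le_shifted_sq (ϑ := ϑ) ha hτ.le
    obtain ⟨i4, e4⟩ := integral_shifted_sq (a := a) hs
    rw [← e4, ← integral_const_mul]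
    exact integral_mono i123 (i4.const_mul _) fun z => hq _ z
  · have i5 : Integrable (fun z : ℝ => τ ^ 2 * (max (|z| - a) 0) ^ 2 + 4 * a * τ * |ϑ|) stdG :=
      ((integrable_softSq ha).const_mul _).add (integrable_const _)
    refine (integral_mono i123 i5 fun z => quad_le_softSq ha hτ.le ϑ _ z).trans ?_
    rw [integral_add ((integrable_softSq ha).const_mul _) (integrable_const _),
      integral_const_mul, integral_const, probReal_univ, one_smul, ← softMoment]
    have h1 := mul_le_mul_of_nonneg_left (not_lt.1 h) (mul_nonneg ha hτ.le)
    linarith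

/-- A priori bound on the effective noise level. -/
lemma tau_le_of_largeCount (hδ : 0 < δ) (hN : 0 < N) (hn : (n : ℝ) = δ * N) (hσ : 0 < σ)
    (hl : 0 < lam) (hSE : StateEvo δ σ (empDist θ) lam β τ) (hστ : σ ≤ τ) (ha : 0 < a)
    (hm : largeCount θ (κ * τ) * (1 + a ^ 2) +
      (N - largeCount θ (κ * τ)) * (softMoment a + 4 * a * κ) ≤ N * m) :
    2 * a * lam * τ * (1 - m / δ) ≤ (a * σ + lam) ^ 2 := by
  obtain ⟨h1, h2, -⟩ := stateEvo_sums hδ hN hn hl hSE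
  obtain ⟨hβ, hτ, -, -⟩ := hSE
  have hN' : (0 : ℝ) < N := by exact_mod_cast hN
  set b := τ * lam / β with hbdef
  have hb : 0 ≤ b := by positivity
  have hL1 := Finset.sum_le_sum fun i (_ : i ∈ Finset.univ) => mul_l1Gain_le hb hτ (θ i)
  have hL2 := Finset.sum_le_sum fun i (_ : i ∈ Finset.univ) =>
    quad_integral_le hb hτ ha.le κ (θ i)
  rw [Finset.sum_add_distrib, Finset.sum_sub_distrib, ← Finset.mul_sum, ← Finset.mul_sum,
    ← Finset.mul_sum, h1, h2, Finset.sum_const_zero] at hL1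
  rw [Finset.sum_sub_distrib, Finset.sum_sub_distrib, ← Finset.mul_sum, ← Finset.mul_sum,
    ← Finset.mul_sum, ← Finset.mul_sum, h1, h2, sum_ite_largeCount] at hL2
  set L := ∑ i, l1Gain τ b (θ i)
  have hL3 := hL2.trans (mul_le_mul_of_nonneg_left hm (sq_nonneg τ))
  have hn0 : (0 : ℝ) < n := hn ▸ mul_pos hδ hN'
  have hm' : (N : ℝ) * m = n * (m / δ) := by rw [hn]; field_simp
  rw [hm'] at hL3
  set μ := m / δ
  have e1 : τ * (τ * (n * (1 - β / τ))) = n * (τ ^ 2 - τ * β) := by field_simp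
  have e2 : 2 * τ * (τ * (n * (1 - β / τ))) = 2 * (n * (τ ^ 2 - τ * β)) := by rw [← e1]; ring
  rw [e1] at hL1
  rw [e2] at hL3
  have hA : b * L ≤ n * (σ ^ 2 - τ * β) := by linarith
  have hB : n * (τ ^ 2 - 2 * τ * β + σ ^ 2 - τ ^ 2 * μ) ≤ 2 * a * τ * L := by linarith
  have hC := mul_le_mul_of_nonneg_left hB hb
  have hD := mul_le_mul_of_nonneg_left hA (by positivity : 0 ≤ 2 * a * τ)
  have hE : b * (n * (τ ^ 2 - 2 * τ * β + σ ^ 2 - τ ^ 2 * μ)) ≤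
      2 * a * τ * (n * (σ ^ 2 - τ * β)) := by linarith
  have hF : lam * (τ ^ 2 - 2 * τ * β + σ ^ 2 - τ ^ 2 * μ) ≤ 2 * a * β * (σ ^ 2 - τ * β) := by
    refine le_of_mul_le_mul_left ?_ (by positivity : 0 < n * τ / β)
    have e3 : n * τ / β * (lam * (τ ^ 2 - 2 * τ * β + σ ^ 2 - τ ^ 2 * μ)) =
        b * (n * (τ ^ 2 - 2 * τ * β + σ ^ 2 - τ ^ 2 * μ)) := by rw [hbdef]; ring
    have e4 : n * τ / β * (2 * a * β * (σ ^ 2 - τ * β)) = 2 * a * τ * (n * (σ ^ 2 - τ * β)) := by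
      field_simp
    rw [e3, e4]; exact hE
  have hG : lam * τ * (1 - μ) ≤ 2 * β * (a * σ + lam) - 2 * a * β ^ 2 := by
    refine le_of_mul_le_mul_left ?_ hτ
    have h3 := mul_le_mul_of_nonneg_left hστ (by positivity : 0 ≤ 2 * a * β * σ)
    have h4 : 0 ≤ lam * σ ^ 2 := by positivity
    linarith
  have hH := mul_le_mul_of_nonneg_left hG (by positivity : 0 ≤ 2 * a)
  have hI := sq_nonneg (a * σ + lam - 2 * a * β)
  linarith

lemma stdG_real_abs_ge_le {t : ℝ} (ht : 0 < t) : stdG.real {z | t ≤ |z|} ≤ 1 / t ^ 2 := by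
  have : IsProbabilityMeasure stdG := by unfold stdG; infer_instance
  have hs : MeasurableSet {z : ℝ | t ≤ |z|} :=
    measurableSet_le measurable_const continuous_abs.measurable
  rw [stdG_real_eq_integral _ hs, ← integral_sq_stdG, ← integral_div]
  refine integral_mono ((integrable_const (1 : ℝ)).indicator hs)
    ((integrable_pow_stdG 2).div_const _) fun z => ?_
  simp only
  by_cases hz : z ∈ {z : ℝ | t ≤ |z|}
  · rw [Set.indicator_of_mem hz, Pi.one_apply, le_div_iff₀ (by positivity), one_mul, ← sq_abs z]
    exact pow_le_pow_left₀ ht.le hz.out 2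
  · rw [Set.indicator_of_notMem hz]; positivity

lemma tailProb_le_ite (hτ : 0 < τ) {α : ℝ} (hα : κ < α) (ϑ : ℝ) :
    tailProb ϑ τ (α * τ) ≤ if κ * τ < |ϑ| then 1 else 1 / (α - κ) ^ 2 := by
  have : IsProbabilityMeasure stdG := by unfold stdG; infer_instance
  split_ifs with h
  · exact measureReal_le_one
  · refine le_trans (measureReal_mono fun z hz => ?_) (stdG_real_abs_ge_le (sub_pos.2 hα))
    have h1 := hz.out.trans (abs_add_le ϑ (τ * z))
    rw [abs_mul, abs_of_pos hτ] at h1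
    refine le_of_mul_le_mul_left ?_ hτ
    linarith [not_lt.1 h]

/-- A priori bound on the ratio of the two state evolution parameters. -/
lemma ratio_ge_of_largeCount (hδ : 0 < δ) (hN : 0 < N) (hn : (n : ℝ) = δ * N) (hl : 0 < lam)
    (hSE : StateEvo δ σ (empDist θ) lam β τ) (hα : κ < lam / β)
    (hs : largeCount θ (κ * τ) ≤ N * s) :
    δ * (1 - β / τ) ≤ s + 1 / (lam / β - κ) ^ 2 := by
  obtain ⟨-, h2, -⟩ := stateEvo_sums hδ hN hn hl hSE
  obtain ⟨hβ, hτ, -, -⟩ := hSE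
  have hN' : (0 : ℝ) < N := by exact_mod_cast hN
  have h3 := Finset.sum_le_sum fun i (_ : i ∈ Finset.univ) =>
    tailProb_le_ite hτ hα (θ i)
  rw [show τ * lam / β = lam / β * τ by ring] at h2
  rw [h2, sum_ite_largeCount, hn] at h3
  have h4 : 0 ≤ 1 / (lam / β - κ) ^ 2 := by positivity
  have h5 := mul_nonneg (largeCount_nonneg θ (κ * τ)) h4
  refine le_of_mul_le_mul_left ?_ hN'
  linarith

end ParameterBounds

section Classes

lemma gphi_eq (x : ℝ) : gphi x = gaussianPDFReal 0 1 x := by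
  unfold gphi gaussianPDFReal
  simp only [NNReal.coe_one, mul_one, sub_zero]
  ring

lemma integrable_poly_mul_gauss (c d e : ℝ) :
    Integrable fun x : ℝ => (c * x ^ 2 + d * x + e) * gaussianPDFReal 0 1 x := by
  have i1 : Integrable (fun z : ℝ => z) stdG := by simpa using integrable_pow_stdG 1
  have h : Integrable (fun x : ℝ => c * x ^ 2 + d * x + e) stdG := by
    have : IsProbabilityMeasure stdG := by unfold stdG; infer_instance
    exact (((integrable_pow_stdG 2).const_mul c).add (i1.const_mul d)).add (integrable_const e)
  refine (integrable_stdG_iff.1 h).congr (.of_forall fun x => ?_)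
  simp only; ring

lemma integral_Ioi_sq_mul_gauss (a : ℝ) :
    ∫ x in Set.Ioi a, gaussianPDFReal 0 1 x * (x - a) ^ 2 =
      (1 + a ^ 2) * gPhi (-a) - a * gphi a := by
  have hd : ∀ x, HasDerivAt (fun x => -((x - 2 * a) * gaussianPDFReal 0 1 x))
      ((1 * x ^ 2 + (-(2 * a)) * x + (-1)) * gaussianPDFReal 0 1 x) x := fun x => by
    have := (((hasDerivAt_id x).sub_const (2 * a)).mul (hasDerivAt_gaussianPDFReal_std x)).neg
    convert! this using 1
    simp only [id]; ring
  have hi := integrable_poly_mul_gauss 1 (-(2 * a)) (-1)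
  have hf : Integrable fun x : ℝ => -((x - 2 * a) * gaussianPDFReal 0 1 x) := by
    refine (integrable_poly_mul_gauss 0 (-1) (2 * a)).congr (.of_forall fun x => ?_)
    simp only; ring
  have ht := tendsto_zero_of_hasDerivAt_of_integrableOn_Ioi (a := a) (fun x _ => hd x)
    hi.integrableOn hf.integrableOn
  have h1 := integral_Ioi_of_hasDerivAt_of_tendsto (hd a).continuousAt.continuousWithinAt
    (fun x _ => hd x) hi.integrableOn ht
  have h2 : ∫ x in Set.Ioi a, (1 + a ^ 2) * gaussianPDFReal 0 1 x = (1 + a ^ 2) * gPhi (-a) := by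
    rw [integral_const_mul]
    congr 1
    have := integral_comp_neg_Iic (-a) gphi
    rw [neg_neg] at this
    unfold gPhi
    simp_rw [← gphi_eq]
    rw [← this]
    refine setIntegral_congr_fun measurableSet_Iic fun x _ => ?_
    unfold gphi; simp
  have h3 : ∀ x : ℝ, gaussianPDFReal 0 1 x * (x - a) ^ 2 =
      (1 * x ^ 2 + (-(2 * a)) * x + (-1)) * gaussianPDFReal 0 1 x +
        (1 + a ^ 2) * gaussianPDFReal 0 1 x := fun x => by ring
  simp_rw [h3]
  rw [integral_add hi.integrableOn ((integrable_gaussianPDFReal 0 1).const_mul _).integrableOn,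
    h1, h2, gphi_eq]
  ring

lemma softMoment_eq {a : ℝ} (ha : 0 ≤ a) :
    softMoment a = 2 * ((1 + a ^ 2) * gPhi (-a) - a * gphi a) := by
  unfold softMoment
  rw [integral_stdG, ← integral_Ioi_sq_mul_gauss]
  have h1 := integral_comp_abs (f := fun x => gaussianPDFReal 0 1 x * (max (x - a) 0) ^ 2)
  have h2 : ∀ x : ℝ, gaussianPDFReal 0 1 |x| = gaussianPDFReal 0 1 x := fun x => by
    simp [gaussianPDFReal]
  simp_rw [h2] at h1
  rw [h1]
  congr 1
  have h3 : Set.Ioi a ⊆ Set.Ioi (0 : ℝ) := Set.Ioi_subset_Ioi ha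
  rw [← integral_indicator measurableSet_Ioi, ← integral_indicator measurableSet_Ioi]
  congr 1
  funext x
  by_cases hx : x ∈ Set.Ioi a
  · rw [Set.indicator_of_mem hx, Set.indicator_of_mem (h3 hx),
      max_eq_left (by linarith [hx.out])]
  · have : x ≤ a := not_lt.1 hx
    rw [Set.indicator_of_notMem hx, Set.indicator_apply, max_eq_right (by linarith)]
    simp

/-- Below the critical sparsity some threshold has risk smaller than `δ`. -/
lemma exists_risk_lt_of_lt_smax {δ s : ℝ} (hδ : 0 < δ) (hs0 : 0 ≤ s) (hs : s < smax δ) :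
    ∃ a : ℝ, 0 < a ∧ s * (1 + a ^ 2 - softMoment a) + softMoment a < δ := by
  unfold smax at hs
  rw [← div_lt_iff₀' hδ] at hs
  obtain ⟨_, ⟨a, ha, rfl⟩, h⟩ := exists_lt_of_lt_csSup (Set.image_nonempty.2 ⟨0, by simp⟩) hs
  have ha : 0 ≤ a := ha
  have hg := softMoment_eq ha
  simp only [div_mul_eq_mul_div, ← hg] at h
  have hle := softMoment_le_one ha
  rcases ha.lt_or_eq with ha | rfl
  · refine ⟨a, ha, ?_⟩
    have hD : 0 < 1 + a ^ 2 - softMoment a := by nlinarith [pow_pos ha 2]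
    rw [lt_div_iff₀ hD, div_mul_eq_mul_div, div_lt_iff₀ hδ, sub_mul, div_mul_cancel₀ _ hδ.ne']
      at h
    linarith
  · have h0 : softMoment 0 = 1 := by
      unfold softMoment
      rw [← integral_sq_stdG]
      congr 1; funext z
      rw [sub_zero, max_eq_left (abs_nonneg z), sq_abs]
    rw [h0] at h
    norm_num at h
    have := div_nonneg hs0 hδ.le
    linarith

/-- The class contains only vectors for which some threshold has risk below `δ`. -/
def RiskBound (δ : ℝ) (D : (M : ℕ) → Set (Fin M → ℝ)) : Prop :=
  ∃ a κ m T : ℝ, 0 < a ∧ m < δ ∧ ∀ N, ∀ θ ∈ D N, ∀ τ, 0 < N → T ≤ τ →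
    largeCount θ (κ * τ) * (1 + a ^ 2) +
      (N - largeCount θ (κ * τ)) * (softMoment a + 4 * a * κ) ≤ N * m

/-- For large thresholds the fraction of selected coordinates is bounded away from `δ`. -/
def SelectionBound (δ σ : ℝ) (D : (M : ℕ) → Set (Fin M → ℝ)) : Prop :=
  ∃ α₀ r : ℝ, 0 < α₀ ∧ 0 < r ∧ ∀ N, ∀ θ ∈ D N, ∀ τ α, 0 < N → σ ≤ τ → α₀ ≤ α →
    ∃ κ s : ℝ, κ < α ∧ largeCount θ (κ * τ) ≤ N * s ∧ s + 1 / (α - κ) ^ 2 ≤ δ * (1 - r)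

lemma largeCount_zero_eq_l0 {N : ℕ} (θ : Fin N → ℝ) : largeCount θ 0 = l0 θ := by
  unfold largeCount l0
  simp only [abs_pos]

lemma one_div_sq_le {c t : ℝ} (hc : 0 < c) (ht : 1 / c + 1 ≤ t) : 1 / t ^ 2 ≤ c := by
  have h0 : 0 < 1 / c := by positivity
  have h1 : 1 / c ≤ t ^ 2 := by nlinarith
  rw [div_le_iff₀ (by nlinarith)]
  rwa [div_le_iff₀' hc] at h1

lemma F0ball_bounds {δ σ s : ℝ} (hδ : 0 < δ) (hs0 : 0 ≤ s) (hs : s < smax δ)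
    {D : (M : ℕ) → Set (Fin M → ℝ)} (hD : ∀ M, D M = F0ball M s) :
    RiskBound δ D ∧ SelectionBound δ σ D := by
  obtain ⟨a, ha, h⟩ := exists_risk_lt_of_lt_smax hδ hs0 hs
  have hg1 := softMoment_le_one ha.le
  have hg0 := softMoment_nonneg a
  have ha2 : 0 < a ^ 2 := by positivity
  set u := min s 1 with hu
  have hus : u ≤ s := min_le_left _ _
  have hu1 : u ≤ 1 := min_le_right _ _
  have hu0 : 0 ≤ u := le_min hs0 zero_le_one
  have hcount : ∀ N, ∀ θ ∈ D N, largeCount θ 0 ≤ N * u := fun N θ hθ => by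
    rw [hD] at hθ
    have h1 := hθ.out
    rw [← largeCount_zero_eq_l0] at h1
    rcases min_choice s 1 with h2 | h2
    · rw [hu, h2]; linarith
    · rw [hu, h2, mul_one]; exact largeCount_le θ 0
  have hm : u * (1 + a ^ 2 - softMoment a) + softMoment a < δ := by
    have := mul_le_mul_of_nonneg_right hus (by linarith : 0 ≤ 1 + a ^ 2 - softMoment a)
    linarith
  have huδ : u < δ := by
    have h1 := mul_nonneg (by linarith : 0 ≤ 1 - u) hg0
    have h2 := mul_nonneg hu0 ha2.le
    linarith
  refine ⟨⟨a, 0, _, 0, ha, hm, fun N θ hθ τ _ _ => ?_⟩, ?_⟩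
  · rw [zero_mul, mul_zero, add_zero]
    have := mul_le_mul_of_nonneg_right (hcount N θ hθ)
      (by linarith : 0 ≤ 1 + a ^ 2 - softMoment a)
    linarith
  · have hc : 0 < (δ - u) / 2 := by linarith
    refine ⟨1 / ((δ - u) / 2) + 1, (δ - u) / (2 * δ), by positivity,
      div_pos (by linarith) (by linarith), fun N θ hθ τ α _ _ hα => ⟨0, u, ?_, ?_, ?_⟩⟩
    · have : 0 < 1 / ((δ - u) / 2) := by positivity
      linarith
    · rw [zero_mul]; exact hcount N θ hθ
    · rw [sub_zero]
      have h1 := one_div_sq_le hc hα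
      have h2 : δ * (1 - (δ - u) / (2 * δ)) = δ - (δ - u) / 2 := by field_simp
      linarith

lemma largeCount_le_of_mem_Fball {N : ℕ} {p ξ t : ℝ} (hp : 0 < p) (hξ : 0 < ξ) (ht : 0 < t)
    (hN : 0 < N) {θ : Fin N → ℝ} (hθ : θ ∈ Fball N p ξ) :
    largeCount θ t ≤ N * (ξ / t) ^ p := by
  have hN' : (0 : ℝ) < N := by exact_mod_cast hN
  have h1 := hθ.out
  rw [one_div, inv_mul_le_iff₀ hN'] at h1
  have h2 : largeCount θ t * t ^ p ≤ ∑ i, |θ i| ^ p := by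
    have h3 := sum_ite_largeCount θ t (t ^ p) 0
    rw [mul_zero, add_zero] at h3
    rw [← h3]
    refine Finset.sum_le_sum fun i _ => ?_
    split_ifs with h
    · exact Real.rpow_le_rpow ht.le h.le hp.le
    · positivity
  rw [Real.div_rpow hξ.le ht.le, ← mul_div_assoc, le_div_iff₀ (by positivity)]
  exact h2.trans h1

lemma exists_rpow_le {p ξ c : ℝ} (hp : 0 < p) (hξ : 0 < ξ) (hc : 0 < c) :
    ∃ T : ℝ, 0 < T ∧ ∀ t, T ≤ t → (ξ / t) ^ p ≤ c := by
  have hc' : 0 < c ^ (1 / p) := by positivity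
  refine ⟨ξ / c ^ (1 / p), by positivity, fun t ht => ?_⟩
  have ht0 : 0 < t := lt_of_lt_of_le (by positivity) ht
  have h1 : ξ / t ≤ c ^ (1 / p) := by
    rw [div_le_iff₀ hc'] at ht
    rw [div_le_iff₀ ht0]; linarith
  calc (ξ / t) ^ p ≤ (c ^ (1 / p)) ^ p := Real.rpow_le_rpow (by positivity) h1 hp.le
    _ = c := by rw [← Real.rpow_mul hc.le, one_div_mul_cancel hp.ne', Real.rpow_one]

lemma exists_softMoment_le {c : ℝ} (hc : 0 < c) : ∃ a : ℝ, 0 < a ∧ softMoment a ≤ c := by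
  set K := ∫ z : ℝ, z ^ 4 ∂stdG
  have hK : 0 ≤ K := integral_nonneg fun z => by positivity
  refine ⟨K / c + 1, by positivity, (softMoment_le (by positivity)).trans ?_⟩
  rw [div_le_iff₀ (by positivity)]
  have h1 : c * (K / c) = K := by field_simp
  have h2 : 0 ≤ K / c := by positivity
  nlinarith [mul_nonneg hc.le (sq_nonneg (K / c))]

lemma Fball_bounds {δ σ p ξ : ℝ} (hδ : 0 < δ) (hσ : 0 < σ) (hp : 0 < p) (hξ : 0 < ξ)
    {D : (M : ℕ) → Set (Fin M → ℝ)} (hD : ∀ M, D M = Fball M p ξ) :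
    RiskBound δ D ∧ SelectionBound δ σ D := by
  constructor
  · obtain ⟨a, ha, hg⟩ := exists_softMoment_le (c := δ / 4) (by positivity)
    have hg0 := softMoment_nonneg a
    obtain ⟨T, hT, h⟩ := exists_rpow_le (c := δ / (4 * (1 + a ^ 2))) hp hξ (by positivity)
    set κ := δ / (16 * a) with hκ
    have hκ0 : 0 < κ := by positivity
    refine ⟨a, κ, 3 * δ / 4, T / κ, ha, by linarith, fun N θ hθ τ hN hτ => ?_⟩
    rw [hD] at hθ
    have hN' : (0 : ℝ) < N := by exact_mod_cast hN
    have hT' : T ≤ κ * τ := by rwa [div_le_iff₀' hκ0] at hτ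
    have h1 := (largeCount_le_of_mem_Fball hp hξ (hT.trans_le hT') hN hθ).trans
      (mul_le_mul_of_nonneg_left (h _ hT') hN'.le)
    have h2 : largeCount θ (κ * τ) * (1 + a ^ 2) ≤ N * (δ / 4) := by
      refine (mul_le_mul_of_nonneg_right h1 (by positivity)).trans_eq ?_
      field_simp
    have h3 : 4 * a * κ = δ / 4 := by rw [hκ]; field_simp; norm_num
    have h4 : (N - largeCount θ (κ * τ)) * (softMoment a + 4 * a * κ) ≤ N * (δ / 2) :=
      mul_le_mul (by linarith [largeCount_nonneg θ (κ * τ)]) (by linarith) (by positivity) hN'.le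
    linarith
  · obtain ⟨T, hT, h⟩ := exists_rpow_le (c := δ / 4) hp hξ (by positivity)
    refine ⟨2 * (T / σ + (1 / (δ / 4) + 1)), 1 / 2, by positivity, by norm_num,
      fun N θ hθ τ α hN hτ hα => ⟨α / 2, δ / 4, ?_, ?_, ?_⟩⟩
    · have : 0 < 2 * (T / σ + (1 / (δ / 4) + 1)) := by positivity
      linarith
    · rw [hD] at hθ
      have hα' : T / σ ≤ α / 2 := by
        have : 0 < 1 / (δ / 4) + 1 := by positivity
        linarith
      have hT' : T ≤ α / 2 * τ := by
        rw [div_le_iff₀ hσ] at hα'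
        refine hα'.trans (mul_le_mul_of_nonneg_left hτ ?_)
        have : 0 < T / σ := by positivity
        nlinarith
      exact (largeCount_le_of_mem_Fball hp hξ (hT.trans_le hT') hN hθ).trans
        (mul_le_mul_of_nonneg_left (h _ hT') (Nat.cast_nonneg _))
    · have h1 := one_div_sq_le (c := δ / 4) (t := α - α / 2) (by positivity) (by
        have : 0 < T / σ := by positivity
        linarith)
      linarith

/-- Uniform a priori bounds on all parameters over the class. -/
lemma exists_admissible {δ σ lmin lmax : ℝ} (hδ : 0 < δ) (hσ : 0 < σ) (hl : 0 < lmin)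
    (hll : lmin ≤ lmax) {D : (M : ℕ) → Set (Fin M → ℝ)} (hR : RiskBound δ D)
    (hS : SelectionBound δ σ D) :
    ∃ M : ℝ, 1 ≤ M ∧ ∀ N n : ℕ, 0 < N → (n : ℝ) = δ * N → ∀ θ ∈ D N,
      ∀ lam ∈ Set.Icc lmin lmax, ∀ β τ, StateEvo δ σ (empDist θ) lam β τ →
        Admissible M δ σ lam β τ := by
  obtain ⟨a, κ, m, T, ha, hm, hR⟩ := hR
  obtain ⟨α₀, r, hα₀, hr, hS⟩ := hS
  have hmδ : 0 < 1 - m / δ := by rw [sub_pos, div_lt_one hδ]; exact hm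
  have hlmax : 0 < lmax := hl.trans_le hll
  set A := (a * σ + lmax) ^ 2 / (2 * a * lmin * (1 - m / δ)) with hA
  have hA0 : 0 ≤ A := by positivity
  refine ⟨1 + 1 / σ + |T| + A + 1 / (r * σ) + α₀ / lmin + 1 / lmin + lmax + 1 / δ + δ, ?_, ?_⟩
  · have := abs_nonneg T
    have : 0 ≤ 1 / σ + A + 1 / (r * σ) + α₀ / lmin + 1 / lmin + lmax + 1 / δ + δ := by positivity
    linarith
  intro N n hN hn θ hθ lam hlam β τ hSE
  have hl0 : 0 < lam := hl.trans_le hlam.1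
  have hN' : (0 : ℝ) < N := by exact_mod_cast hN
  have hn0 : (0 : ℝ) < n := hn ▸ mul_pos hδ hN'
  obtain ⟨e1, e2, -⟩ := stateEvo_sums hδ hN hn hl0 hSE
  obtain ⟨hβ, hτ, -, -⟩ := id hSE
  have hστ : σ ≤ τ := by
    have h1 : 0 ≤ n * (τ ^ 2 - σ ^ 2) := by
      rw [← e1]
      exact Finset.sum_nonneg fun i _ => integral_nonneg fun z => sq_nonneg _
    have h2 := nonneg_of_mul_nonneg_right h1 hn0
    exact (sq_le_sq₀ hσ.le hτ.le).1 (by linarith)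
  have hβτ : β ≤ τ := by
    have h1 : 0 ≤ n * (1 - β / τ) := by
      rw [← e2]
      exact Finset.sum_nonneg fun i _ => measureReal_nonneg
    have h2 := nonneg_of_mul_nonneg_right h1 hn0
    rwa [sub_nonneg, div_le_one hτ] at h2
  have hτle : τ ≤ |T| + A := by
    rcases le_or_gt T τ with h | h
    · have h1 := tau_le_of_largeCount hδ hN hn hσ hl0 hSE hστ ha (hR N θ hθ τ hN h)
      have h2 : τ ≤ A := by
        rw [hA, le_div_iff₀ (by positivity)]
        calc τ * (2 * a * lmin * (1 - m / δ)) ≤ τ * (2 * a * lam * (1 - m / δ)) := by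
              gcongr; exact hlam.1
          _ = 2 * a * lam * τ * (1 - m / δ) := by ring
          _ ≤ (a * σ + lam) ^ 2 := h1
          _ ≤ _ := by gcongr; exact hlam.2
      linarith [abs_nonneg T]
    · linarith [le_abs_self T]
  have hβge : 1 / β ≤ 1 / (r * σ) + α₀ / lmin := by
    have p1 : 0 < 1 / (r * σ) := by positivity
    have p2 : 0 < α₀ / lmin := by positivity
    rcases le_or_gt α₀ (lam / β) with h | h
    · obtain ⟨k, s, hk, hc, hs⟩ := hS N θ hθ τ (lam / β) hN hστ h
      have h1 := (ratio_ge_of_largeCount hδ hN hn hl0 hSE hk hc).trans hs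
      have h2 := le_of_mul_le_mul_left h1 hδ
      have h3 : r ≤ β / τ := by linarith
      rw [le_div_iff₀ hτ] at h3
      have h4 : r * σ ≤ β := (mul_le_mul_of_nonneg_left hστ hr.le).trans h3
      have := one_div_le_one_div_of_le (by positivity) h4
      linarith
    · have h1 : 1 / β ≤ α₀ / lmin := by
        rw [div_lt_iff₀ hβ] at h
        rw [div_le_div_iff₀ hβ hl]
        linarith [hlam.1]
      linarith
  have q1 : 0 < 1 / σ := by positivity
  have q2 : 0 < 1 / (r * σ) := by positivity
  have q3 : 0 < α₀ / lmin := by positivity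
  have q4 : 0 < 1 / lmin := by positivity
  have q5 : 0 < 1 / δ := by positivity
  have q6 := abs_nonneg T
  set M := 1 + 1 / σ + |T| + A + 1 / (r * σ) + α₀ / lmin + 1 / lmin + lmax + 1 / δ + δ with hM
  have hM0 : 0 < M := by linarith
  have h4 := one_div_le_one_div_of_le hl hlam.1
  exact ⟨by linarith, (one_div_le hM0 hσ).2 (by linarith), hστ, by linarith,
    (one_div_le hM0 hβ).2 (by linarith), hβτ, (one_div_le hM0 hl0).2 (by linarith),
    by linarith [hlam.2], (one_div_le hM0 hδ).2 (by linarith), by linarith⟩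

lemma DFamSpec.bounds {δ σ q : ℝ} (hδ : 0 < δ) (hσ : 0 < σ) {D : (M : ℕ) → Set (Fin M → ℝ)}
    (h : DFamSpec δ D q) : RiskBound δ D ∧ SelectionBound δ σ D := by
  rcases h with ⟨p, ξ, hp, hξ, hD, -⟩ | ⟨s, hs0, hs, hD, -⟩
  · exact Fball_bounds hδ hσ hp hξ hD
  · exact F0ball_bounds hδ hs0 hs hD

lemma DFamSpec.exponent_nonneg {δ q : ℝ} {D : (M : ℕ) → Set (Fin M → ℝ)}
    (h : DFamSpec δ D q) : 0 ≤ q := by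
  rcases h with ⟨p, ξ, -, -, -, rfl⟩ | ⟨s, -, -, -, rfl⟩
  · exact le_max_right _ _
  · exact le_rfl

end Classes

/-- Theorem (sparsity of the Lasso estimator): uniform control of ‖θ̂_λ‖₀/N
around s⋆(λ), over λ and θ⋆. -/
theorem stmt4 (δ σ lmin lmax q : ℝ)
    (hδ : 0 < δ) (hσ : 0 < σ) (hl : 0 < lmin) (hll : lmin ≤ lmax)
    (Dfam : (M : ℕ) → Set (Fin M → ℝ))
    (hD : DFamSpec δ Dfam q) :
    ∃ C c : ℝ, 0 < C ∧ 0 < c ∧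
      ∀ (N n : ℕ), 0 < N → (n : ℝ) = δ * N →
      ∀ θstar ∈ Dfam N,
      ∀ βstar τstar : ℝ → ℝ,
      (∀ lam ∈ Set.Icc lmin lmax,
        StateEvo δ σ (empDist θstar) lam (βstar lam) (τstar lam)) →
      ∀ θhat : ℝ → (Fin n → Fin N → ℝ) → (Fin n → ℝ) → (Fin N → ℝ),
      (∀ lam ∈ Set.Icc lmin lmax, ∀ (X : Fin n → Fin N → ℝ) (z : Fin n → ℝ),
        IsMinOn (lassoCost X (yvec σ θstar X z) lam) Set.univ (θhat lam X z)) →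
      ∀ ε : ℝ, ε ∈ Set.Ioo (0 : ℝ) 1 →
      Pmodel n N
        {ω | ∃ lam ∈ Set.Icc lmin lmax,
          ε ≤ |(1 / (N : ℝ)) * (l0 (θhat lam ω.1 ω.2) : ℝ)
              - sStar (empDist θstar) (τstar lam) (lam / βstar lam)|}
      ≤ ENNReal.ofReal (C / ε ^ 6 * (N : ℝ) ^ q * Real.exp (-c * N * ε ^ 6)) := by
  obtain ⟨hR, hS⟩ := hD.bounds hδ hσ
  obtain ⟨M, hM, hA⟩ := exists_admissible hδ hσ hl hll hR hS
  obtain ⟨C, c, hC, hc, h⟩ :=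
    sparsity_bound_of_admissible hM (σ := σ) hδ hl hll hD.exponent_nonneg
  exact ⟨C, c, hC, hc, fun N n hN hn θ hθ βs τs hSE θhat hmin ε hε =>
    h N n hN hn θ βs τs hSE (fun lam hlam => hA N n hN hn θ hθ lam hlam _ _ (hSE lam hlam))
      θhat hmin ε hε⟩
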